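/- Let w be a motif with [w] ∈ 𝒢. Then δ(w) + ρ(w) + 3 ≥ L(w). -/

import Mathlib

open scoped Classical

abbrev SL2Z := Matrix.SpecialLinearGroup (Fin 2) ℤ

def Amat : SL2Z := ⟨!![1, 2; 0, 1], by norm_num [Matrix.det_fin_two_of]⟩
def Bmat : SL2Z := ⟨!![1, 0; -2, 1], by norm_num [Matrix.det_fin_two_of]⟩
def Cmat : SL2Z := (Amat * Bmat)⁻¹

def Gamma : Subgroup SL2Z := Subgroup.closure {Amat, Bmat}

/-- The real entry `i j` of a matrix in `SL₂(ℤ)`. -/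
def entry (g : SL2Z) (i j : Fin 2) : ℝ := ((g : Matrix (Fin 2) (Fin 2) ℤ) i j : ℤ)

/-- The Möbius action of `SL₂(ℤ)` on the circle `ℝ ∪ {∞}`. -/
noncomputable def mobius (g : SL2Z) (p : OnePoint ℝ) : OnePoint ℝ :=
  Option.rec (motive := fun _ => OnePoint ℝ)
    (if entry g 1 0 = 0 then OnePoint.infty
     else OnePoint.some (entry g 0 0 / entry g 1 0))
    (fun x => if entry g 1 0 * x + entry g 1 1 = 0 then OnePoint.infty
      else OnePoint.some ((entry g 0 0 * x + entry g 0 1) / (entry g 1 0 * x + entry g 1 1)))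
    p

/-- The fixed-point set of `g` acting on the circle `ℝ ∪ {∞}`. -/
noncomputable def fixedSet (g : SL2Z) : Set (OnePoint ℝ) := {p | mobius g p = p}

/-- `g` is hyperbolic if `|trace g| > 2`. -/
def Hyperbolic (g : SL2Z) : Prop := 2 < |Matrix.trace (g : Matrix (Fin 2) (Fin 2) ℤ)|

/-- Two two-element subsets of the circle are linked if the two points of `Q` lie in
different connected components of the complement of `P`. -/
def Linked (P Q : Set (OnePoint ℝ)) : Prop :=
  ∃ q₁ q₂ : OnePoint ℝ, q₁ ≠ q₂ ∧ Q = {q₁, q₂} ∧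
    connectedComponentIn Pᶜ q₁ ≠ connectedComponentIn Pᶜ q₂

/-- `h` contributes to the count `s(v)`: `v` and `h * v * h⁻¹` are hyperbolic with
linked fixed-point sets. -/
def GoodConj (v h : Gamma) : Prop :=
  Hyperbolic (v : SL2Z) ∧ Hyperbolic ((h * v * h⁻¹ : Gamma) : SL2Z) ∧
    Linked (fixedSet (v : SL2Z)) (fixedSet ((h * v * h⁻¹ : Gamma) : SL2Z))

/-- Twice `s(v)`: the number of double cosets `⟨v⟩ h ⟨v⟩` in `Γ` such that `v` and
`h * v * h⁻¹` are hyperbolic with linked fixed-point sets. -/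
noncomputable def sTwo (v : Gamma) : ℕ :=
  Nat.card (Quot (fun h h' : {h : Gamma // GoodConj v h} =>
    ∃ m k : ℤ, (h' : Gamma) = v ^ m * (h : Gamma) * v ^ k))

/-- `v` is not a proper power in `Γ`. -/
def NotProperPower (v : Gamma) : Prop := ¬ ∃ u : Gamma, ∃ k : ℕ, 2 ≤ k ∧ v = u ^ k

/-- The self-intersection number `I(g) = n² s(v) + n - 1`, where `g = vⁿ` with `v` not a
proper power and `n ≥ 1`, and `s(v)` is half the number of good double cosets. -/
noncomputable def Iγ (g : Gamma) : ℤ :=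
  if h : ∃ p : Gamma × ℕ, 1 ≤ p.2 ∧ NotProperPower p.1 ∧ g = p.1 ^ p.2 then
    (h.choose.2 : ℤ) ^ 2 * ((sTwo h.choose.1 / 2 : ℕ) : ℤ) + (h.choose.2 : ℤ) - 1
  else 0
/-- The three-letter alphabet `{x, y, z}`. -/
inductive Letter | x | y | z
deriving DecidableEq

/-- The letter of `w` at cyclic position `i`. -/
def cget (w : List Letter) (i : ℕ) : Letter := w.getD (i % w.length) Letter.x

/-- `w` is cyclically reduced: nonempty, and any two cyclically consecutive letters differ. -/
def CyclRed (w : List Letter) : Prop :=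
  w ≠ [] ∧ ∀ i : ℕ, i < w.length → cget w i ≠ cget w (i + 1)

/-- The matrix assigned to a consecutive pair of letters:
`xy ↦ A`, `yx ↦ A⁻¹`, `yz ↦ B`, `zy ↦ B⁻¹`, `zx ↦ C`, `xz ↦ C⁻¹`. -/
def pairM : Letter → Letter → SL2Z
  | .x, .y => Amat
  | .y, .x => Amat⁻¹
  | .y, .z => Bmat
  | .z, .y => Bmat⁻¹
  | .z, .x => Cmat
  | .x, .z => Cmat⁻¹
  | _, _ => 1

/-- `φ(w)`: group the letters of `w` into consecutive pairs and multiply the matrices. -/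
def phiM : List Letter → SL2Z
  | [] => 1
  | [_] => 1
  | a :: b :: t => pairM a b * phiM t

lemma pairM_mem (a b : Letter) : pairM a b ∈ Gamma := by
  have hA : Amat ∈ Gamma := Subgroup.subset_closure (by simp)
  have hB : Bmat ∈ Gamma := Subgroup.subset_closure (by simp)
  have hC : Cmat ∈ Gamma := inv_mem (mul_mem hA hB)
  cases a <;> cases b <;>
    simp only [pairM] <;>
    first
      | exact hA | exact hB | exact hC
      | exact inv_mem hA | exact inv_mem hB | exact inv_mem hC
      | exact one_mem _

lemma phiM_mem : ∀ w : List Letter, phiM w ∈ Gamma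
  | [] => one_mem _
  | [_] => one_mem _
  | _ :: b :: t => mul_mem (pairM_mem _ b) (phiM_mem t)

/-- The self-intersection number of the word `w`. -/
noncomputable def Iw (w : List Letter) : ℤ := Iγ ⟨phiM w, phiM_mem w⟩

/-- The combinatorial length `L(w)` (half the number of letters). -/
def Lw (w : List Letter) : ℤ := (w.length : ℤ) / 2
/-- `w` is primitive: as a cyclic word it is not a `k`-fold concatenation of a
shorter word for any `k ≥ 2`. -/
def Primitive (w : List Letter) : Prop :=
  ¬ ∃ u : List Letter, ∃ k : ℕ, 2 ≤ k ∧ u.length < w.length ∧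
      ∃ j : ℕ, w.rotate j = (List.replicate k u).flatten

/-- `w` represents a class of `𝒢`: primitive, cyclically reduced, of even length at least 4. -/
def InG (w : List Letter) : Prop :=
  CyclRed w ∧ Primitive w ∧ 2 ∣ w.length ∧ 4 ≤ w.length

/-- Words representing classes of `𝒢`. -/
def GWord := {w : List Letter // InG w}

/-- `v` is obtained from `u`, or from its reversal, by a cyclic rotation through an
even number of places. -/
def WordEquiv (u v : List Letter) : Prop :=
  ∃ k : ℕ, 2 ∣ k ∧ (v = u.rotate k ∨ v = u.reverse.rotate k)

def GEquiv (u v : GWord) : Prop := WordEquiv u.1 v.1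

/-- The set `𝒢` of equivalence classes. -/
def GClass := Quot GEquiv

/-- The defect `δ(w) = I(w) - L(w)`. -/
noncomputable def deltaW (w : List Letter) : ℤ := Iw w - Lw w

/-- `N_δ(L)`: the number of classes `[w] ∈ 𝒢` with `L(w) = L` and `δ(w) = δ`. -/
noncomputable def Ncount (d L : ℤ) : ℕ :=
  Nat.card {c : GClass // ∃ w : GWord, Quot.mk GEquiv w = c ∧ Lw w.1 = L ∧ deltaW w.1 = d}
/-- The positions `i, i+1, …, i+len-1` (cyclically) form a run of `w`: a maximal cyclic
interval whose letters lie in a two-element subset of `{x, y, z}`. -/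
def RunAt (w : List Letter) (i len : ℕ) : Prop :=
  i < w.length ∧ 2 ≤ len ∧ len < w.length ∧
  (∃ T : Finset Letter, T.card = 2 ∧ ∀ j, j < len → cget w (i + j) ∈ T) ∧
  ¬ (∃ T : Finset Letter, T.card = 2 ∧ ∀ j, j < len + 1 → cget w (i + j) ∈ T) ∧
  ¬ (∃ T : Finset Letter, T.card = 2 ∧ ∀ j, j < len + 1 → cget w (i + w.length - 1 + j) ∈ T)

/-- The type of the run starting at position `i`: the two-element subset of letters it uses. -/
def runType (w : List Letter) (i : ℕ) : Finset Letter := {cget w i, cget w (i + 1)}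

/-- The expansion `w⁺[r]` of `w` at the run starting at position `i`: repeat the
first two letters of the run. -/
def expandAt (w : List Letter) (i : ℕ) : List Letter :=
  w.take i ++ [cget w i, cget w (i + 1)] ++ w.drop i

/-- The contraction `w⁻[r]` of `w` at the run starting at position `i`: delete the
first two letters of the run. -/
def contractAt (w : List Letter) (i : ℕ) : List Letter :=
  if i + 1 < w.length then w.take i ++ w.drop (i + 2)
  else (w.drop 1).dropLast

/-- The run at `(i, len)` is distinguished: strictly longer than every other run of the
same type. -/
def DistinguishedRun (w : List Letter) (i len : ℕ) : Prop :=
  RunAt w i len ∧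
    ∀ i' len', RunAt w i' len' → runType w i' = runType w i → i' ≠ i → len' < len

/-- The rank `ρ(w)`: the number of distinguished runs of `w`. -/
noncomputable def rank (w : List Letter) : ℕ :=
  Nat.card {p : ℕ × ℕ // DistinguishedRun w p.1 p.2}

/-- The motif condition: every run `r` with `ℓ(r) ≥ 4` admits another run `s` of the same
type with `ℓ(r) ≤ ℓ(s) + 2`. -/
def MotifCond (w : List Letter) : Prop :=
  ∀ i len, RunAt w i len → 4 ≤ len →
    ∃ i' len', RunAt w i' len' ∧ runType w i' = runType w i ∧ i' ≠ i ∧ len ≤ len' + 2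

/-- The binomial coefficient `C(n, k)` with the convention that it vanishes when `n` or `k`
is negative, except `C(-1, -1) = 1`. -/
def binC (n k : ℤ) : ℤ :=
  if n = -1 ∧ k = -1 then 1
  else if 0 ≤ n ∧ 0 ≤ k then (n.toNat.choose k.toNat : ℤ)
  else 0

/-- The word-level descendants of `w`: the smallest collection containing `w` and closed
under expansion at distinguished runs. -/
inductive Desc (w : List Letter) : List Letter → Prop
  | base : Desc w w
  | step (v : List Letter) (i len : ℕ) :
      Desc w v → DistinguishedRun v i len → Desc w (expandAt v i)

abbrev GL2Z := Matrix.GeneralLinearGroup (Fin 2) ℤ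

/-- The irrational points of the circle. -/
abbrev Irr := {u : ℝ // Irrational u}

lemma GL2Z.det_eq (g : GL2Z) :
    g.1 0 0 * g.1 1 1 - g.1 0 1 * g.1 1 0 = 1 ∨ g.1 0 0 * g.1 1 1 - g.1 0 1 * g.1 1 0 = -1 := by
  have h : IsUnit g.1.det := (Matrix.isUnit_iff_isUnit_det _).1 g.isUnit
  rw [Matrix.det_fin_two] at h
  exact Int.isUnit_iff.1 h

lemma Irr.lin_ne_zero (u : Irr) {c d : ℤ} (h : c ≠ 0 ∨ d ≠ 0) : (c : ℝ) * u.1 + d ≠ 0 := by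
  rintro e
  have hu := u.2
  by_cases hc : c = 0
  · subst hc
    simp at e
    simp_all
  · apply hu
    refine ⟨-(d : ℚ) / c, ?_⟩
    have : (c : ℝ) ≠ 0 := by exact_mod_cast hc
    push_cast
    field_simp
    linarith

lemma GL2Z.den_ne_zero (g : GL2Z) (u : Irr) : (g.1 1 0 : ℝ) * u.1 + g.1 1 1 ≠ 0 := by
  apply u.lin_ne_zero
  by_contra! h
  have := g.det_eq
  simp [h.1, h.2] at this

lemma GL2Z.det_real (g : GL2Z) :
    (g.1 0 0 : ℝ) * g.1 1 1 - g.1 0 1 * g.1 1 0 = 1 ∨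
      (g.1 0 0 : ℝ) * g.1 1 1 - g.1 0 1 * g.1 1 0 = -1 := by
  exact_mod_cast g.det_eq

lemma GL2Z.irrational_image (g : GL2Z) (u : Irr) :
    Irrational (((g.1 0 0 : ℝ) * u.1 + g.1 0 1) / (g.1 1 0 * u.1 + g.1 1 1)) := by
  have hd := g.den_ne_zero u
  rintro ⟨q, hq⟩
  rw [eq_div_iff hd] at hq
  have h1 : (u.1 : ℝ) * (g.1 0 0 - g.1 1 0 * q) = g.1 1 1 * q - g.1 0 1 := by linarith
  have h2 : ((g.1 0 0 : ℝ) - g.1 1 0 * q) ≠ 0 := by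
    intro h0
    have h3 : ((g.1 0 0 : ℝ) - g.1 1 0 * q) * (g.1 1 0 * u.1 + g.1 1 1) =
        (g.1 0 0 : ℝ) * g.1 1 1 - g.1 0 1 * g.1 1 0 := by linear_combination (-(g.1 1 0 : ℝ)) * hq
    rw [h0, zero_mul] at h3
    rcases g.det_real with h | h <;> rw [h] at h3 <;> norm_num at h3
  apply u.2
  refine ⟨(g.1 1 1 * q - g.1 0 1) / (g.1 0 0 - g.1 1 0 * q), ?_⟩
  push_cast
  rw [div_eq_iff h2, h1]

noncomputable instance : MulAction GL2Z Irr where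
  smul g u := ⟨((g.1 0 0 : ℝ) * u.1 + g.1 0 1) / (g.1 1 0 * u.1 + g.1 1 1), g.irrational_image u⟩
  one_smul u := by
    apply Subtype.ext
    change (((1 : GL2Z).1 0 0 : ℝ) * u.1 + (1 : GL2Z).1 0 1) /
      ((1 : GL2Z).1 1 0 * u.1 + (1 : GL2Z).1 1 1) = u.1
    simp
  mul_smul g h u := by
    apply Subtype.ext
    change (((g * h).1 0 0 : ℝ) * u.1 + (g * h).1 0 1) /
      ((g * h).1 1 0 * u.1 + (g * h).1 1 1) =
      ((g.1 0 0 : ℝ) * (((h.1 0 0 : ℝ) * u.1 + h.1 0 1) / (h.1 1 0 * u.1 + h.1 1 1)) + g.1 0 1) /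
      (g.1 1 0 * (((h.1 0 0 : ℝ) * u.1 + h.1 0 1) / (h.1 1 0 * u.1 + h.1 1 1)) + g.1 1 1)
    have h1 := h.den_ne_zero u
    have h2 := (g * h).den_ne_zero u
    have h3 := g.den_ne_zero ⟨_, h.irrational_image u⟩
    simp only [Units.val_mul, Matrix.mul_apply, Fin.sum_univ_two] at h2 ⊢
    push_cast at h2 ⊢
    rw [div_eq_div_iff h2 h3]
    field_simp
    ring

lemma Irr.smul_val (g : GL2Z) (u : Irr) :
    (g • u).1 = ((g.1 0 0 : ℝ) * u.1 + g.1 0 1) / (g.1 1 0 * u.1 + g.1 1 1) := rfl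

lemma Irr.smul_sub (g : GL2Z) (u v : Irr) :
    (g • v).1 - (g • u).1 = ((g.1 0 0 : ℝ) * g.1 1 1 - g.1 0 1 * g.1 1 0) * (v.1 - u.1) /
      (((g.1 1 0 : ℝ) * u.1 + g.1 1 1) * ((g.1 1 0 : ℝ) * v.1 + g.1 1 1)) := by
  rw [Irr.smul_val, Irr.smul_val]
  have h1 := g.den_ne_zero u
  have h2 := g.den_ne_zero v
  rw [div_sub_div _ _ h2 h1, div_eq_div_iff (mul_ne_zero h2 h1) (mul_ne_zero h1 h2)]
  ring

/-- The pairs `{a, b}` and `{c, d}` separate each other on the circle. -/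
def Link (a b c d : Irr) : Prop := (c.1 - a.1) * (c.1 - b.1) * ((d.1 - a.1) * (d.1 - b.1)) < 0

lemma link_smul (g : GL2Z) (a b c d : Irr) :
    Link (g • a) (g • b) (g • c) (g • d) ↔ Link a b c d := by
  unfold Link
  simp only [Irr.smul_sub]
  have ha := g.den_ne_zero a
  have hb := g.den_ne_zero b
  have hc := g.den_ne_zero c
  have hd := g.den_ne_zero d
  have h2 : ((g.1 0 0 : ℝ) * g.1 1 1 - g.1 0 1 * g.1 1 0) ^ 2 = 1 := by
    rcases g.det_real with h | h <;> rw [h] <;> norm_num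
  set e := ((g.1 0 0 : ℝ) * g.1 1 1 - g.1 0 1 * g.1 1 0)
  set A := (g.1 1 0 : ℝ) * a.1 + g.1 1 1
  set B := (g.1 1 0 : ℝ) * b.1 + g.1 1 1
  set C := (g.1 1 0 : ℝ) * c.1 + g.1 1 1
  set D := (g.1 1 0 : ℝ) * d.1 + g.1 1 1
  have : e * (c.1 - a.1) / (A * C) * (e * (c.1 - b.1) / (B * C)) *
      (e * (d.1 - a.1) / (A * D) * (e * (d.1 - b.1) / (B * D))) =
      ((c.1 - a.1) * (c.1 - b.1) * ((d.1 - a.1) * (d.1 - b.1))) / (A * B * C * D) ^ 2 := by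
    field_simp
    linear_combination ((e ^ 2 + 1) * (c.1 - a.1) * (c.1 - b.1) * ((d.1 - a.1) * (d.1 - b.1))) * h2
  rw [this]
  have hp : 0 < (A * B * C * D) ^ 2 := by positivity
  constructor
  · intro h
    by_contra! h'
    exact absurd h (not_lt.2 (div_nonneg h' hp.le))
  · intro h
    exact div_neg_of_neg_of_pos h hp

/-- The reflection attached to a letter. -/
def Rm : Letter → GL2Z
  | .x => ⟨!![-1, 2; 0, 1], !![-1, 2; 0, 1], by decide, by decide⟩
  | .y => ⟨!![-1, 0; 0, 1], !![-1, 0; 0, 1], by decide, by decide⟩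
  | .z => ⟨!![-1, 0; -2, 1], !![-1, 0; -2, 1], by decide, by decide⟩

lemma Rm_mul_self (s : Letter) : Rm s * Rm s = 1 := by
  cases s <;> apply Units.ext <;> decide

lemma Rm_smul_smul (s : Letter) (u : Irr) : Rm s • Rm s • u = u := by
  rw [← mul_smul, Rm_mul_self, one_smul]

lemma Rm_inv (s : Letter) : (Rm s)⁻¹ = Rm s := inv_eq_of_mul_eq_one_left (Rm_mul_self s)

lemma Rx_smul (u : Irr) : (Rm .x • u).1 = 2 - u.1 := by
  simp [Irr.smul_val, Rm]; ring

lemma Ry_smul (u : Irr) : (Rm .y • u).1 = - u.1 := by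
  simp [Irr.smul_val, Rm]

lemma Irr.two_ne (u : Irr) : 2 * u.1 - 1 ≠ 0 := by
  have := u.lin_ne_zero (c := 2) (d := -1) (by simp)
  push_cast at this
  intro h
  apply this
  linarith

lemma Rz_smul (u : Irr) : (Rm .z • u).1 = u.1 / (2 * u.1 - 1) := by
  simp only [Irr.smul_val, Rm]
  have h := u.two_ne
  have h' : -(2 * u.1) + 1 ≠ 0 := by intro h0; apply h; linarith
  simp
  rw [div_eq_div_iff h' h]
  ring

/-- The side of the ideal triangle `(0, 1, ∞)` cutting off `u`. -/
noncomputable def loc (u : Irr) : Letter :=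
  if u.1 < 0 then .y else if u.1 < 1 then .z else .x

lemma loc_eq_y {u : Irr} : loc u = .y ↔ u.1 < 0 := by
  unfold loc; split_ifs <;> simp_all

lemma Irr.ne_int (u : Irr) (k : ℤ) : u.1 ≠ k := fun h => u.2 ⟨k, by rw [h]; simp⟩

lemma loc_eq_z {u : Irr} : loc u = .z ↔ 0 < u.1 ∧ u.1 < 1 := by
  have h0 := u.ne_int 0
  unfold loc; split_ifs with h h' <;> simp_all
  · intro; linarith
  · exact lt_of_le_of_ne h (Ne.symm h0)

lemma loc_eq_x {u : Irr} : loc u = .x ↔ 1 < u.1 := by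
  have h0 := u.ne_int 1
  unfold loc; split_ifs with h h' <;> simp_all
  · linarith
  · linarith
  · exact lt_of_le_of_ne h' (Ne.symm h0)

lemma loc_smul_of_ne {s : Letter} {u : Irr} (h : loc u ≠ s) : loc (Rm s • u) = s := by
  cases s
  · rw [Ne, loc_eq_x, not_lt] at h
    have := u.ne_int 1
    rw [loc_eq_x, Rx_smul]
    have : u.1 < 1 := lt_of_le_of_ne h (by exact_mod_cast this)
    linarith
  · rw [Ne, loc_eq_y, not_lt] at h
    have := u.ne_int 0
    rw [loc_eq_y, Ry_smul]
    have : 0 < u.1 := lt_of_le_of_ne h (by exact_mod_cast this.symm)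
    linarith
  · rw [loc_eq_z, Rz_smul]
    have h2 : loc u = .x ∨ loc u = .y := by
      cases h' : loc u <;> simp_all
    rcases h2 with h2 | h2
    · rw [loc_eq_x] at h2
      have : 0 < 2 * u.1 - 1 := by linarith
      exact ⟨div_pos (by linarith) this, by rw [div_lt_one this]; linarith⟩
    · rw [loc_eq_y] at h2
      have : 2 * u.1 - 1 < 0 := by linarith
      exact ⟨div_pos_of_neg_of_neg (by linarith) this, by rw [div_lt_one_of_neg this]; linarith⟩

lemma loc_smul_of_eq {s : Letter} {u : Irr} (h : loc u = s) : loc (Rm s • u) ≠ s := by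
  cases s
  · rw [Ne, loc_eq_x, not_lt, Rx_smul]
    rw [loc_eq_x] at h
    linarith
  · rw [Ne, loc_eq_y, not_lt, Ry_smul]
    rw [loc_eq_y] at h
    linarith
  · rw [Ne, loc_eq_z, Rz_smul]
    rw [loc_eq_z] at h
    rintro ⟨h1, h2⟩
    rcases lt_or_gt_of_ne u.two_ne with h3 | h3
    · exact absurd h1 (not_lt.2 (div_nonpos_of_nonneg_of_nonpos h.1.le h3.le))
    · rw [div_lt_one h3] at h2
      linarith

/-- `true` when `(a, b)` is one of `(x, y)`, `(y, z)`, `(z, x)`. -/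
def cyc : Letter → Letter → Bool
  | .x, .y => true
  | .y, .z => true
  | .z, .x => true
  | _, _ => false

/-- The orientation of a triple of points on the circle. -/
noncomputable def ori (u v w : Irr) : ℝ := (v.1 - u.1) * (w.1 - v.1) * (u.1 - w.1)

lemma ori_Rm_neg (s : Letter) (u v w : Irr) :
    ori (Rm s • u) (Rm s • v) (Rm s • w) < 0 ↔ 0 < ori u v w := by
  cases s
  · simp only [ori, Rx_smul]
    rw [← neg_pos]; ring_nf
  · simp only [ori, Ry_smul]
    rw [← neg_pos]; ring_nf
  · simp only [ori, Rz_smul]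
    have h1 := u.two_ne
    have h2 := v.two_ne
    have h3 := w.two_ne
    have key : ∀ a b : Irr, b.1 / (2 * b.1 - 1) - a.1 / (2 * a.1 - 1) =
        -((b.1 - a.1) / ((2 * a.1 - 1) * (2 * b.1 - 1))) := fun a b => by
      rw [div_sub_div _ _ b.two_ne a.two_ne, ← neg_div,
        div_eq_div_iff (mul_ne_zero b.two_ne a.two_ne) (mul_ne_zero a.two_ne b.two_ne)]
      ring
    rw [key, key, key]
    have : -((v.1 - u.1) / ((2 * u.1 - 1) * (2 * v.1 - 1))) *
        -((w.1 - v.1) / ((2 * v.1 - 1) * (2 * w.1 - 1))) *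
        -((u.1 - w.1) / ((2 * w.1 - 1) * (2 * u.1 - 1))) =
        -(((v.1 - u.1) * (w.1 - v.1) * (u.1 - w.1)) /
        ((2 * u.1 - 1) * (2 * v.1 - 1) * (2 * w.1 - 1)) ^ 2) := by
      generalize 2 * u.1 - 1 = A at *
      generalize 2 * v.1 - 1 = B at *
      generalize 2 * w.1 - 1 = C at *
      field_simp
    rw [this, neg_lt_zero]
    have hp : 0 < ((2 * u.1 - 1) * (2 * v.1 - 1) * (2 * w.1 - 1)) ^ 2 := by positivity
    rw [div_pos_iff_of_pos_right hp]

lemma ori_Rm_pos (s : Letter) (u v w : Irr) :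
    0 < ori (Rm s • u) (Rm s • v) (Rm s • w) ↔ ori u v w < 0 := by
  have := ori_Rm_neg s (Rm s • u) (Rm s • v) (Rm s • w)
  simpa [Rm_smul_smul] using this.symm

lemma ori_neg_of_cyc {u v w : Irr} (h1 : loc w ≠ loc u) (h2 : loc w ≠ loc v)
    (h : cyc (loc u) (loc v) = true) : ori u v w < 0 := by
  unfold ori
  cases hu : loc u <;> cases hv : loc v <;> cases hw : loc w <;> simp_all [cyc] <;>
    simp only [loc_eq_x, loc_eq_y, loc_eq_z] at hu hv hw
  · exact mul_neg_of_neg_of_pos (mul_neg_of_neg_of_pos (by linarith) (by linarith)) (by linarith)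
  · exact mul_neg_of_pos_of_neg (mul_pos (by linarith) (by linarith)) (by linarith)
  · exact mul_neg_of_neg_of_pos (mul_neg_of_pos_of_neg (by linarith) (by linarith)) (by linarith)

lemma ori_swap (u v w : Irr) : ori v u w = - ori u v w := by unfold ori; ring

lemma cyc_swap {a b : Letter} (h : a ≠ b) : cyc b a = !cyc a b := by
  cases a <;> cases b <;> simp_all [cyc]

lemma ori_pos_of_cyc {u v w : Irr} (h0 : loc u ≠ loc v) (h1 : loc w ≠ loc u) (h2 : loc w ≠ loc v)
    (h : cyc (loc u) (loc v) = false) : 0 < ori u v w := by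
  have : ori v u w < 0 := ori_neg_of_cyc h2 h1 (by rw [cyc_swap h0, h]; rfl)
  rw [ori_swap] at this
  linarith

lemma link_iff_ori (a b c d : Irr) (hab : a ≠ b) :
    Link a b c d ↔ 0 < ori a c b * ori b d a := by
  have : ori a c b * ori b d a =
      -(a.1 - b.1) ^ 2 * ((c.1 - a.1) * (c.1 - b.1) * ((d.1 - a.1) * (d.1 - b.1))) := by
    unfold ori; ring
  rw [this]
  have hp : 0 < (a.1 - b.1) ^ 2 := by
    have : a.1 - b.1 ≠ 0 := fun h => hab (Subtype.ext (by linarith))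
    positivity
  unfold Link
  constructor
  · intro h
    exact mul_pos_of_neg_of_neg (by linarith) h
  · intro h
    by_contra! h'
    nlinarith [mul_nonneg hp.le h']

open Topology Filter

lemma mobius_coe (g : SL2Z) (u : Irr) :
    mobius g (u.1 : OnePoint ℝ) = (((g : GL2Z) • u : Irr).1 : OnePoint ℝ) := by
  have h := GL2Z.den_ne_zero (g : GL2Z) u
  change (if entry g 1 0 * u.1 + entry g 1 1 = 0 then OnePoint.infty
      else OnePoint.some ((entry g 0 0 * u.1 + entry g 0 1) / (entry g 1 0 * u.1 + entry g 1 1))) = _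
  exact if_neg h

lemma mobius_coe_eq (g : SL2Z) (u : Irr) :
    (u.1 : OnePoint ℝ) ∈ fixedSet g ↔ (g : GL2Z) • u = u := by
  change mobius g _ = _ ↔ _
  rw [mobius_coe, OnePoint.coe_eq_coe, Subtype.ext_iff]

lemma SL2Z.det_real (g : SL2Z) : entry g 0 0 * entry g 1 1 - entry g 0 1 * entry g 1 0 = 1 := by
  have := g.2
  rw [Matrix.det_fin_two] at this
  unfold entry
  exact_mod_cast this

lemma Hyperbolic.fixed {g : SL2Z} (hg : Hyperbolic g) :
    ∃ a b : Irr, a ≠ b ∧ fixedSet g = {(a.1 : OnePoint ℝ), (b.1 : OnePoint ℝ)} := by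
  have hdet := g.det_real
  have hdetZ := g.2
  rw [Matrix.det_fin_two] at hdetZ
  set a := g.1 0 0 with ha
  set b := g.1 0 1 with hb
  set c := g.1 1 0 with hc
  set d := g.1 1 1 with hd
  have htr : 2 < |a + d| := by
    have := hg
    rwa [Hyperbolic, Matrix.trace_fin_two] at this
  have hc0 : c ≠ 0 := by
    intro h
    rw [h, mul_zero, sub_zero] at hdetZ
    rcases Int.eq_one_or_neg_one_of_mul_eq_one' hdetZ with ⟨h1, h2⟩ | ⟨h1, h2⟩ <;>
      rw [h1, h2] at htr <;> norm_num at htr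
  have hc' : (c : ℝ) ≠ 0 := by exact_mod_cast hc0
  set D : ℤ := (a + d) ^ 2 - 4 with hD
  have hDpos : 0 < D := by
    have : 2 ^ 2 < |a + d| ^ 2 := by gcongr
    rw [sq_abs] at this
    omega
  have hirr : Irrational (Real.sqrt D) := by
    rw [irrational_sqrt_intCast_iff_of_nonneg hDpos.le]
    rintro ⟨k, hk⟩
    have h1 : |k| * |k| = |a + d| * |a + d| - 4 := by
      rw [abs_mul_abs_self, abs_mul_abs_self, ← hk, hD]; ring
    have h2 : |k| < |a + d| := by nlinarith [abs_nonneg k, abs_nonneg (a + d)]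
    nlinarith [abs_nonneg k, abs_nonneg (a + d)]
  set r := Real.sqrt D with hr
  have hr2 : r * r = ((a : ℝ) + d) ^ 2 - 4 := by
    have := Real.mul_self_sqrt (show (0 : ℝ) ≤ D by exact_mod_cast hDpos.le)
    rw [hr, this, hD]; push_cast; ring
  have hdetR : (a : ℝ) * d - b * c = 1 := by exact_mod_cast hdetZ
  have irr : ∀ e : ℤ, e ≠ 0 → Irrational ((a - d + e * r) / (2 * c)) := by
    intro e he
    rintro ⟨q, hq⟩
    apply hirr
    refine ⟨(q * (2 * c) - a + d) / e, ?_⟩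
    have he' : (e : ℝ) ≠ 0 := by exact_mod_cast he
    push_cast
    rw [hq]
    field_simp
    ring
  refine ⟨⟨_, irr 1 (by norm_num)⟩, ⟨_, irr (-1) (by norm_num)⟩, ?_, ?_⟩
  · intro h
    have h := congrArg Subtype.val h
    simp only [Int.cast_one, Int.cast_neg] at h
    rw [div_left_inj' (by positivity)] at h
    have : r = 0 := by linarith
    rw [this] at hirr
    exact hirr ⟨0, by simp⟩
  · have quad : ∀ x : ℝ, (c : ℝ) * x ^ 2 + (d - a) * x - b = 0 ↔
        x = (a - d + (1 : ℤ) * r) / (2 * c) ∨ x = (a - d + (-1 : ℤ) * r) / (2 * c) := by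
      intro x
      rw [eq_div_iff (by positivity), eq_div_iff (by positivity)]
      push_cast
      have : (c : ℝ) * x ^ 2 + (d - a) * x - b = 0 ↔
          (x * (2 * c) - (a - d + 1 * r)) * (x * (2 * c) - (a - d + -1 * r)) = 0 := by
        have e : (x * (2 * c) - (a - d + 1 * r)) * (x * (2 * c) - (a - d + -1 * r)) =
            4 * c * ((c : ℝ) * x ^ 2 + (d - a) * x - b) := by
          linear_combination (-1) * hr2 - 4 * hdetR
        rw [e]
        simp [hc']
      rw [this, mul_eq_zero, sub_eq_zero, sub_eq_zero]
    ext p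
    simp only [fixedSet, Set.mem_ofPred_eq, Set.mem_insert_iff, Set.mem_singleton_iff]
    cases p with
    | infty =>
      have : mobius g OnePoint.infty = OnePoint.some (entry g 0 0 / entry g 1 0) := by
        change (if entry g 1 0 = 0 then OnePoint.infty else _) = _
        rw [if_neg]
        exact hc'
      rw [this]
      simp
    | coe x =>
      rw [OnePoint.coe_eq_coe, OnePoint.coe_eq_coe, ← quad]
      change (if (c : ℝ) * x + d = 0 then OnePoint.infty
        else OnePoint.some (((a : ℝ) * x + b) / (c * x + d))) = _ ↔ _
      split_ifs with h0
      · simp only [OnePoint.infty_ne_coe, false_iff]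
        intro h1
        have : (a : ℝ) * x + b = 0 := by linear_combination x * h0 - h1
        have h3 : (a : ℝ) * d - b * c = 0 := by
          linear_combination a * h0 - c * this
        linarith
      · rw [OnePoint.coe_eq_coe, div_eq_iff h0]
        constructor <;> intro h <;> linear_combination -h

lemma compl_pair_coe (a b : ℝ) (hab : a < b) :
    ({(a : OnePoint ℝ), (b : OnePoint ℝ)} : Set (OnePoint ℝ))ᶜ =
      ((↑) '' Set.Ioo a b) ∪ ((↑) '' Set.Icc a b)ᶜ := by
  ext p
  cases p with
  | infty => simp
  | coe x =>
    simp only [Set.mem_compl_iff, Set.mem_insert_iff, OnePoint.coe_eq_coe, Set.mem_singleton_iff,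
      Set.mem_union, Set.mem_image, exists_eq_right, Set.mem_Ioo, Set.mem_Icc]
    constructor
    · intro h
      push Not at h
      by_cases h1 : a < x ∧ x < b
      · exact Or.inl h1
      · right
        rintro ⟨h2, h3⟩
        exact h1 ⟨lt_of_le_of_ne h2 h.1.symm, lt_of_le_of_ne h3 h.2⟩
    · rintro (h | h) (rfl | rfl)
      · exact lt_irrefl _ h.1
      · exact lt_irrefl _ h.2
      · exact h ⟨le_rfl, hab.le⟩
      · exact h ⟨hab.le, le_rfl⟩

lemma isPreconnected_outer (a b : ℝ) :
    IsPreconnected (((↑) '' Set.Icc a b)ᶜ : Set (OnePoint ℝ)) := by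
  have e : (((↑) '' Set.Icc a b)ᶜ : Set (OnePoint ℝ)) =
      ((↑) '' Set.Iio a ∪ {OnePoint.infty}) ∪ ((↑) '' Set.Ioi b ∪ {OnePoint.infty}) := by
    ext p
    cases p with
    | infty => simp
    | coe x =>
      simp only [Set.mem_compl_iff, Set.mem_image, OnePoint.coe_eq_coe, exists_eq_right,
        Set.mem_Icc, Set.union_singleton, Set.mem_union, Set.mem_insert_iff, OnePoint.coe_ne_infty,
        false_or, Set.mem_Iio, Set.mem_Ioi]
      grind
  have key : ∀ (s : Set ℝ) (f : Filter ℝ) [f.NeBot], f ≤ cocompact ℝ → s ∈ f → IsPreconnected s →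
      IsPreconnected ((↑) '' s ∪ {OnePoint.infty} : Set (OnePoint ℝ)) := by
    intro s f _ hf hs hp
    have h1 : IsPreconnected ((↑) '' s : Set (OnePoint ℝ)) :=
      hp.image _ OnePoint.continuous_coe.continuousOn
    refine h1.subset_closure Set.subset_union_left ?_
    refine Set.union_subset subset_closure ?_
    rw [Set.singleton_subset_iff]
    have ht : Tendsto ((↑) : ℝ → OnePoint ℝ) f (𝓝 OnePoint.infty) := by
      have := OnePoint.tendsto_coe_infty (X := ℝ)
      rw [coclosedCompact_eq_cocompact] at this
      exact this.mono_left hf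
    exact mem_closure_of_tendsto ht (Filter.mem_of_superset hs fun x hx => ⟨x, hx, rfl⟩)
  rw [e]
  exact IsPreconnected.union OnePoint.infty (by simp) (by simp)
    (key _ atBot atBot_le_cocompact (Iio_mem_atBot a) isPreconnected_Iio)
    (key _ atTop atTop_le_cocompact (Ioi_mem_atTop b) isPreconnected_Ioi)

lemma link_comm_left (a b c d : Irr) : Link a b c d ↔ Link b a c d := by
  unfold Link
  rw [mul_comm (c.1 - a.1), mul_comm (d.1 - a.1)]

lemma link_comm_right (a b c d : Irr) : Link a b c d ↔ Link a b d c := by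
  unfold Link
  rw [mul_comm]

lemma link_iff_of_lt {a b c d : Irr} (hab : a.1 < b.1) (hca : c ≠ a) (hcb : c ≠ b) (hda : d ≠ a)
    (hdb : d ≠ b) : Link a b c d ↔ (c.1 ∈ Set.Ioo a.1 b.1 ↔ ¬ d.1 ∈ Set.Ioo a.1 b.1) := by
  have key : ∀ e : Irr, e ≠ a → e ≠ b → (e.1 ∈ Set.Ioo a.1 b.1 ∧ (e.1 - a.1) * (e.1 - b.1) < 0) ∨
      (¬ e.1 ∈ Set.Ioo a.1 b.1 ∧ 0 < (e.1 - a.1) * (e.1 - b.1)) := by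
    intro e h1 h2
    have h1 : e.1 ≠ a.1 := fun h => h1 (Subtype.ext h)
    have h2 : e.1 ≠ b.1 := fun h => h2 (Subtype.ext h)
    rcases lt_or_gt_of_ne h1 with h1 | h1 <;> rcases lt_or_gt_of_ne h2 with h2 | h2
    · exact Or.inr ⟨fun h => lt_asymm h1 h.1, mul_pos_of_neg_of_neg (by linarith) (by linarith)⟩
    · linarith
    · exact Or.inl ⟨⟨h1, h2⟩, mul_neg_of_pos_of_neg (by linarith) (by linarith)⟩
    · exact Or.inr ⟨fun h => lt_asymm h2 h.2, mul_pos (by linarith) (by linarith)⟩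
  unfold Link
  rcases key c hca hcb with ⟨h1, h2⟩ | ⟨h1, h2⟩ <;> rcases key d hda hdb with ⟨h3, h4⟩ | ⟨h3, h4⟩
  · simp [h1, h3, not_lt.2 (mul_pos_of_neg_of_neg h2 h4).le]
  · simp [h1, h3, mul_neg_of_neg_of_pos h2 h4]
  · simp [h1, h3, mul_neg_of_pos_of_neg h2 h4]
  · simp [h1, h3, not_lt.2 (mul_pos h2 h4).le]

lemma coe_mem_compl_pair {a b c : Irr} (hca : c ≠ a) (hcb : c ≠ b) :
    (c.1 : OnePoint ℝ) ∈ ({(a.1 : OnePoint ℝ), (b.1 : OnePoint ℝ)} : Set (OnePoint ℝ))ᶜ := by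
  simp [Subtype.ext_iff.symm, hca, hcb]

lemma component_eq_iff {a b c d : Irr} (hab : a.1 < b.1) (hca : c ≠ a) (hcb : c ≠ b) (hda : d ≠ a)
    (hdb : d ≠ b) :
    connectedComponentIn ({(a.1 : OnePoint ℝ), (b.1 : OnePoint ℝ)} : Set (OnePoint ℝ))ᶜ c.1 =
      connectedComponentIn ({(a.1 : OnePoint ℝ), (b.1 : OnePoint ℝ)} : Set (OnePoint ℝ))ᶜ d.1 ↔
      (c.1 ∈ Set.Ioo a.1 b.1 ↔ d.1 ∈ Set.Ioo a.1 b.1) := by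
  set F := ({(a.1 : OnePoint ℝ), (b.1 : OnePoint ℝ)} : Set (OnePoint ℝ))ᶜ with hF
  have hcF : (c.1 : OnePoint ℝ) ∈ F := coe_mem_compl_pair hca hcb
  have hdF : (d.1 : OnePoint ℝ) ∈ F := coe_mem_compl_pair hda hdb
  have hFe := compl_pair_coe a.1 b.1 hab
  set U : Set (OnePoint ℝ) := (↑) '' Set.Ioo a.1 b.1 with hU
  set V : Set (OnePoint ℝ) := ((↑) '' Set.Icc a.1 b.1)ᶜ with hV
  have hUo : IsOpen U := OnePoint.isOpenEmbedding_coe.isOpenMap _ isOpen_Ioo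
  have hVo : IsOpen V := by
    rw [hV, isOpen_compl_iff]
    exact (isCompact_Icc.image OnePoint.continuous_coe).isClosed
  have hUV : Disjoint U V := by
    rw [Set.disjoint_compl_right_iff_subset]
    exact Set.image_mono Set.Ioo_subset_Icc_self
  have memU : ∀ e : Irr, (e.1 : OnePoint ℝ) ∈ U ↔ e.1 ∈ Set.Ioo a.1 b.1 := fun e => by simp [hU]
  have hFV : ∀ e : Irr, (e.1 : OnePoint ℝ) ∈ F → e.1 ∉ Set.Ioo a.1 b.1 →
      (e.1 : OnePoint ℝ) ∈ V := fun e h1 h2 => by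
    rw [hF, hFe] at h1
    exact h1.resolve_left (mt (memU e).1 h2)
  have sep : ∀ e f : Irr, (e.1 : OnePoint ℝ) ∈ F → (f.1 : OnePoint ℝ) ∈ F →
      connectedComponentIn F e.1 = connectedComponentIn F f.1 → e.1 ∈ Set.Ioo a.1 b.1 →
      f.1 ∈ Set.Ioo a.1 b.1 := by
    intro e f heF hfF h he
    have := IsPreconnected.subset_left_of_subset_union hUo hVo hUV
      (s := connectedComponentIn F e.1)
      (by rw [← hFe]; exact connectedComponentIn_subset _ _)
      ⟨_, mem_connectedComponentIn heF, (memU e).2 he⟩ isPreconnected_connectedComponentIn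
    rw [← memU]
    apply this
    rw [h]
    exact mem_connectedComponentIn hfF
  have same : ∀ S : Set (OnePoint ℝ), IsPreconnected S → S ⊆ F → (c.1 : OnePoint ℝ) ∈ S →
      (d.1 : OnePoint ℝ) ∈ S → connectedComponentIn F c.1 = connectedComponentIn F d.1 :=
    fun S h1 h2 h3 h4 => connectedComponentIn_eq (h1.subset_connectedComponentIn h3 h2 h4)
  constructor
  · intro h
    exact ⟨sep c d hcF hdF h, sep d c hdF hcF h.symm⟩
  · intro h
    by_cases hc : c.1 ∈ Set.Ioo a.1 b.1
    · exact same U (isPreconnected_Ioo.image _ OnePoint.continuous_coe.continuousOn)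
        (by rw [hF, hFe]; exact Set.subset_union_left) ((memU c).2 hc) ((memU d).2 (h.1 hc))
    · exact same V (isPreconnected_outer _ _)
        (by rw [hF, hFe]; exact Set.subset_union_right) (hFV c hcF hc)
        (hFV d hdF (mt h.2 hc))

/-- For disjoint pairs of irrational points, being linked is the separation condition. -/
lemma linked_iff_link {a b c d : Irr} (hab : a ≠ b) (hcd : c ≠ d) (hca : c ≠ a) (hcb : c ≠ b)
    (hda : d ≠ a) (hdb : d ≠ b) :
    Linked {(a.1 : OnePoint ℝ), (b.1 : OnePoint ℝ)} {(c.1 : OnePoint ℝ), (d.1 : OnePoint ℝ)} ↔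
      Link a b c d := by
  wlog h : a.1 < b.1 generalizing a b
  · rw [Set.pair_comm, link_comm_left]
    have hne : a.1 ≠ b.1 := fun h => hab (Subtype.ext h)
    exact this hab.symm hcb hca hdb hda (hne.lt_or_gt.resolve_left h)
  rw [link_iff_of_lt h hca hcb hda hdb]
  have key := component_eq_iff h hca hcb hda hdb
  have hcd' : (c.1 : OnePoint ℝ) ≠ d.1 := by
    rw [Ne, OnePoint.coe_eq_coe]; exact fun h => hcd (Subtype.ext h)
  constructor
  · rintro ⟨q₁, q₂, hne, hQ, hcomp⟩
    have hcc : connectedComponentIn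
        ({(a.1 : OnePoint ℝ), (b.1 : OnePoint ℝ)} : Set (OnePoint ℝ))ᶜ c.1 ≠
      connectedComponentIn ({(a.1 : OnePoint ℝ), (b.1 : OnePoint ℝ)} : Set (OnePoint ℝ))ᶜ d.1 := by
      rcases Set.pair_eq_pair_iff.1 hQ with ⟨rfl, rfl⟩ | ⟨rfl, rfl⟩
      · exact hcomp
      · exact hcomp.symm
    rw [Ne, key] at hcc
    tauto
  · intro hl
    refine ⟨_, _, hcd', rfl, ?_⟩
    rw [Ne, key]
    tauto

lemma fixedSet_conj {g v : SL2Z} {a b : Irr} (hv : Hyperbolic v)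
    (h : fixedSet v = {(a.1 : OnePoint ℝ), (b.1 : OnePoint ℝ)}) :
    Hyperbolic (g * v * g⁻¹) ∧ fixedSet (g * v * g⁻¹) =
      {(((g : GL2Z) • a : Irr).1 : OnePoint ℝ), (((g : GL2Z) • b : Irr).1 : OnePoint ℝ)} := by
  have hh : Hyperbolic (g * v * g⁻¹) := by
    unfold Hyperbolic at hv ⊢
    rwa [Matrix.SpecialLinearGroup.coe_mul, Matrix.trace_mul_comm,
      ← Matrix.SpecialLinearGroup.coe_mul, ← mul_assoc, inv_mul_cancel, one_mul]
  refine ⟨hh, ?_⟩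
  have fix : ∀ u : Irr, (v : GL2Z) • u = u ↔ u = a ∨ u = b := by
    intro u
    rw [← mobius_coe_eq, h]
    simp [Subtype.ext_iff]
  have hfix : ∀ u : Irr, (u.1 : OnePoint ℝ) ∈ fixedSet (g * v * g⁻¹) ↔
      u = (g : GL2Z) • a ∨ u = (g : GL2Z) • b := by
    intro u
    rw [mobius_coe_eq, map_mul, map_mul, map_inv, mul_smul, mul_smul, smul_eq_iff_eq_inv_smul, fix,
      inv_smul_eq_iff, inv_smul_eq_iff]
  obtain ⟨c, d, hcd, he⟩ := hh.fixed
  ext p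
  constructor
  · intro hp
    have : ∃ u : Irr, p = (u.1 : OnePoint ℝ) := by
      rw [he] at hp
      rcases hp with rfl | rfl
      · exact ⟨c, rfl⟩
      · exact ⟨d, rfl⟩
    obtain ⟨u, rfl⟩ := this
    rcases (hfix u).1 hp with rfl | rfl <;> simp
  · rintro (rfl | rfl)
    · exact (hfix _).2 (Or.inl rfl)
    · exact (hfix _).2 (Or.inr rfl)

lemma dist_le_of_step {s : Letter} {u v : Irr} (hu : loc u = s) (hv : loc v = s) :
    |u.1 - v.1| ≤ |(Rm s • u).1 - (Rm s • v).1| := by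
  cases s
  · rw [Rx_smul, Rx_smul, abs_sub_comm]
    ring_nf; rfl
  · rw [Ry_smul, Ry_smul, abs_sub_comm]
    ring_nf; rfl
  · rw [Rz_smul, Rz_smul, div_sub_div _ _ u.two_ne v.two_ne, abs_div]
    rw [loc_eq_z] at hu hv
    have h1 : |2 * u.1 - 1| < 1 := by rw [abs_lt]; constructor <;> linarith
    have h2 : |2 * v.1 - 1| < 1 := by rw [abs_lt]; constructor <;> linarith
    have h3 : 0 < |(2 * u.1 - 1) * (2 * v.1 - 1)| := abs_pos.2 (mul_ne_zero u.two_ne v.two_ne)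
    rw [le_div_iff₀ h3]
    have e : u.1 * (2 * v.1 - 1) - (2 * u.1 - 1) * v.1 = -(u.1 - v.1) := by ring
    rw [e, abs_neg, abs_mul]
    nlinarith [abs_nonneg (u.1 - v.1), abs_nonneg (2 * u.1 - 1), abs_nonneg (2 * v.1 - 1),
      mul_le_one₀ h1.le (abs_nonneg _) h2.le]

lemma dist_le_of_step_z {u v : Irr} (hv : loc v = .z) :
    |u.1 - v.1| ≤ |2 * u.1 - 1| * |(Rm .z • u).1 - (Rm .z • v).1| := by
  rw [Rz_smul, Rz_smul, div_sub_div _ _ u.two_ne v.two_ne, abs_div]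
  rw [loc_eq_z] at hv
  have h2 : |2 * v.1 - 1| < 1 := by rw [abs_lt]; constructor <;> linarith
  have h3 : 0 < |(2 * v.1 - 1)| := abs_pos.2 v.two_ne
  have h4 : 0 < |(2 * u.1 - 1)| := abs_pos.2 u.two_ne
  have e : u.1 * (2 * v.1 - 1) - (2 * u.1 - 1) * v.1 = -(u.1 - v.1) := by ring
  rw [e, abs_neg, abs_mul, ← mul_div_assoc, mul_div_mul_left _ _ h4.ne', le_div_iff₀ h3]
  nlinarith [abs_nonneg (u.1 - v.1)]

/-- A point is determined by its itinerary, when that itinerary is followed by a periodic point. -/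
lemma itinerary_unique {s : ℕ → Letter} {u u' : ℕ → Irr} {n k₀ : ℕ}
    (hu : ∀ k, u (k + 1) = Rm (s k) • u k) (hu' : ∀ k, u' (k + 1) = Rm (s k) • u' k)
    (hl : ∀ k, loc (u k) = s k) (hl' : ∀ k, loc (u' k) = s k) (hn : 0 < n)
    (hper : ∀ k, u (k + n) = u k) (hz : s k₀ = .z) : u 0 = u' 0 := by
  have mono : Monotone fun k => |(u k).1 - (u' k).1| := monotone_nat_of_le_succ fun k => by
    rw [hu, hu']; exact dist_le_of_step (hl k) (hl' k)
  have hperj : ∀ j, u (k₀ + j * n) = u k₀ := by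
    intro j
    induction j with
    | zero => simp
    | succ j ih => rw [Nat.succ_mul, ← add_assoc, hper, ih]
  set r := |2 * (u k₀).1 - 1| with hr
  have hzl : loc (u k₀) = .z := by rw [hl, hz]
  have hr1 : r < 1 := by
    rw [loc_eq_z] at hzl
    rw [hr, abs_lt]; constructor <;> linarith
  have hr0 : 0 ≤ r := abs_nonneg _
  have hzj : ∀ j, s (k₀ + j * n) = .z := fun j => by rw [← hl, hperj, hl, hz]
  have step : ∀ j, |(u (k₀ + j * n)).1 - (u' (k₀ + j * n)).1| ≤
      r * |(u (k₀ + (j + 1) * n)).1 - (u' (k₀ + (j + 1) * n)).1| := by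
    intro j
    have h1 := dist_le_of_step_z (u := u (k₀ + j * n)) (v := u' (k₀ + j * n)) (by rw [hl', hzj])
    rw [← hzj j, ← hu, ← hu', hperj, ← hr] at h1
    have h2 := mono (show k₀ + j * n + 1 ≤ k₀ + (j + 1) * n by rw [Nat.succ_mul]; omega)
    rw [hperj]
    exact h1.trans (mul_le_mul_of_nonneg_left h2 hr0)
  have bound : ∀ j, |(u k₀).1 - (u' k₀).1| ≤ r ^ j := by
    intro j
    have h1 : |(u k₀).1 - (u' k₀).1| ≤ r ^ j * |(u (k₀ + j * n)).1 - (u' (k₀ + j * n)).1| := by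
      induction j with
      | zero => simp
      | succ j ih =>
        refine ih.trans ?_
        rw [pow_succ, mul_assoc]
        exact mul_le_mul_of_nonneg_left (step j) (pow_nonneg hr0 j)
    refine h1.trans (mul_le_of_le_one_right (pow_nonneg hr0 j) ?_)
    have h2 := hl (k₀ + j * n)
    have h3 := hl' (k₀ + j * n)
    rw [hzj, loc_eq_z] at h2 h3
    rw [abs_le]; constructor <;> linarith
  have hzero : |(u k₀).1 - (u' k₀).1| ≤ 0 :=
    ge_of_tendsto' (tendsto_pow_atTop_nhds_zero_of_lt_one hr0 hr1) bound
  have hle := (mono (Nat.zero_le k₀)).trans hzero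
  exact Subtype.ext (sub_eq_zero.1 (abs_nonpos_iff.1 hle))

/-- A primitive cyclically reduced word of even length using all three letters, indexed
cyclically, together with the parity of the positions. -/
structure Loop where
  n : ℕ
  [ne : NeZero n]
  lab : ZMod n → Letter
  par : ZMod n → Bool
  adj : ∀ i, lab i ≠ lab (i + 1)
  par_zero : par 0 = false
  par_succ : ∀ i, par (i + 1) = !par i
  aper : ∀ d, (∀ i, lab (i + d) = lab i) → d = 0
  surj : ∀ s, ∃ i, lab i = s

namespace Loop

instance (W : Loop) : NeZero W.n := W.ne

variable (W : Loop)

/-- The partial products of the reflections along the loop. -/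
def P : ℤ → GL2Z
  | Int.ofNat k => Nat.rec 1 (fun k p => p * Rm (W.lab (k : ℕ))) k
  | Int.negSucc k => Nat.rec (Rm (W.lab (-1))) (fun k p => p * Rm (W.lab (-(k + 2 : ℕ)))) k

lemma P_zero : W.P 0 = 1 := rfl

lemma P_succ (i : ℤ) : W.P (i + 1) = W.P i * Rm (W.lab i) := by
  rcases i with k | k
  · have : (Int.ofNat k + 1) = Int.ofNat (k + 1) := rfl
    rw [this]
    change _ * _ = _
    simp [P]
  · rcases k with _ | k
    · change (1 : GL2Z) = Rm (W.lab (-1)) * _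
      rw [show ((Int.negSucc 0 : ℤ) : ZMod W.n) = -1 by simp, Rm_mul_self]
    · have : (Int.negSucc (k + 1) + 1) = Int.negSucc k := by omega
      rw [this]
      change _ = W.P (Int.negSucc k) * Rm (W.lab (-(k + 2 : ℕ))) * _
      rw [show ((Int.negSucc (k + 1) : ℤ) : ZMod W.n) = -((k + 2 : ℕ) : ZMod W.n) by
        rw [Int.cast_negSucc], mul_assoc, Rm_mul_self, mul_one]

lemma P_pred (i : ℤ) : W.P (i - 1) = W.P i * Rm (W.lab (i - 1)) := by
  have := W.P_succ (i - 1)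
  rw [sub_add_cancel] at this
  rw [this, mul_assoc]
  push_cast
  rw [Rm_mul_self, mul_one]

lemma P_add (i : ℤ) : W.P (i + W.n) = W.P W.n * W.P i := by
  induction i using Int.induction_on with
  | zero => simp [P_zero]
  | succ i ih =>
    rw [show (i : ℤ) + 1 + W.n = (i + W.n) + 1 by ring, P_succ, ih, P_succ, mul_assoc]
    simp
  | pred i ih =>
    rw [show -(i : ℤ) - 1 + W.n = (-i + W.n) - 1 by ring, P_pred, ih, P_pred, mul_assoc]
    simp

lemma P_add_mul (i m : ℤ) : W.P (i + m * W.n) = W.P W.n ^ m * W.P i := by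
  induction m using Int.induction_on with
  | zero => simp
  | succ m ih => rw [add_mul, one_mul, ← add_assoc, P_add, ih, ← mul_assoc, zpow_add, zpow_one,
      ← zpow_one_add, add_comm, zpow_add, zpow_one]
  | pred m ih =>
    have := W.P_add (i + (-(m : ℤ) - 1) * W.n)
    rw [show i + (-(m : ℤ) - 1) * W.n + W.n = i + -(m : ℤ) * W.n by ring, ih] at this
    rw [eq_inv_mul_of_mul_eq this.symm, ← mul_assoc, ← zpow_neg_one, ← zpow_add]
    congr 2
    ring

lemma par_two_mul (k : ℤ) : W.par ((2 * k : ℤ)) = false := by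
  induction k using Int.induction_on with
  | zero => simp [W.par_zero]
  | succ k ih =>
    rw [show (2 * ((k : ℤ) + 1)) = 2 * k + 1 + 1 by ring]
    push_cast at ih ⊢
    rw [W.par_succ, W.par_succ, ih]; rfl
  | pred k ih =>
    rw [show (2 * (-(k : ℤ))) = 2 * (-k - 1) + 1 + 1 by ring] at ih
    push_cast at ih ⊢
    rw [W.par_succ, W.par_succ, Bool.not_not] at ih
    exact ih

lemma par_cast_eq_false_iff (i : ℤ) : W.par i = false ↔ Even i := by
  constructor
  · intro h
    by_contra h'
    rw [Int.not_even_iff_odd] at h'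
    obtain ⟨k, rfl⟩ := h'
    have := W.par_two_mul k
    push_cast at h this
    rw [W.par_succ, this] at h
    cases h
  · rintro ⟨k, rfl⟩
    rw [← two_mul]
    exact W.par_two_mul k

lemma par_eq_iff (i j : ℤ) : W.par i = W.par j ↔ Even (i - j) := by
  rw [Int.even_sub, ← par_cast_eq_false_iff W, ← par_cast_eq_false_iff W]
  cases W.par i <;> cases W.par j <;> simp

lemma toGL_pairM (a b : Letter) : (pairM a b : GL2Z) = Rm a * Rm b := by
  cases a <;> cases b <;> apply Units.ext <;> decide

lemma P_even {i : ℤ} (hi : Even i) : ∃ g ∈ Gamma, (g : GL2Z) = W.P i := by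
  obtain ⟨k, rfl⟩ := hi
  rw [← two_mul]
  induction k using Int.induction_on with
  | zero => exact ⟨1, one_mem _, by simp [P_zero]⟩
  | succ k ih =>
    obtain ⟨g, hg, he⟩ := ih
    refine ⟨g * pairM _ _, mul_mem hg (pairM_mem (W.lab ((2 * k : ℤ))) (W.lab ((2 * k + 1 : ℤ)))), ?_⟩
    rw [map_mul, he, toGL_pairM, show (2 * ((k : ℤ) + 1)) = 2 * k + 1 + 1 by ring, P_succ, P_succ,
      mul_assoc]
  | pred k ih =>
    obtain ⟨g, hg, he⟩ := ih
    refine ⟨g * pairM _ _, mul_mem hg (pairM_mem (W.lab ((2 * -k - 1 : ℤ)))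
      (W.lab ((2 * -k - 1 - 1 : ℤ)))), ?_⟩
    rw [map_mul, he, toGL_pairM, show (2 * (-(k : ℤ) - 1)) = 2 * -k - 1 - 1 by ring, P_pred, P_pred,
      mul_assoc]
    push_cast
    rfl

/-- Frames adapted to the letters, in which the partial products become nonnegative. -/
def frame : Letter → Bool → Matrix (Fin 2) (Fin 2) ℤ
  | .x, false => !![1, 1; 0, 1]
  | .y, false => !![0, -1; 1, 0]
  | .z, false => !![1, 0; 1, 1]
  | .x, true => !![1, 1; 1, 0]
  | .y, true => !![-1, 0; 0, 1]
  | .z, true => !![0, 1; 1, 1]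

def turnM : Bool → Matrix (Fin 2) (Fin 2) ℤ
  | true => !![1, 1; 0, 1]
  | false => !![1, 0; 1, 1]

lemma Rm_mul_frame (a b : Letter) (e : Bool) (h : a ≠ b) :
    (Rm a).1 * frame b (!e) = frame a e * turnM (xor (cyc a b) e) ∨
      (Rm a).1 * frame b (!e) = -(frame a e * turnM (xor (cyc a b) e)) := by
  cases a <;> cases b <;> cases e <;> first | exact absurd rfl h | (left; decide) | (right; decide)

/-- The product of the first `k` turn matrices. -/
def N (k : ℕ) : Matrix (Fin 2) (Fin 2) ℤ :=
  Nat.rec 1 (fun k p => p * turnM (xor (cyc (W.lab k) (W.lab (k + 1))) (W.par k))) k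

lemma N_succ (k : ℕ) :
    W.N (k + 1) = W.N k * turnM (xor (cyc (W.lab k) (W.lab (k + 1))) (W.par k)) := rfl

lemma P_mul_frame (k : ℕ) :
    (W.P k).1 * frame (W.lab k) (W.par k) = frame (W.lab 0) false * W.N k ∨
      (W.P k).1 * frame (W.lab k) (W.par k) = -(frame (W.lab 0) false * W.N k) := by
  induction k with
  | zero => left; simp [P_zero, W.par_zero, N]
  | succ k ih =>
    push_cast
    rw [P_succ, Units.val_mul, W.par_succ, mul_assoc, N_succ, ← mul_assoc (frame _ _)]
    rcases Rm_mul_frame (W.lab k) (W.lab (k + 1)) (W.par k) (W.adj k) with h | h <;>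
      rcases ih with h' | h' <;> simp only [Int.cast_natCast, h, mul_neg, ← mul_assoc, h'] <;> simp

lemma N_nonneg (k : ℕ) : 1 ≤ W.N k 0 0 ∧ 0 ≤ W.N k 0 1 ∧ 0 ≤ W.N k 1 0 ∧ 1 ≤ W.N k 1 1 := by
  induction k with
  | zero => simp [N]
  | succ k ih =>
    rw [N_succ]
    cases (xor (cyc (W.lab k) (W.lab (k + 1))) (W.par k)) <;>
      simp [turnM, Matrix.mul_apply, Fin.sum_univ_two] <;> omega

lemma N_trace_mono : Monotone fun k => W.N k 0 0 + W.N k 1 1 := by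
  refine monotone_nat_of_le_succ fun k => ?_
  have := W.N_nonneg k
  rw [N_succ]
  cases (xor (cyc (W.lab k) (W.lab (k + 1))) (W.par k)) <;>
    simp [turnM, Matrix.mul_apply, Fin.sum_univ_two] <;> omega

lemma exists_lab_ne : ∃ k : ℕ, k + 2 ≤ W.n ∧ W.lab k ≠ W.lab (k + 2) := by
  by_contra! h
  have h2 : ∀ k : ℕ, k + 1 ≤ W.n → (W.lab k = W.lab 0 ∨ W.lab k = W.lab 1) ∧
      (W.lab (k + 1) = W.lab 0 ∨ W.lab (k + 1) = W.lab 1) := by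
    intro k
    induction k with
    | zero => intro _; simp
    | succ k ih =>
      intro hk
      have := ih (by omega)
      have h3 := h k (by omega)
      push_cast
      refine ⟨this.2, ?_⟩
      rw [add_assoc, one_add_one_eq_two, ← h3]
      exact this.1
  have h3 : ∀ i : ZMod W.n, W.lab i = W.lab 0 ∨ W.lab i = W.lab 1 := by
    intro i
    have := (h2 i.val (ZMod.val_lt i)).1
    rwa [ZMod.natCast_zmod_val] at this
  have h4 : ∃ s, s ≠ W.lab 0 ∧ s ≠ W.lab 1 := by
    cases W.lab 0 <;> cases W.lab 1 <;> first
      | exact ⟨.x, by decide, by decide⟩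
      | exact ⟨.y, by decide, by decide⟩
      | exact ⟨.z, by decide, by decide⟩
  obtain ⟨s, hs0, hs1⟩ := h4
  obtain ⟨i, rfl⟩ := W.surj s
  exact (h3 i).elim hs0 hs1

lemma N_trace : 3 ≤ W.N W.n 0 0 + W.N W.n 1 1 := by
  obtain ⟨k, hk, hne⟩ := W.exists_lab_ne
  refine le_trans ?_ (W.N_trace_mono hk)
  have h0 := W.N_nonneg k
  simp only [show k + 2 = (k + 1) + 1 by rfl, N_succ]
  have h1 := W.adj k
  have h2 := W.adj (k + 1)
  push_cast
  rw [W.par_succ]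
  rw [show (k : ZMod W.n) + 2 = k + 1 + 1 by ring] at hne
  have : xor (cyc (W.lab k) (W.lab (k + 1))) (W.par k) =
      !(xor (cyc (W.lab (k + 1)) (W.lab (k + 1 + 1))) (!W.par k)) := by
    generalize W.lab k = a at *
    generalize W.lab (k + 1) = b at *
    generalize W.lab (k + 1 + 1) = c at *
    cases W.par k <;> cases a <;> cases b <;> cases c <;> simp_all [cyc]
  rw [this]
  cases (xor (cyc (W.lab (k + 1)) (W.lab (k + 1 + 1))) (!W.par k)) <;>
    simp [turnM, Matrix.mul_apply, Fin.sum_univ_two] <;> omega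

lemma frame_det (a : Letter) (e : Bool) : IsUnit (frame a e).det := by
  cases a <;> cases e <;> simp [frame, Matrix.det_fin_two_of]

lemma hyperbolic {v : SL2Z} (hv : (v : GL2Z) = W.P W.n) : Hyperbolic v := by
  have h := W.P_mul_frame W.n
  rw [ZMod.natCast_self, W.par_zero] at h
  have hvP : (W.P W.n).1 = v.1 := by rw [← hv]; rfl
  rw [hvP] at h
  set E := frame (W.lab 0) false
  have hE : IsUnit E.det := frame_det _ _
  have key : ∀ M : Matrix (Fin 2) (Fin 2) ℤ, v.1 * E = E * M → v.1.trace = M.trace := by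
    intro M hM
    have : v.1 = E * M * E⁻¹ := by
      rw [← hM, mul_assoc, Matrix.mul_nonsing_inv _ hE, mul_one]
    rw [this, Matrix.trace_mul_comm, ← mul_assoc, Matrix.nonsing_inv_mul _ hE, one_mul]
  have ht : 3 ≤ (W.N W.n).trace := by rw [Matrix.trace_fin_two]; exact W.N_trace
  unfold Hyperbolic
  rcases h with h | h
  · rw [key _ h, abs_of_nonneg (by omega)]
    omega
  · rw [key (-(W.N W.n)) (by rw [h, mul_neg]), Matrix.trace_neg, abs_neg, abs_of_nonneg (by omega)]
    omega

/-- The points seen from the vertices of the axis. -/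
lemma view_succ (i : ℤ) (u : Irr) : (W.P (i + 1))⁻¹ • u = Rm (W.lab i) • (W.P i)⁻¹ • u := by
  rw [P_succ, mul_inv_rev, Rm_inv, mul_smul]

lemma view_pred (i : ℤ) (u : Irr) :
    (W.P (i - 1))⁻¹ • u = Rm (W.lab (i - 1)) • (W.P i)⁻¹ • u := by
  rw [P_pred, mul_inv_rev, Rm_inv, mul_smul]

lemma view_period {u : Irr} (hu : W.P W.n • u = u) (i : ℤ) :
    (W.P (i + W.n))⁻¹ • u = (W.P i)⁻¹ • u := by
  rw [P_add, mul_inv_rev, mul_smul, inv_smul_eq_iff.2 hu.symm]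

lemma forward_unique {u u' : Irr} (hu : W.P W.n • u = u)
    (hl : ∀ i : ℕ, loc ((W.P i)⁻¹ • u) = W.lab i)
    (hl' : ∀ i : ℕ, loc ((W.P i)⁻¹ • u') = W.lab i) : u = u' := by
  obtain ⟨i, hi⟩ := W.surj .z
  have := itinerary_unique (s := fun k => W.lab k) (u := fun k => (W.P k)⁻¹ • u)
    (u' := fun k => (W.P k)⁻¹ • u') (n := W.n) (k₀ := i.val)
    (fun k => by simpa using W.view_succ k u) (fun k => by simpa using W.view_succ k u')
    hl hl' (Nat.pos_of_neZero _) (fun k => by simpa using W.view_period hu k)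
    (by simpa using hi)
  simpa [P_zero] using this

lemma backward_unique {u u' : Irr} (hu : W.P W.n • u = u)
    (hl : ∀ i : ℕ, loc ((W.P (-i))⁻¹ • u) = W.lab (-i - 1))
    (hl' : ∀ i : ℕ, loc ((W.P (-i))⁻¹ • u') = W.lab (-i - 1)) : u = u' := by
  obtain ⟨i, hi⟩ := W.surj .z
  have hs : ∀ (k : ℕ) (u : Irr),
      (W.P (-(k + 1 : ℕ)))⁻¹ • u = Rm (W.lab (-k - 1)) • (W.P (-k))⁻¹ • u := by
    intro k u
    have := W.view_pred (-k) u
    push_cast at this ⊢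
    rw [← this]
    congr 3
    ring
  have := itinerary_unique (s := fun k => W.lab (-k - 1)) (u := fun k => (W.P (-k))⁻¹ • u)
    (u' := fun k => (W.P (-k))⁻¹ • u') (n := W.n) (k₀ := (-i - 1).val)
    (fun k => hs k u) (fun k => hs k u')
    hl hl' (Nat.pos_of_neZero _)
    (fun k => by
      have := W.view_period hu (-(k + W.n : ℕ))
      simp only [← this]
      congr 3
      push_cast; ring)
    (by simpa using hi)
  simpa [P_zero] using this

lemma forward_or_backward {u : Irr} (hu : W.P W.n • u = u) :
    (∀ i : ℤ, loc ((W.P i)⁻¹ • u) = W.lab i) ∨ (∀ i : ℤ, loc ((W.P i)⁻¹ • u) = W.lab (i - 1)) := by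
  by_contra! h
  obtain ⟨⟨i, hi⟩, j, hj⟩ := h
  have hk : ∀ k : ℕ, loc ((W.P (i + k + 1 : ℤ))⁻¹ • u) = W.lab (i + k) := by
    intro k
    induction k with
    | zero =>
      rw [view_succ]
      simpa using loc_smul_of_ne hi
    | succ k ih =>
      rw [view_succ]
      push_cast at ih ⊢
      rw [show (i : ℤ) + (k + 1) = i + k + 1 by ring]
      apply loc_smul_of_ne
      rw [ih, ← add_assoc]
      exact W.adj _
  have hper : ∀ (m : ℕ) (i : ℤ), (W.P (i + m * W.n))⁻¹ • u = (W.P i)⁻¹ • u := by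
    intro m i
    induction m with
    | zero => simp
    | succ m ih =>
      push_cast
      rw [add_mul, one_mul, ← add_assoc, W.view_period hu, ih]
  apply hj
  have hn : 0 < W.n := Nat.pos_of_neZero _
  have h1 := hper (i - j + 1).natAbs j
  have h2 := hk (j + (i - j + 1).natAbs * W.n - i - 1).toNat
  have h3 : i + 1 ≤ j + (i - j + 1).natAbs * W.n := by
    have : ((i - j + 1).natAbs : ℤ) * 1 ≤ (i - j + 1).natAbs * W.n := by gcongr; exact_mod_cast hn
    omega
  have h4 : (((j + (i - j + 1).natAbs * W.n - i - 1).toNat : ℕ) : ℤ) =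
    j + (i - j + 1).natAbs * W.n - i - 1 := Int.toNat_of_nonneg (by omega)
  rw [h4, show i + (j + (i - j + 1).natAbs * W.n - i - 1) + 1 =
    j + (i - j + 1).natAbs * W.n by ring, h1] at h2
  rw [h2]
  congr 1
  have h5 := congrArg (Int.cast : ℤ → ZMod W.n) h4
  rw [Int.cast_natCast] at h5
  rw [h5]
  push_cast
  simp
  ring

lemma exists_ends {v : SL2Z} (hv : (v : GL2Z) = W.P W.n) : ∃ a b : Irr, a ≠ b ∧
    fixedSet v = {(a.1 : OnePoint ℝ), (b.1 : OnePoint ℝ)} ∧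
    (∀ i : ℤ, loc ((W.P i)⁻¹ • a) = W.lab i) ∧ (∀ i : ℤ, loc ((W.P i)⁻¹ • b) = W.lab (i - 1)) := by
  obtain ⟨a, b, hab, h⟩ := (W.hyperbolic hv).fixed
  have ha : W.P W.n • a = a := by rw [← hv, ← mobius_coe_eq, h]; simp
  have hb : W.P W.n • b = b := by rw [← hv, ← mobius_coe_eq, h]; simp
  rcases W.forward_or_backward ha with h1 | h1 <;> rcases W.forward_or_backward hb with h2 | h2
  · exact absurd (W.forward_unique ha (fun i => by simpa using h1 i) (fun i => by simpa using h2 i))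
      hab
  · exact ⟨a, b, hab, h, h1, h2⟩
  · exact ⟨b, a, hab.symm, by rw [h, Set.pair_comm], h2, h1⟩
  · exact absurd (W.backward_unique ha (fun i => by simpa using h1 (-i))
      (fun i => by simpa using h2 (-i))) hab

end Loop

/-- The hyperbolic element attached to a loop, with its attracting and repelling fixed points. -/
structure Axis (W : Loop) where
  v : Gamma
  v_eq : ((v : SL2Z) : GL2Z) = W.P W.n
  a : Irr
  b : Irr
  ne : a ≠ b
  fixed : fixedSet (v : SL2Z) = {(a.1 : OnePoint ℝ), (b.1 : OnePoint ℝ)}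
  loc_a : ∀ i : ℤ, loc ((W.P i)⁻¹ • a) = W.lab i
  loc_b : ∀ i : ℤ, loc ((W.P i)⁻¹ • b) = W.lab (i - 1)

lemma Loop.exists_axis (W : Loop) (v : Gamma) (hv : ((v : SL2Z) : GL2Z) = W.P W.n) :
    ∃ X : Axis W, X.v = v := by
  obtain ⟨a, b, h1, h2, h3, h4⟩ := W.exists_ends hv
  exact ⟨⟨v, hv, a, b, h1, h2, h3, h4⟩, rfl⟩

lemma Link.ne {a b c d : Irr} (h : Link a b c d) : c ≠ a ∧ c ≠ b ∧ d ≠ a ∧ d ≠ b ∧ c ≠ d := by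
  unfold Link at h
  refine ⟨?_, ?_, ?_, ?_, ?_⟩ <;> rintro rfl
  · simp at h
  · simp at h
  · simp at h
  · simp at h
  · exact absurd h (not_lt.2 (mul_self_nonneg _))

lemma not_link_of_loc {a b c d : Irr} (h : loc c = loc d) (ha : loc a ≠ loc c)
    (hb : loc b ≠ loc c) : ¬ Link a b c d := by
  have key : ∀ e : Irr, loc e ≠ loc c → 0 < (c.1 - e.1) * (d.1 - e.1) := by
    intro e he
    cases hc : loc c <;> cases he' : loc e <;> rw [hc] at h he <;> rw [he'] at he <;>
      (try exact absurd rfl he) <;> have hd := h.symm <;>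
      simp only [loc_eq_x, loc_eq_y, loc_eq_z] at hc hd he'
    · exact mul_pos (by linarith) (by linarith)
    · exact mul_pos (by linarith) (by linarith)
    · exact mul_pos_of_neg_of_neg (by linarith) (by linarith)
    · exact mul_pos_of_neg_of_neg (by linarith) (by linarith)
    · exact mul_pos_of_neg_of_neg (by linarith) (by linarith)
    · exact mul_pos (by linarith) (by linarith)
  have := mul_pos (key a ha) (key b hb)
  unfold Link
  intro h'
  linarith

/-- The product of the reflections of a list of letters, the head acting first. -/
def listProd : List Letter → GL2Z
  | [] => 1
  | s :: l => listProd l * Rm s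

lemma loc_listProd {s : Letter} {l : List Letter} (hl : (s :: l).IsChain (· ≠ ·)) {u u' : Irr}
    (hu : loc u = s) (hu' : loc u' = s) : loc (listProd l • u) = loc (listProd l • u') := by
  induction l generalizing s u u' with
  | nil => simp [listProd, hu, hu']
  | cons t l ih =>
    rw [List.isChain_cons_cons] at hl
    rw [listProd, mul_smul, mul_smul]
    exact ih hl.2 (loc_smul_of_ne (by rw [hu]; exact hl.1)) (loc_smul_of_ne (by rw [hu']; exact hl.1))

lemma exists_listProd {g : GL2Z} (hg : g ∈ Subgroup.closure (Set.range Rm)) :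
    ∃ l : List Letter, l.IsChain (· ≠ ·) ∧ g = listProd l := by
  have step : ∀ (g : GL2Z) (s : Letter), (∃ l : List Letter, l.IsChain (· ≠ ·) ∧ g = listProd l) →
      ∃ l : List Letter, l.IsChain (· ≠ ·) ∧ g * Rm s = listProd l := by
    rintro _ s ⟨l, hl, rfl⟩
    rcases l with _ | ⟨t, l⟩
    · exact ⟨[s], by simp, rfl⟩
    · by_cases h : s = t
      · subst h
        refine ⟨l, hl.tail, ?_⟩
        rw [listProd, mul_assoc, Rm_mul_self, mul_one]
      · exact ⟨s :: t :: l, List.isChain_cons_cons.2 ⟨h, hl⟩, rfl⟩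
  induction hg using Subgroup.closure_induction_right with
  | one => exact ⟨[], by simp, rfl⟩
  | mul_right x _ y hy ih =>
    obtain ⟨s, rfl⟩ := hy
    exact step x s ih
  | mul_inv_cancel x _ y hy ih =>
    obtain ⟨s, rfl⟩ := hy
    rw [Rm_inv]
    exact step x s ih

lemma Rm_mem (s : Letter) : Rm s ∈ Subgroup.closure (Set.range Rm) :=
  Subgroup.subset_closure ⟨s, rfl⟩

lemma toGL_mem {g : SL2Z} (hg : g ∈ Gamma) : (g : GL2Z) ∈ Subgroup.closure (Set.range Rm) := by
  have : Gamma ≤ (Subgroup.closure (Set.range Rm)).comap Matrix.SpecialLinearGroup.toGL := by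
    rw [Gamma, Subgroup.closure_le]
    rintro _ (rfl | rfl)
    · change Matrix.SpecialLinearGroup.toGL (pairM .x .y) ∈ Subgroup.closure (Set.range Rm)
      rw [Loop.toGL_pairM]
      exact mul_mem (Rm_mem _) (Rm_mem _)
    · change Matrix.SpecialLinearGroup.toGL (pairM .y .z) ∈ Subgroup.closure (Set.range Rm)
      rw [Loop.toGL_pairM]
      exact mul_mem (Rm_mem _) (Rm_mem _)
  exact this hg

lemma Loop.P_mem (W : Loop) (i : ℤ) : W.P i ∈ Subgroup.closure (Set.range Rm) := by
  induction i using Int.induction_on with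
  | zero => exact one_mem _
  | succ i ih => rw [W.P_succ]; exact mul_mem ih (Rm_mem _)
  | pred i ih => rw [W.P_pred]; exact mul_mem ih (Rm_mem _)

lemma exists_third (a b : Letter) : ∃ c, c ≠ a ∧ c ≠ b := by
  cases a <;> cases b <;> first | exact ⟨.x, by decide, by decide⟩ |
    exact ⟨.y, by decide, by decide⟩ | exact ⟨.z, by decide, by decide⟩

lemma eq_third {a b c d : Letter} (hab : a ≠ b) (ha : c ≠ a) (hb : c ≠ b) (ha' : d ≠ a)
    (hb' : d ≠ b) : c = d := by
  cases a <;> cases b <;> cases c <;> cases d <;> simp_all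

lemma Loop.adj_pred (W : Loop) (i : ZMod W.n) : W.lab (i - 1) ≠ W.lab i := by
  have := W.adj (i - 1)
  rwa [sub_add_cancel] at this

namespace Axis

variable {W : Loop} (X : Axis W)

noncomputable def A (i : ℤ) : Irr := (W.P i)⁻¹ • X.a
noncomputable def B (i : ℤ) : Irr := (W.P i)⁻¹ • X.b

lemma loc_A (i : ℤ) : loc (X.A i) = W.lab i := X.loc_a i
lemma loc_B (i : ℤ) : loc (X.B i) = W.lab (i - 1) := X.loc_b i
lemma A_succ (i : ℤ) : X.A (i + 1) = Rm (W.lab i) • X.A i := W.view_succ i _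
lemma B_succ (i : ℤ) : X.B (i + 1) = Rm (W.lab i) • X.B i := W.view_succ i _
lemma A_pred (i : ℤ) : X.A (i - 1) = Rm (W.lab (i - 1)) • X.A i := W.view_pred i _
lemma B_pred (i : ℤ) : X.B (i - 1) = Rm (W.lab (i - 1)) • X.B i := W.view_pred i _
lemma A_zero : X.A 0 = X.a := by simp [A, W.P_zero]
lemma B_zero : X.B 0 = X.b := by simp [B, W.P_zero]

lemma smul_eq_iff (u : Irr) : W.P W.n • u = u ↔ u = X.a ∨ u = X.b := by
  rw [← X.v_eq, ← mobius_coe_eq, X.fixed]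
  simp [Subtype.ext_iff]

lemma cast_eq_of_A_eq {i j : ℤ} (h : X.A i = X.A j) : (i : ZMod W.n) = j := by
  have h1 : ∀ k : ℕ, X.A (i + k) = X.A (j + k) := by
    intro k
    induction k with
    | zero => simpa using h
    | succ k ih =>
      push_cast
      rw [← add_assoc, ← add_assoc, A_succ, A_succ, ← X.loc_A, ← X.loc_A, ih]
  have h2 : ∀ z : ZMod W.n, W.lab (i + z) = W.lab (j + z) := by
    intro z
    have := congrArg loc (h1 z.val)
    rw [loc_A, loc_A] at this
    simpa using this
  have := W.aper (i - j) (fun z => by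
    have := h2 (z - j)
    rw [add_sub_cancel] at this
    rw [← this]; congr 1; ring)
  exact sub_eq_zero.1 this

lemma exists_eq_P_inv {l : List Letter} (hl : l.IsChain (· ≠ ·)) {j : ℤ}
    (h : loc (listProd l • X.A j) ≠ loc (listProd l • X.B j)) :
    ∃ i : ℤ, listProd l = (W.P i)⁻¹ * W.P j := by
  induction l generalizing j with
  | nil => exact ⟨j, by simp [listProd]⟩
  | cons s l ih =>
    rw [listProd, mul_smul, mul_smul] at h
    by_cases h1 : s = W.lab j
    · subst h1
      rw [← A_succ, ← B_succ] at h
      obtain ⟨i, hi⟩ := ih hl.tail h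
      refine ⟨i, ?_⟩
      rw [listProd, hi, W.P_succ, mul_assoc, mul_assoc, Rm_mul_self, mul_one]
    by_cases h2 : s = W.lab (j - 1)
    · subst h2
      rw [← A_pred, ← B_pred] at h
      obtain ⟨i, hi⟩ := ih hl.tail h
      refine ⟨i, ?_⟩
      rw [listProd, hi, W.P_pred, mul_assoc, mul_assoc, Rm_mul_self, mul_one]
    · exact absurd (loc_listProd hl (loc_smul_of_ne (by rw [loc_A]; exact Ne.symm h1))
        (loc_smul_of_ne (by rw [loc_B]; exact Ne.symm h2))) h

lemma exists_eq_P_inv_of_mem {g : GL2Z} (hg : g ∈ Subgroup.closure (Set.range Rm))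
    (h : loc (g • X.a) ≠ loc (g • X.b)) : ∃ i : ℤ, g = (W.P i)⁻¹ := by
  obtain ⟨l, hl, rfl⟩ := exists_listProd hg
  obtain ⟨i, hi⟩ := X.exists_eq_P_inv (j := 0) hl (by rwa [A_zero, B_zero])
  exact ⟨i, by rw [hi, W.P_zero, mul_one]⟩

lemma good_iff (h : Gamma) : GoodConj X.v h ↔
    Linked {(X.a.1 : OnePoint ℝ), (X.b.1 : OnePoint ℝ)}
      {((((h : SL2Z) : GL2Z) • X.a : Irr).1 : OnePoint ℝ),
        ((((h : SL2Z) : GL2Z) • X.b : Irr).1 : OnePoint ℝ)} := by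
  have hv := W.hyperbolic X.v_eq
  obtain ⟨h1, h2⟩ := fixedSet_conj (g := h) hv X.fixed
  unfold GoodConj
  have e : ((h * X.v * h⁻¹ : Gamma) : SL2Z) = (h : SL2Z) * X.v * (h : SL2Z)⁻¹ := rfl
  rw [e, h2, X.fixed]
  exact ⟨fun h => h.2.2, fun h => ⟨hv, h1, h⟩⟩

lemma exists_loc_ne {h : Gamma} (hh : GoodConj X.v h) : ∃ i : ℤ,
    loc ((W.P i)⁻¹ • ((h : SL2Z) : GL2Z) • X.a) ≠ loc ((W.P i)⁻¹ • ((h : SL2Z) : GL2Z) • X.b) := by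
  by_contra! hl
  rw [good_iff] at hh
  set u := ((h : SL2Z) : GL2Z) • X.a with hu
  set u' := ((h : SL2Z) : GL2Z) • X.b with hu'
  have hne : u ≠ u' := fun h => X.ne (MulAction.injective _ h)
  by_cases h1 : ∃ i : ℤ, loc ((W.P i)⁻¹ • u) ≠ W.lab i ∧ loc ((W.P i)⁻¹ • u) ≠ W.lab (i - 1)
  · obtain ⟨i, h2, h3⟩ := h1
    have aux : ∀ p q : Irr, loc ((W.P i)⁻¹ • p) ≠ loc ((W.P i)⁻¹ • q) → p ≠ q := by
      rintro p q h rfl; exact h rfl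
    rw [linked_iff_link X.ne hne
      (aux _ _ (by rwa [X.loc_a])) (aux _ _ (by rwa [X.loc_b]))
      (aux _ _ (by rwa [X.loc_a, ← hl])) (aux _ _ (by rwa [X.loc_b, ← hl])),
      ← link_smul (W.P i)⁻¹] at hh
    exact not_link_of_loc (hl i) (by rw [X.loc_a]; exact h2.symm) (by rw [X.loc_b]; exact h3.symm) hh
  · push Not at h1
    have hfwd : ∀ w : Irr, (∀ i : ℤ, loc ((W.P i)⁻¹ • w) ≠ W.lab i →
        loc ((W.P i)⁻¹ • w) = W.lab (i - 1)) → loc ((W.P 0)⁻¹ • w) = W.lab 0 → X.a = w := by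
      intro w hw h0
      refine W.forward_unique ((X.smul_eq_iff _).2 (Or.inl rfl)) (fun i => by simpa using X.loc_a i) ?_
      intro i
      induction i with
      | zero => simpa using h0
      | succ i ih =>
        by_contra h'
        have := hw (i + 1) (by simpa using h')
        rw [W.view_succ] at this
        exact loc_smul_of_eq (by simpa using ih) (by simpa using this)
    have hbwd : ∀ w : Irr, (∀ i : ℤ, loc ((W.P i)⁻¹ • w) ≠ W.lab i →
        loc ((W.P i)⁻¹ • w) = W.lab (i - 1)) → loc ((W.P 0)⁻¹ • w) ≠ W.lab 0 → X.b = w := by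
      intro w hw h0
      refine W.backward_unique ((X.smul_eq_iff _).2 (Or.inr rfl))
        (fun i => by simpa using X.loc_b (-i)) ?_
      intro i
      induction i with
      | zero =>
        have := hw 0 (by simpa using h0)
        simpa using this
      | succ i ih =>
        have e : (-((i + 1 : ℕ) : ℤ)) = -i - 1 := by push_cast; ring
        have h3 := hw (-i - 1)
        rw [W.view_pred] at h3
        rw [e, W.view_pred]
        have h4 : loc (Rm (W.lab ((-(i : ℤ) : ℤ) - 1)) • (W.P (-(i : ℤ)))⁻¹ • w) ≠
            W.lab (((-(i : ℤ) - 1 : ℤ))) := by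
          have := loc_smul_of_eq ih
          simpa using this
        have := h3 h4
        rw [this]
        congr 1
        push_cast
        ring
    have h1' : ∀ i : ℤ, loc ((W.P i)⁻¹ • u') ≠ W.lab i → loc ((W.P i)⁻¹ • u') = W.lab (i - 1) := by
      intro i; rw [← hl]; exact h1 i
    apply hne
    by_cases h0 : loc ((W.P 0)⁻¹ • u) = W.lab 0
    · rw [← hfwd u h1 h0, ← hfwd u' h1' (by rwa [← hl])]
    · rw [← hbwd u h1 h0, ← hbwd u' h1' (by rwa [← hl])]

lemma good_form {h : Gamma} (hh : GoodConj X.v h) :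
    ∃ i j : ℤ, ((h : SL2Z) : GL2Z) = W.P i * (W.P j)⁻¹ := by
  obtain ⟨i, hi⟩ := X.exists_loc_ne hh
  rw [← mul_smul, ← mul_smul] at hi
  obtain ⟨j, hj⟩ := X.exists_eq_P_inv_of_mem
    (mul_mem (inv_mem (W.P_mem i)) (toGL_mem h.2)) hi
  exact ⟨i, j, by rw [← hj, mul_inv_cancel_left]⟩

/-- The double coset relation. -/
def rel (h h' : {h : Gamma // GoodConj X.v h}) : Prop :=
  ∃ m k : ℤ, (h' : Gamma) = X.v ^ m * (h : Gamma) * X.v ^ k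

lemma rel_equiv : Equivalence X.rel where
  refl h := ⟨0, 0, by simp⟩
  symm := by
    rintro h h' ⟨m, k, e⟩
    refine ⟨-m, -k, ?_⟩
    rw [e]; group
  trans := by
    rintro h h' h'' ⟨m, k, e⟩ ⟨m', k', e'⟩
    refine ⟨m' + m, k + k', ?_⟩
    rw [e', e]; group

lemma sTwo_eq : sTwo X.v = Nat.card (Quot X.rel) := rfl

lemma toGL_gamma_inj {g h : Gamma} (e : ((g : SL2Z) : GL2Z) = ((h : SL2Z) : GL2Z)) : g = h :=
  Subtype.ext (Matrix.SpecialLinearGroup.toGL_injective e)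

lemma toGL_conj (m k : ℤ) (h : Gamma) {i j : ℤ} (e : ((h : SL2Z) : GL2Z) = W.P i * (W.P j)⁻¹) :
    (((X.v ^ m * h * X.v ^ k : Gamma) : SL2Z) : GL2Z) =
      W.P (i + m * W.n) * (W.P (j + (-k) * W.n))⁻¹ := by
  push_cast
  rw [map_mul, map_mul, map_zpow, map_zpow, X.v_eq, e, W.P_add_mul, W.P_add_mul, mul_inv_rev,
    zpow_neg, inv_inv]
  simp only [mul_assoc]

lemma cast_eq_iff (i j : ℤ) : (i : ZMod W.n) = j ↔ ∃ m : ℤ, j = i + m * W.n := by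
  rw [ZMod.intCast_eq_intCast_iff_dvd_sub]
  constructor
  · rintro ⟨m, hm⟩; exact ⟨m, by linarith⟩
  · rintro ⟨m, hm⟩; exact ⟨m, by linarith⟩

lemma finite_quot : Finite (Quot X.rel) := by
  have hf : ∀ q : Quot X.rel, ∃ p : ℤ × ℤ, ((q.out.1 : SL2Z) : GL2Z) = W.P p.1 * (W.P p.2)⁻¹ :=
    fun q => by
      obtain ⟨i, j, h⟩ := X.good_form q.out.2
      exact ⟨(i, j), h⟩
  choose f hf using hf
  refine Finite.of_injective (β := ZMod W.n × ZMod W.n) (fun q => ((f q).1, (f q).2)) ?_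
  intro q q' h
  simp only [Prod.mk.injEq] at h
  obtain ⟨m, hm⟩ := (cast_eq_iff _ _).1 h.1
  obtain ⟨k, hk⟩ := (cast_eq_iff _ _).1 h.2
  have : X.rel q.out q'.out := by
    refine ⟨m, -k, toGL_gamma_inj ?_⟩
    rw [X.toGL_conj _ _ _ (hf q), hf q', hm, hk, neg_neg]
  rw [← Quot.out_eq q, ← Quot.out_eq q']
  exact Quot.sound this

lemma exists_gamma {i j : ℤ} (h : W.par i = W.par j) :
    ∃ g : Gamma, ((g : SL2Z) : GL2Z) = W.P i * (W.P j)⁻¹ := by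
  rw [W.par_eq_iff, Int.even_sub] at h
  by_cases hi : Even i
  · obtain ⟨g, hg, e⟩ := W.P_even hi
    obtain ⟨g', hg', e'⟩ := W.P_even (h.1 hi)
    exact ⟨⟨g, hg⟩ * ⟨g', hg'⟩⁻¹, by simp [e, e']⟩
  · have hj : ¬ Even j := fun h' => hi (h.2 h')
    obtain ⟨g, hg, e⟩ := W.P_even (i := i + 1) (by rw [Int.even_add_one]; exact hi)
    obtain ⟨g', hg', e'⟩ := W.P_even (i := j + 1) (by rw [Int.even_add_one]; exact hj)
    refine ⟨⟨g, hg⟩ * ⟨pairM (W.lab i) (W.lab j), pairM_mem _ _⟩ * ⟨g', hg'⟩⁻¹, ?_⟩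
    push_cast
    rw [map_mul, map_mul, map_inv, e, e', Loop.toGL_pairM, W.P_succ, W.P_succ, mul_inv_rev, Rm_inv]
    simp only [mul_assoc]
    rw [← mul_assoc (Rm (W.lab j)), Rm_mul_self, one_mul, ← mul_assoc (Rm (W.lab i)), Rm_mul_self,
      one_mul]

/-- The pair of positions `(i, j)` is the first place where two crossing lifts meet. -/
structure Meets (i j : ZMod W.n) : Prop where
  par_eq : W.par i = W.par j
  ne₁ : W.lab (i - 1) ≠ W.lab j
  ne₂ : W.lab (i - 1) ≠ W.lab (j - 1)
  link : Link (X.A i.val) (X.B i.val) (X.A j.val) (X.B j.val)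

lemma loc_before {i j : ℤ} (h1 : W.lab (i - 1) ≠ W.lab j) (h2 : W.lab (i - 1) ≠ W.lab (j - 1))
    (k : ℕ) : loc ((W.P (i - 1 - k))⁻¹ • W.P i • X.A j) = W.lab (i - 1 - k) ∧
      loc ((W.P (i - 1 - k))⁻¹ • W.P i • X.B j) = W.lab (i - 1 - k) := by
  induction k with
  | zero =>
    simp only [Nat.cast_zero, sub_zero]
    rw [W.view_pred, inv_smul_smul, W.view_pred, inv_smul_smul]
    exact ⟨loc_smul_of_ne (by rw [loc_A]; exact h1.symm), loc_smul_of_ne (by rw [loc_B]; exact h2.symm)⟩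
  | succ k ih =>
    push_cast
    rw [← sub_sub, ← sub_sub, W.view_pred, W.view_pred]
    have h3 := W.adj_pred (i - 1 - k)
    have e : (((i - 1 - k : ℤ) : ZMod W.n) - 1) = i - 1 - k - 1 := by push_cast; rfl
    rw [e]
    exact ⟨loc_smul_of_ne (by rw [ih.1]; exact h3.symm), loc_smul_of_ne (by rw [ih.2]; exact h3.symm)⟩

lemma first_meet_unique (X : Axis W) {i j i' j' : ℤ} (h1 : W.lab (i - 1) ≠ W.lab j)
    (h2 : W.lab (i - 1) ≠ W.lab (j - 1))
    (e : W.P i * (W.P j)⁻¹ = W.P i' * (W.P j')⁻¹) : i ≤ i' := by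
  by_contra! hlt
  obtain ⟨k, hk⟩ : ∃ k : ℕ, i' = i - 1 - k := ⟨(i - 1 - i').toNat, by omega⟩
  obtain ⟨h3, h4⟩ := X.loc_before h1 h2 k
  rw [← hk, A, ← mul_smul (W.P i), e, ← mul_smul, inv_mul_cancel_left, X.loc_a] at h3
  rw [← hk, B, ← mul_smul (W.P i), e, ← mul_smul, inv_mul_cancel_left, X.loc_b] at h4
  exact W.adj_pred j' (h4.trans h3.symm)

lemma card_le_sTwo (S : Finset (ZMod W.n × ZMod W.n)) (hS : ∀ p ∈ S, X.Meets p.1 p.2) :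
    S.card ≤ sTwo X.v := by
  have hg : ∀ p : S, ∃ g : Gamma,
      ((g : SL2Z) : GL2Z) = W.P p.1.1.val * (W.P p.1.2.val)⁻¹ := fun p =>
    exists_gamma (by simpa using (hS p.1 p.2).par_eq)
  choose g hg using hg
  have good : ∀ p : S, GoodConj X.v (g p) := by
    intro p
    have hl := (hS p.1 p.2).link
    rw [good_iff]
    have hl' : Link X.a X.b (((g p : SL2Z) : GL2Z) • X.a) (((g p : SL2Z) : GL2Z) • X.b) := by
      rw [← link_smul (W.P p.1.1.val)⁻¹, ← mul_smul, ← mul_smul, hg, inv_mul_cancel_left]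
      exact hl
    obtain ⟨k1, k2, k3, k4, k5⟩ := hl'.ne
    exact (linked_iff_link X.ne k5 k1 k2 k3 k4).2 hl'
  have hfin := X.finite_quot
  rw [sTwo_eq, ← Fintype.card_coe, ← Nat.card_eq_fintype_card]
  refine Nat.card_le_card_of_injective (fun p : S => Quot.mk X.rel ⟨g p, good p⟩) ?_
  intro p p' h
  have hrel := (X.rel_equiv.eqvGen_iff).1 (Quot.eqvGen_exact h)
  obtain ⟨m, k, e⟩ := hrel
  have e := congrArg (fun g : Gamma => ((g : SL2Z) : GL2Z)) e
  simp only at e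
  rw [X.toGL_conj _ _ _ (hg p), hg p'] at e
  set i : ℤ := (p.1.1.val : ℤ) + m * W.n with hi
  set j : ℤ := (p.1.2.val : ℤ) + -k * W.n with hj
  have hi' : (i : ZMod W.n) = p.1.1 := by simp [hi]
  have hj' : (j : ZMod W.n) = p.1.2 := by simp [hj]
  have hp := hS p.1 p.2
  have hp' := hS p'.1 p'.2
  have le1 := X.first_meet_unique (i := i) (j := j) (by rw [hi', hj']; exact hp.ne₁)
    (by rw [hi', hj']; exact hp.ne₂) e.symm
  have le2 := X.first_meet_unique (i := p'.1.1.val) (j := p'.1.2.val) (by simpa using hp'.ne₁)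
    (by simpa using hp'.ne₂) e
  have ei := le_antisymm le1 le2
  rw [ei, mul_right_inj, inv_inj] at e
  have ej : ((p'.1.2.val : ℤ) : ZMod W.n) = j := X.cast_eq_of_A_eq (by rw [A, A, e])
  apply Subtype.ext
  refine Prod.ext ?_ ?_
  · rw [← hi', ei]; simp
  · rw [← hj', ← ej]; simp

lemma loc_P {i : ℕ} {u : Irr} (hu : loc u ≠ W.lab i) :
    loc (W.P (i + 1 : ℕ) • u) = W.lab 0 := by
  induction i generalizing u with
  | zero =>
    rw [show ((0 + 1 : ℕ) : ℤ) = 0 + 1 by simp, W.P_succ, W.P_zero, one_mul]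
    simpa using loc_smul_of_ne hu
  | succ i ih =>
    rw [show ((i + 1 + 1 : ℕ) : ℤ) = (i + 1 : ℕ) + 1 by push_cast; ring, W.P_succ, mul_smul]
    apply ih
    rw [Int.cast_natCast, loc_smul_of_ne hu]
    push_cast
    exact (W.adj i).symm

lemma zpow_eq_one (X : Axis W) {m : ℤ} (h : W.P W.n ^ m = 1) : m = 0 := by
  have key : ∀ m : ℕ, W.P W.n ^ m = 1 → m = 0 := by
    intro m h
    by_contra hm
    have hn : 0 < W.n := Nat.pos_of_neZero _
    obtain ⟨i, hi⟩ : ∃ i, m * W.n = i + 1 := ⟨m * W.n - 1, by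
      have := Nat.mul_pos (Nat.pos_of_ne_zero hm) hn; omega⟩
    obtain ⟨t, h1, h2⟩ := exists_third (W.lab i) (W.lab 0)
    have : ∃ u : Irr, loc u = t := by
      by_cases h : loc X.a = t
      · exact ⟨_, h⟩
      · exact ⟨_, loc_smul_of_ne h⟩
    obtain ⟨u, rfl⟩ := this
    have h3 := loc_P h1
    have h4 := W.P_add_mul 0 m
    rw [zpow_natCast, h, W.P_zero, zero_add, mul_one] at h4
    rw [← hi] at h3
    push_cast at h3
    rw [h4, one_smul] at h3
    exact h2 h3
  have := key m.natAbs (by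
    rcases Int.natAbs_eq m with h' | h'
    · rw [h'] at h; simpa using h
    · rw [h', zpow_neg, inv_eq_one] at h; simpa using h)
  omega

lemma det_P (i : ℤ) (g : SL2Z) (h : (g : GL2Z) = W.P i) : Even i := by
  have hR : ∀ s, (Rm s).1.det = -1 := by intro s; cases s <;> simp [Rm, Matrix.det_fin_two_of]
  have key : ∀ i : ℤ, (W.P i).1.det = if Even i then 1 else -1 := by
    intro i
    induction i using Int.induction_on with
    | zero => simp [W.P_zero]
    | succ i ih =>
      rw [W.P_succ, Units.val_mul, Matrix.det_mul, ih, hR]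
      simp only [Int.even_add_one]
      split_ifs <;> simp_all
    | pred i ih =>
      rw [W.P_pred, Units.val_mul, Matrix.det_mul, ih, hR]
      simp only [Int.even_sub_one]
      split_ifs <;> simp_all
  have h1 := key i
  rw [← h] at h1
  have h2 : (g : GL2Z).1.det = 1 := g.2
  rw [h2] at h1
  by_contra h3
  rw [if_neg h3] at h1
  norm_num at h1

lemma notProperPower : NotProperPower X.v := by
  rintro ⟨u, k, hk, hvu⟩
  set U : GL2Z := ((u : SL2Z) : GL2Z) with hU
  have hvU : W.P W.n = U ^ k := by
    rw [← X.v_eq, hvu]; push_cast; rw [map_pow]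
  have perm : ∀ w : Irr, W.P W.n • w = w → W.P W.n • (U • w) = U • w := by
    intro w hw
    rw [← mul_smul, hvU, ← pow_succ, pow_succ', mul_smul, ← hvU, hw]
  have ha := (X.smul_eq_iff _).1 (perm _ ((X.smul_eq_iff X.a).2 (Or.inl rfl)))
  have hb := (X.smul_eq_iff _).1 (perm _ ((X.smul_eq_iff X.b).2 (Or.inr rfl)))
  have hne : U • X.a ≠ U • X.b := fun h => X.ne (MulAction.injective _ h)
  have hadj : W.lab (-1) ≠ W.lab 0 := by simpa using W.adj_pred 0
  have la : loc X.a = W.lab 0 := by simpa [A_zero] using X.loc_A 0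
  have lb : loc X.b = W.lab (-1) := by simpa [B_zero] using X.loc_B 0
  have hloc : loc (U • X.a) ≠ loc (U • X.b) := by
    rcases ha with ha | ha <;> rcases hb with hb | hb
    · exact absurd (ha.trans hb.symm) hne
    · rw [ha, hb, la, lb]; exact hadj.symm
    · rw [ha, hb, la, lb]; exact hadj
    · exact absurd (ha.trans hb.symm) hne
  obtain ⟨j, hj⟩ := X.exists_eq_P_inv_of_mem (toGL_mem u.2) hloc
  rcases ha with ha | ha
  · have h1 : X.A j = X.A 0 := by rw [A_zero, ← ha, A]; rw [← hU] at hj; rw [← hj, ha]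
    obtain ⟨m, hm⟩ := (cast_eq_iff _ _).1 (X.cast_eq_of_A_eq h1).symm
    have h2 : U = W.P W.n ^ (-m) := by
      rw [hU, hj, hm, W.P_add_mul, W.P_zero, mul_one, zpow_neg]
    have h3 : W.P W.n ^ (-m * k - 1) = 1 := by
      rw [zpow_sub, zpow_mul, ← h2, zpow_natCast, ← hvU]; simp
    have h4 := X.zpow_eq_one h3
    have h5 : (k : ℤ) ∣ 1 := ⟨-m, by linarith⟩
    have := Int.le_of_dvd one_pos h5
    omega
  · have h1 : ∀ i : ℕ, X.A (j + i) = X.B (-i) := by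
      intro i
      induction i with
      | zero =>
        simp only [Nat.cast_zero, add_zero, neg_zero, B_zero]
        rw [← ha, A, ← hj]
      | succ i ih =>
        have e : W.lab ((j + i : ℤ)) = W.lab (((-i : ℤ) : ZMod W.n) - 1) := by
          rw [← X.loc_A, ih, X.loc_B]
        push_cast
        rw [← add_assoc, A_succ, e, ih, ← B_pred]
        congr 1
        ring
    have h2 : ∀ z : ZMod W.n, W.lab (j + z) = W.lab (-z - 1) := by
      intro z
      have := congrArg loc (h1 z.val)
      rw [loc_A, loc_B] at this
      simpa using this
    have h3 : Even j := det_P j ((u⁻¹ : Gamma) : SL2Z) (by push_cast; rw [map_inv, hj, inv_inv])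
    obtain ⟨r, rfl⟩ := h3
    have h4 := h2 (((-r - 1 : ℤ)) : ZMod W.n)
    push_cast at h4
    apply W.adj (r - 1)
    convert h4 using 2 <;> ring

lemma selfInt_eq : Iγ X.v = ((sTwo X.v / 2 : ℕ) : ℤ) := by
  have h : ∃ p : Gamma × ℕ, 1 ≤ p.2 ∧ NotProperPower p.1 ∧ X.v = p.1 ^ p.2 :=
    ⟨(X.v, 1), le_rfl, X.notProperPower, by simp⟩
  rw [Iγ, dif_pos h]
  obtain ⟨h1, h2, h3⟩ := h.choose_spec
  have h4 : h.choose.2 = 1 := by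
    by_contra h5
    exact X.notProperPower ⟨h.choose.1, h.choose.2, by omega, h3⟩
  rw [h4, pow_one] at h3
  rw [h4, ← h3]
  simp

end Axis

namespace Loop

variable (W : Loop)

/-- A position of the loop with a direction of travel. -/
abbrev Pos := ZMod W.n × Bool

variable {W}

/-- The next position. -/
def nx (q : W.Pos) : W.Pos := (cond q.2 (q.1 + 1) (q.1 - 1), q.2)

/-- The same position, travelled in the opposite direction. -/
def rv (q : W.Pos) : W.Pos := (q.1, !q.2)

/-- The letter ahead. -/
def lt (q : W.Pos) : Letter := W.lab (cond q.2 q.1 (q.1 - 1))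

/-- The parity of a position. -/
def pr (q : W.Pos) : Bool := W.par q.1

/-- The turn at a position. -/
def tq (q : W.Pos) : Bool := (cyc (lt (rv q)) (lt q)).xor (pr q)

@[simp] lemma rv_rv (q : W.Pos) : rv (rv q) = q := by simp [rv]

@[simp] lemma nx_rv_nx (q : W.Pos) : nx (rv (nx q)) = rv q := by
  obtain ⟨i, d⟩ := q; cases d <;> simp [nx, rv]

@[simp] lemma lt_rv_nx (q : W.Pos) : lt (rv (nx q)) = lt q := by
  obtain ⟨i, d⟩ := q; cases d <;> simp [nx, rv, lt]

@[simp] lemma pr_nx (q : W.Pos) : pr (nx q) = !pr q := by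
  obtain ⟨i, d⟩ := q
  cases d
  · have := W.par_succ (i - 1)
    simp only [sub_add_cancel] at this
    simp [nx, pr, this]
  · simp [nx, pr, W.par_succ]

@[simp] lemma pr_rv (q : W.Pos) : pr (rv q) = pr q := rfl

lemma lt_ne (q : W.Pos) : lt (rv q) ≠ lt q := by
  obtain ⟨i, d⟩ := q
  cases d
  · simpa [lt, rv] using (W.adj_pred i).symm
  · simpa [lt, rv] using W.adj_pred i

lemma lt_nx_ne (q : W.Pos) : lt (nx q) ≠ lt q := by
  simpa using (lt_ne (nx q)).symm

@[simp] lemma tq_rv (q : W.Pos) : tq (rv q) = !tq q := by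
  rw [tq, tq, rv_rv, cyc_swap (lt_ne q), pr_rv, Bool.not_xor]

@[simp] lemma nx_snd (q : W.Pos) : (nx q).2 = q.2 := rfl

@[simp] lemma rv_snd (q : W.Pos) : (rv q).2 = !q.2 := rfl

lemma cyc_eq_iff {a b c : Letter} (h1 : b ≠ a) (h2 : c ≠ a) : cyc a b = cyc a c ↔ b = c := by
  cases a <;> cases b <;> cases c <;> simp_all [cyc]

lemma cyc_eq_iff' {a b c : Letter} (h1 : b ≠ a) (h2 : c ≠ a) : cyc b a = cyc c a ↔ b = c := by
  cases a <;> cases b <;> cases c <;> simp_all [cyc]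

lemma cyc_rotate {a b c : Letter} (h1 : a ≠ b) (h2 : a ≠ c) (h3 : b ≠ c) : cyc a b = cyc b c := by
  cases a <;> cases b <;> cases c <;> simp_all [cyc]

lemma tq_nx_eq_iff (q : W.Pos) : tq (nx q) = tq q ↔ lt (nx q) = lt (rv q) := by
  rw [← cyc_eq_iff (lt_nx_ne q) (lt_ne q), tq, tq, lt_rv_nx, pr_nx, cyc_swap (lt_ne q)]
  cases pr q <;> cases cyc (lt q) (lt (nx q)) <;> cases cyc (lt (rv q)) (lt q) <;> decide

lemma nx_iterate_rv (k : ℕ) (q : W.Pos) : nx^[k] (rv (nx^[k] q)) = rv q := by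
  induction k with
  | zero => rfl
  | succ k ih => rw [Function.iterate_succ_apply, Function.iterate_succ_apply', nx_rv_nx, ih]

lemma nx_iterate_rv_add (k m : ℕ) (q : W.Pos) :
    nx^[k] (rv (nx^[k + m] q)) = rv (nx^[m] q) := by
  rw [Function.iterate_add_apply, nx_iterate_rv]

@[simp] lemma pr_nx_iterate (k : ℕ) (q : W.Pos) : pr (nx^[k] q) = (pr q).xor (k.bodd) := by
  induction k with
  | zero => simp
  | succ k ih => rw [Function.iterate_succ_apply', pr_nx, ih, Nat.bodd_succ, Bool.xor_not]

@[simp] lemma nx_iterate_snd (k : ℕ) (q : W.Pos) : (nx^[k] q).2 = q.2 := by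
  induction k with
  | zero => rfl
  | succ k ih => rw [Function.iterate_succ_apply', nx_snd, ih]

lemma lt_nx_eq {q q' : W.Pos} (hl : lt q = lt q') (hp : pr q = pr q')
    (h : tq (nx q) = tq (nx q')) : lt (nx q) = lt (nx q') := by
  rw [← cyc_eq_iff (lt_nx_ne q) (by rw [hl]; exact lt_nx_ne q')]
  rw [tq, tq, lt_rv_nx, lt_rv_nx, pr_nx, pr_nx, hp, hl] at h
  rw [hl]
  simpa using h

lemma lt_nx_iterate_eq {q q' : W.Pos} (hl : lt q = lt q') (hp : pr q = pr q') {t : ℕ}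
    (h : ∀ k, 1 ≤ k → k ≤ t → tq (nx^[k] q) = tq (nx^[k] q')) : lt (nx^[t] q) = lt (nx^[t] q') := by
  induction t with
  | zero => exact hl
  | succ t ih =>
    rw [Function.iterate_succ_apply', Function.iterate_succ_apply']
    apply lt_nx_eq (ih fun k h1 h2 => h k h1 (by omega))
    · simp [hp]
    · have := h (t + 1) (by omega) le_rfl
      rwa [Function.iterate_succ_apply', Function.iterate_succ_apply'] at this

/-- The paths from `q` and `q'` turn apart at the start, agree for `t` steps and then part so that
they cross; `e` is the turn of `q` at the start. -/
structure Cross (e : Bool) (q q' : W.Pos) (t : ℕ) : Prop where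
  lt_eq : lt q = lt q'
  pr_eq : pr q = pr q'
  start₁ : tq q = e
  start₂ : tq q' = !e
  agree : ∀ k, 1 ≤ k → k ≤ t → tq (nx^[k] q) = tq (nx^[k] q')
  end₁ : tq (nx^[t + 1] q) = !e
  end₂ : tq (nx^[t + 1] q') = e

lemma Cross.reverse {e : Bool} {q q' : W.Pos} {t : ℕ} (h : Cross e q q' t) :
    Cross e (rv (nx^[t + 1] q)) (rv (nx^[t + 1] q')) t where
  lt_eq := by
    rw [Function.iterate_succ_apply', Function.iterate_succ_apply', lt_rv_nx, lt_rv_nx]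
    exact lt_nx_iterate_eq h.lt_eq h.pr_eq h.agree
  pr_eq := by simp [h.pr_eq]
  start₁ := by rw [tq_rv, h.end₁, Bool.not_not]
  start₂ := by rw [tq_rv, h.end₂]
  agree k h1 h2 := by
    obtain ⟨m, rfl⟩ := Nat.exists_eq_add_of_le h2
    rw [show k + m + 1 = k + (m + 1) by ring, nx_iterate_rv_add, nx_iterate_rv_add, tq_rv, tq_rv,
      h.agree _ (by omega) (by omega)]
  end₁ := by rw [nx_iterate_rv, tq_rv, h.start₁]
  end₂ := by rw [nx_iterate_rv, tq_rv, h.start₂, Bool.not_not]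

lemma Cross.lt_rv_ne {e : Bool} {q q' : W.Pos} {t : ℕ} (h : Cross e q q' t) :
    lt (rv q) ≠ lt (rv q') := by
  rw [Ne, ← cyc_eq_iff' (lt_ne q) (by rw [h.lt_eq]; exact lt_ne q')]
  have h1 := h.start₁
  have h2 := h.start₂
  rw [tq, h.pr_eq] at h1
  rw [tq, ← h.lt_eq] at h2
  intro h3
  rw [h3, h2] at h1
  simp at h1

end Loop

namespace Axis

open Loop

variable {W : Loop} (X : Axis W)

lemma A_congr {i j : ℤ} (h : (i : ZMod W.n) = j) : X.A i = X.A j ∧ X.B i = X.B j := by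
  obtain ⟨m, rfl⟩ := (cast_eq_iff i j).1 h
  have key : ∀ u : Irr, u = X.a ∨ u = X.b → (W.P i)⁻¹ • u = (W.P (i + m * W.n))⁻¹ • u := by
    intro u hu
    have h1 : W.P W.n ∈ MulAction.stabilizer GL2Z u := (X.smul_eq_iff u).2 hu
    have h2 := inv_mem (zpow_mem h1 m)
    rw [W.P_add_mul, mul_inv_rev, mul_smul, MulAction.mem_stabilizer_iff.1 h2]
  exact ⟨key _ (Or.inl rfl), key _ (Or.inr rfl)⟩

/-- The endpoint ahead, seen from a position. -/
noncomputable def pt (q : W.Pos) : Irr := cond q.2 (X.A q.1.val) (X.B q.1.val)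

lemma loc_pt (q : W.Pos) : loc (X.pt q) = lt q := by
  obtain ⟨i, d⟩ := q
  cases d
  · simp [pt, lt, loc_B]
  · simp [pt, lt, loc_A]

lemma pt_nx (q : W.Pos) : X.pt (nx q) = Rm (lt q) • X.pt q ∧
    X.pt (rv (nx q)) = Rm (lt q) • X.pt (rv q) := by
  obtain ⟨i, d⟩ := q
  cases d
  · have h := X.A_congr (i := (i - 1).val) (j := i.val - 1) (by simp)
    simp only [pt, lt, nx, rv, cond_false, cond_true, Bool.not_false, h]
    rw [A_pred, B_pred]
    simp
  · have h := X.A_congr (i := (i + 1).val) (j := i.val + 1) (by simp)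
    simp only [pt, lt, nx, rv, cond_false, cond_true, Bool.not_true, h]
    rw [A_succ, B_succ]
    simp

lemma ori_pt_nx {q q' : W.Pos} (hl : lt q = lt q') :
    (ori (X.pt q) (X.pt q') (X.pt (rv q)) < 0 ↔
      0 < ori (X.pt (nx q)) (X.pt (nx q')) (X.pt (rv (nx q)))) ∧
    (0 < ori (X.pt q) (X.pt q') (X.pt (rv q)) ↔
      ori (X.pt (nx q)) (X.pt (nx q')) (X.pt (rv (nx q))) < 0) := by
  rw [(X.pt_nx q).1, (X.pt_nx q).2, (X.pt_nx q').1, hl, ori_Rm_neg, ori_Rm_pos]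
  exact ⟨Iff.rfl, Iff.rfl⟩

lemma ori_pt {q q' : W.Pos} (hl : lt q = lt q') (hp : pr q = pr q') {t : ℕ}
    (h : ∀ k, 1 ≤ k → k ≤ t → tq (nx^[k] q) = tq (nx^[k] q'))
    (hne : tq (nx^[t + 1] q) ≠ tq (nx^[t + 1] q')) :
    ((tq (nx^[t + 1] q)).xor (pr q) = true → ori (X.pt q) (X.pt q') (X.pt (rv q)) < 0) ∧
    ((tq (nx^[t + 1] q)).xor (pr q) = false → 0 < ori (X.pt q) (X.pt q') (X.pt (rv q))) := by
  induction t generalizing q q' with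
  | zero =>
    rw [(X.ori_pt_nx hl).1, (X.ori_pt_nx hl).2]
    simp only [zero_add, Function.iterate_one] at hne ⊢
    have l1 : loc (X.pt (rv (nx q))) ≠ loc (X.pt (nx q)) := by
      rw [loc_pt, loc_pt]; exact lt_ne _
    have l2 : loc (X.pt (rv (nx q))) ≠ loc (X.pt (nx q')) := by
      rw [loc_pt, loc_pt, lt_rv_nx, hl]; exact (lt_nx_ne _).symm
    have l3 : loc (X.pt (nx q)) ≠ loc (X.pt (nx q')) := by
      rw [loc_pt, loc_pt]
      intro h3
      apply hne
      rw [tq, tq, lt_rv_nx, lt_rv_nx, pr_nx, pr_nx, hp, hl, h3]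
    have key : cyc (loc (X.pt (nx q))) (loc (X.pt (nx q'))) = !((tq (nx q)).xor (pr q)) := by
      have h4 : cyc (lt (rv (nx q))) (lt (nx q)) = cyc (lt (nx q)) (lt (nx q')) := by
        rw [loc_pt, loc_pt] at l1 l2 l3
        exact cyc_rotate l1 l2 l3
      rw [loc_pt, loc_pt, ← h4, tq, pr_nx]
      cases pr q <;> simp
    constructor
    · intro h5
      exact ori_pos_of_cyc l3 l1 l2 (by rw [key, h5]; rfl)
    · intro h5
      exact ori_neg_of_cyc l1 l2 (by rw [key, h5]; rfl)
  | succ t ih =>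
    have ha : tq (nx q) = tq (nx q') := h 1 le_rfl (by omega)
    have hl' := lt_nx_eq hl hp ha
    have := ih hl' (by simp [hp]) (fun k h1 h2 => by
      rw [← Function.iterate_succ_apply, ← Function.iterate_succ_apply]
      exact h (k + 1) (by omega) (by omega)) (by
      rw [← Function.iterate_succ_apply, ← Function.iterate_succ_apply]; exact hne)
    rw [← Function.iterate_succ_apply, pr_nx] at this
    rw [(X.ori_pt_nx hl).1, (X.ori_pt_nx hl).2]
    constructor
    · intro h5
      apply this.2
      simpa using h5
    · intro h5
      apply this.1
      simpa using h5

lemma link_of_cross {e : Bool} {q q' : W.Pos} {t : ℕ} (h : Cross e q q' t) :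
    Link (X.pt q) (X.pt (rv q)) (X.pt q') (X.pt (rv q')) := by
  have l1 : loc (X.pt q) ≠ loc (X.pt (rv q)) := by rw [loc_pt, loc_pt]; exact (lt_ne q).symm
  have l2 : loc (X.pt q) ≠ loc (X.pt (rv q')) := by
    rw [loc_pt, loc_pt, h.lt_eq]; exact (lt_ne q').symm
  have l3 : loc (X.pt (rv q)) ≠ loc (X.pt (rv q')) := by
    rw [loc_pt, loc_pt]; exact h.lt_rv_ne
  have hne : X.pt q ≠ X.pt (rv q) := fun h => l1 (by rw [h])
  rw [link_iff_ori _ _ _ _ hne]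
  obtain ⟨k1, k2⟩ := X.ori_pt h.lt_eq h.pr_eq h.agree (by rw [h.end₁, h.end₂]; simp)
  have key : cyc (loc (X.pt (rv q))) (loc (X.pt (rv q'))) = (tq (nx^[t + 1] q)).xor (pr q) := by
    have h4 : cyc (lt (rv q)) (lt (rv q')) = !cyc (lt (rv q)) (lt q) := by
      rw [loc_pt, loc_pt] at l1 l2 l3
      rw [cyc_rotate l3 l1.symm l2.symm, cyc_rotate l2.symm l3.symm l1, cyc_swap (lt_ne q)]
    have h5 := h.start₁
    rw [tq] at h5
    rw [loc_pt, loc_pt, h4, h.end₁, ← h5]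
    cases pr q <;> simp
  cases h6 : (tq (nx^[t + 1] q)).xor (pr q) with
  | true => exact mul_pos_of_neg_of_neg (k1 h6) (ori_neg_of_cyc l1 l2 (by rw [key, h6]))
  | false => exact mul_pos (k2 h6) (ori_pos_of_cyc l3 l1 l2 (by rw [key, h6]))

lemma meets_of_cross {e : Bool} {q q' : W.Pos} {t : ℕ} (h : Cross e q q' t) (hq : q.2 = true) :
    X.Meets q.1 q'.1 := by
  have hl := X.link_of_cross h
  have h1 := h.lt_rv_ne
  have h2 : lt (rv q) ≠ lt q' := by rw [← h.lt_eq]; exact lt_ne q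
  obtain ⟨i, d⟩ := q
  obtain ⟨j, d'⟩ := q'
  simp only at hq
  subst hq
  cases d'
  · refine ⟨h.pr_eq, ?_, ?_, ?_⟩
    · simpa [lt, rv] using h1
    · simpa [lt, rv] using h2
    · simpa [pt, rv, link_comm_right] using hl
  · refine ⟨h.pr_eq, ?_, ?_, ?_⟩
    · simpa [lt, rv] using h2
    · simpa [lt, rv] using h1
    · simpa [pt, rv] using hl

end Axis

namespace Loop

variable {W : Loop}

lemma nx_iterate_true (k : ℕ) (i : ZMod W.n) : nx^[k] ((i, true) : W.Pos) = (i + k, true) := by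
  induction k with
  | zero => simp
  | succ k ih => rw [Function.iterate_succ_apply', ih]; simp [nx, add_assoc]

lemma nx_iterate_false (k : ℕ) (i : ZMod W.n) : nx^[k] ((i, false) : W.Pos) = (i - k, false) := by
  induction k with
  | zero => simp
  | succ k ih => rw [Function.iterate_succ_apply', ih]; simp [nx, sub_sub]

lemma exists_nx_iterate {q q' : W.Pos} (h : q.2 = q'.2) : ∃ k < W.n, nx^[k] q = q' := by
  obtain ⟨i, d⟩ := q
  obtain ⟨j, d'⟩ := q'
  simp only at h
  subst h
  cases d
  · exact ⟨(i - j).val, ZMod.val_lt _, by rw [nx_iterate_false]; simp⟩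
  · exact ⟨(j - i).val, ZMod.val_lt _, by rw [nx_iterate_true]; simp⟩

lemma exists_lt_eq (q : W.Pos) (s : Letter) : ∃ k < W.n, lt (nx^[k] q) = s := by
  obtain ⟨i, rfl⟩ := W.surj s
  obtain ⟨k, hk, h⟩ := exists_nx_iterate (q := q) (q' := (cond q.2 i (i + 1), q.2)) rfl
  refine ⟨k, hk, ?_⟩
  rw [h]
  cases h2 : q.2 <;> simp [lt]

lemma nx_injective : Function.Injective (nx : W.Pos → W.Pos) := by
  rintro ⟨i, d⟩ ⟨j, d'⟩ h
  simp only [nx, Prod.mk.injEq] at h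
  obtain ⟨h1, rfl⟩ := h
  cases d <;> simpa using h1

lemma rv_injective : Function.Injective (rv : W.Pos → W.Pos) :=
  Function.LeftInverse.injective rv_rv

lemma lt_iterate_ne {q : W.Pos} {s : Letter} (m : ℕ)
    (h : ∀ k, 1 ≤ k → k < m → tq (nx^[k + 1] q) = tq (nx^[k] q))
    (h0 : lt q ≠ s) (h1 : lt (nx q) ≠ s) : ∀ k ≤ m, lt (nx^[k] q) ≠ s := by
  intro k
  induction k using Nat.strong_induction_on with
  | _ k ih =>
    intro hk
    match k, ih, hk with
    | 0, _, _ => exact h0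
    | 1, _, _ => exact h1
    | k + 2, ih, hk =>
      have h2 := h (k + 1) (by omega) (by omega)
      rw [Function.iterate_succ_apply', tq_nx_eq_iff, Function.iterate_succ_apply' nx k,
        lt_rv_nx] at h2
      rw [Function.iterate_succ_apply', Function.iterate_succ_apply', h2]
      exact ih k (by omega) (by omega)

lemma exists_tq_ne (q : W.Pos) : ∃ k, 1 ≤ k ∧ k + 1 < W.n ∧ tq (nx^[k + 1] q) ≠ tq (nx q) := by
  by_contra! h
  obtain ⟨c, h0, h1⟩ := exists_third (lt q) (lt (nx q))
  obtain ⟨k, hk, h2⟩ := exists_lt_eq q c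
  have key : ∀ k, 1 ≤ k → k + 1 ≤ W.n → tq (nx^[k] q) = tq (nx q) := by
    intro k h1 h2
    obtain ⟨m, rfl⟩ := Nat.exists_eq_add_of_le' h1
    rcases m with _ | m
    · rfl
    · exact h (m + 1) (by omega) (by omega)
  exact lt_iterate_ne k (fun j h3 h4 => (key _ (by omega) (by omega)).trans
    (key j h3 (by omega)).symm) h0.symm h1.symm k le_rfl h2

/-- The number of steps after the first one until the turn changes. -/
noncomputable def gap (q : W.Pos) : ℕ := Nat.find (exists_tq_ne q)

lemma one_le_gap (q : W.Pos) : 1 ≤ gap q := (Nat.find_spec (exists_tq_ne q)).1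

lemma gap_lt (q : W.Pos) : gap q + 1 < W.n := (Nat.find_spec (exists_tq_ne q)).2.1

lemma tq_gap (q : W.Pos) : tq (nx^[gap q + 1] q) = !tq (nx q) :=
  Bool.eq_not_of_ne (Nat.find_spec (exists_tq_ne q)).2.2

lemma tq_of_le_gap {q : W.Pos} {j : ℕ} (h1 : 1 ≤ j) (h2 : j ≤ gap q) :
    tq (nx^[j] q) = tq (nx q) := by
  obtain ⟨m, rfl⟩ := Nat.exists_eq_add_of_le' h1
  rcases m with _ | m
  · rfl
  · by_contra h
    have := gap_lt q
    exact Nat.find_min (exists_tq_ne q) (m := m + 1) h2 ⟨by omega, by omega, h⟩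

lemma gap_eq {q : W.Pos} {g : ℕ} (h0 : 1 ≤ g) (h1 : ∀ j, 1 ≤ j → j ≤ g → tq (nx^[j] q) = tq (nx q))
    (h2 : tq (nx^[g + 1] q) ≠ tq (nx q)) : gap q = g := by
  rcases lt_trichotomy (gap q) g with h | h | h
  · have := tq_gap q
    rw [h1 _ (by omega) (by omega)] at this
    simp at this
  · exact h
  · exact absurd (tq_of_le_gap (by omega) h) h2

/-- The first position at which the run started at `q` has ended. -/
noncomputable def nb (q : W.Pos) : W.Pos := nx^[gap q] q

/-- The start of the other run beginning with the same edge, in the opposite direction. -/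
def io (q : W.Pos) : W.Pos := rv (nx q)

@[simp] lemma io_io (q : W.Pos) : io (io q) = q := by simp [io]

lemma io_injective : Function.Injective (io : W.Pos → W.Pos) := Function.LeftInverse.injective io_io

@[simp] lemma lt_io (q : W.Pos) : lt (io q) = lt q := lt_rv_nx q

@[simp] lemma io_snd (q : W.Pos) : (io q).2 = !q.2 := rfl

@[simp] lemma nb_snd (q : W.Pos) : (nb q).2 = q.2 := nx_iterate_snd _ _

@[simp] lemma lt_rv_io (q : W.Pos) : lt (rv (io q)) = lt (nx q) := by simp [io]

@[simp] lemma lt_nx_io (q : W.Pos) : lt (nx (io q)) = lt (rv q) := by simp [io]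

/-- The starts of the runs with turn `e`. -/
noncomputable def Bd (W : Loop) (e : Bool) : Finset W.Pos :=
  Finset.univ.filter fun q => tq q = !e ∧ tq (nx q) = e

lemma mem_Bd {e : Bool} {q : W.Pos} : q ∈ W.Bd e ↔ tq q = !e ∧ tq (nx q) = e := by simp [Bd]

lemma io_mem {e : Bool} {q : W.Pos} (h : q ∈ W.Bd e) : io q ∈ W.Bd e := by
  rw [mem_Bd] at h ⊢
  simp [io, h.1, h.2]

lemma nx_nb (q : W.Pos) : nx (nb q) = nx^[gap q + 1] q := by
  rw [nb, Function.iterate_succ_apply']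

lemma nb_mem {e : Bool} {q : W.Pos} (h : q ∈ W.Bd e) : nb q ∈ W.Bd (!e) := by
  rw [mem_Bd] at h ⊢
  rw [nx_nb, tq_gap, h.2, nb, tq_of_le_gap (one_le_gap q) le_rfl, h.2]
  simp

lemma gap_io_nb {e : Bool} {q : W.Pos} (h : q ∈ W.Bd e) : gap (io (nb q)) = gap q := by
  rw [mem_Bd] at h
  have key : ∀ j, j ≤ gap q + 1 → nx^[j] (io (nb q)) = rv (nx^[gap q + 1 - j] q) := by
    intro j hj
    rw [io, nx_nb]
    obtain ⟨m, hm⟩ := Nat.exists_eq_add_of_le hj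
    rw [hm, nx_iterate_rv_add, Nat.add_sub_cancel_left]
  have h1 : ∀ j, 1 ≤ j → j ≤ gap q → tq (nx^[j] (io (nb q))) = !e := by
    intro j h1 h2
    rw [key j (by omega), tq_rv, tq_of_le_gap (by omega) (by omega), h.2]
  apply gap_eq (one_le_gap q)
  · intro j h2 h3
    rw [h1 j h2 h3]
    exact (h1 1 le_rfl (one_le_gap q)).symm
  · rw [show nx (io (nb q)) = nx^[1] (io (nb q)) from rfl, h1 1 le_rfl (one_le_gap q),
      key _ le_rfl, Nat.sub_self, tq_rv, Function.iterate_zero_apply, h.1]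
    simp

lemma nb_io_nb {e : Bool} {q : W.Pos} (h : q ∈ W.Bd e) : nb (io (nb q)) = io q := by
  rw [nb, gap_io_nb h, io, nx_nb, nx_iterate_rv_add]
  rfl

lemma nb_inj {e : Bool} {q q' : W.Pos} (h : q ∈ W.Bd e) (h' : q' ∈ W.Bd e) (hn : nb q = nb q') :
    q = q' := by
  apply io_injective
  rw [← nb_io_nb h, hn, nb_io_nb h']

lemma exists_nb {e : Bool} {x : W.Pos} (h : x ∈ W.Bd (!e)) : ∃ r ∈ W.Bd e, nb r = x := by
  refine ⟨io (nb (io x)), ?_, ?_⟩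
  · simpa using io_mem (nb_mem (io_mem h))
  · rw [nb_io_nb (io_mem h), io_io]

lemma lt_nx_ne_rv {e : Bool} {q : W.Pos} (h : q ∈ W.Bd e) : lt (nx q) ≠ lt (rv q) := by
  rw [mem_Bd] at h
  rw [Ne, ← tq_nx_eq_iff, h.1, h.2]
  simp

lemma lt_add_two {q : W.Pos} {i : ℕ} (h : i + 2 ≤ gap q) : lt (nx^[i + 2] q) = lt (nx^[i] q) := by
  have h2 : tq (nx^[i + 2] q) = tq (nx^[i + 1] q) := by
    rw [tq_of_le_gap (by omega) h, tq_of_le_gap (by omega) (by omega)]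
  rw [Function.iterate_succ_apply', tq_nx_eq_iff, Function.iterate_succ_apply' nx i,
    lt_rv_nx] at h2
  rw [Function.iterate_succ_apply', Function.iterate_succ_apply', h2]

lemma lt_iterate {q : W.Pos} : ∀ {i : ℕ}, i ≤ gap q →
    lt (nx^[i] q) = if Even i then lt q else lt (nx q)
  | 0, _ => by simp
  | 1, _ => by simp
  | i + 2, h => by
    rw [lt_add_two h, lt_iterate (by omega)]
    simp only [Nat.even_add, even_two, iff_true]

lemma lt_ne_of_le_gap {e : Bool} {q : W.Pos} (h : q ∈ W.Bd e) {i : ℕ} (hi : i ≤ gap q) :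
    lt (nx^[i] q) ≠ lt (rv q) := by
  rw [lt_iterate hi]
  split_ifs
  · exact (lt_ne q).symm
  · exact lt_nx_ne_rv h

lemma lt_nb_eq_iff (q : W.Pos) : lt (nb q) = lt q ↔ Even (gap q) := by
  rw [nb, lt_iterate le_rfl]
  split_ifs with h
  · simp [h]
  · simp [h, lt_nx_ne]

lemma lt_nb_ne {e : Bool} {q : W.Pos} (h : q ∈ W.Bd e) : lt (nb q) ≠ lt (rv q) :=
  lt_ne_of_le_gap h le_rfl

lemma lt_nx_nb {e : Bool} {q : W.Pos} (h : q ∈ W.Bd e) : lt (nx (nb q)) = lt (rv q) := by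
  obtain ⟨g, hg⟩ := Nat.exists_eq_add_of_le' (one_le_gap q)
  have h1 := lt_nx_ne_rv (nb_mem h)
  have h2 : lt (rv (nb q)) = lt (nx^[g] q) := by
    rw [nb, hg, Function.iterate_succ_apply', lt_rv_nx]
  have h3 := lt_ne_of_le_gap h (i := g) (by omega)
  rw [← h2] at h3
  exact eq_third (lt_ne (nb q)) h1 (lt_nx_ne _) h3.symm (lt_nb_ne h).symm

lemma card_tq (e : Bool) : (Finset.univ.filter fun q : W.Pos => tq q = e).card = W.n := by
  have h1 : (Finset.univ.filter fun q : W.Pos => tq q = e).card =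
      (Finset.univ.filter fun q : W.Pos => ¬ tq q = e).card := by
    apply Finset.card_bij (fun q _ => rv q)
    · intro q hq
      simp only [Finset.mem_filter, Finset.mem_univ, true_and] at hq ⊢
      simp [hq]
    · intro q _ q' _ h
      exact rv_injective h
    · intro q hq
      simp only [Finset.mem_filter, Finset.mem_univ, true_and] at hq
      refine ⟨rv q, ?_, rv_rv q⟩
      simp only [Finset.mem_filter, Finset.mem_univ, true_and]
      rw [tq_rv]
      cases e <;> simpa using hq
  have h2 := Finset.card_filter_add_card_filter_not (s := (Finset.univ : Finset W.Pos))
    (fun q => tq q = e)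
  rw [← h1, Finset.card_univ, Fintype.card_prod, ZMod.card, Fintype.card_bool] at h2
  omega

lemma exists_run {e : Bool} {p : W.Pos} (hp : tq p = e) :
    ∃ r ∈ W.Bd e, ∃ j < gap r, nx^[j + 1] r = p := by
  have h0 : nx (io p) = rv p := nx_rv_nx p
  have h1 : ∀ j, 1 ≤ j → j ≤ gap (io p) → tq (nx^[j] (io p)) = !e := by
    intro j h2 h3
    rw [tq_of_le_gap h2 h3, h0, tq_rv, hp]
  have h2 : tq (nx^[gap (io p) + 1] (io p)) = e := by
    rw [tq_gap, h0, tq_rv, hp, Bool.not_not]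
  have hg := one_le_gap (io p)
  set k := gap (io p) with hk
  have key : ∀ j, j ≤ k + 1 → nx^[j] (rv (nx^[k + 1] (io p))) = rv (nx^[k + 1 - j] (io p)) := by
    intro j hj
    obtain ⟨m, hm⟩ := Nat.exists_eq_add_of_le hj
    rw [hm, nx_iterate_rv_add, Nat.add_sub_cancel_left]
  have h3 : ∀ j, 1 ≤ j → j ≤ k → tq (nx^[j] (rv (nx^[k + 1] (io p)))) = e := by
    intro j h4 h5
    rw [key j (by omega), tq_rv, h1 _ (by omega) (by omega), Bool.not_not]
  have hr : rv (nx^[k + 1] (io p)) ∈ W.Bd e := by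
    rw [mem_Bd, tq_rv, h2]
    exact ⟨rfl, h3 1 le_rfl hg⟩
  refine ⟨_, hr, k - 1, ?_, ?_⟩
  · by_contra! h4
    have h5 := tq_gap (rv (nx^[k + 1] (io p)))
    rw [(mem_Bd.1 hr).2, h3 _ (by omega) (by omega)] at h5
    simp at h5
  · rw [Nat.sub_add_cancel hg, key k (by omega), Nat.add_sub_cancel_left,
      Function.iterate_one, h0, rv_rv]

lemma le_sum_gap (e : Bool) : W.n ≤ ∑ r ∈ W.Bd e, gap r := by
  rw [← card_tq e]
  calc _ ≤ ((W.Bd e).biUnion fun r => (Finset.range (gap r)).image fun j => nx^[j + 1] r).card := by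
        apply Finset.card_le_card
        intro p hp
        obtain ⟨r, hr, j, hj, h⟩ := exists_run (Finset.mem_filter.1 hp).2
        simp only [Finset.mem_biUnion, Finset.mem_image, Finset.mem_range]
        exact ⟨r, hr, j, hj, h⟩
    _ ≤ ∑ r ∈ W.Bd e, ((Finset.range (gap r)).image fun j => nx^[j + 1] r).card :=
        Finset.card_biUnion_le
    _ ≤ _ := Finset.sum_le_sum fun r _ => Finset.card_image_le.trans (by simp)

/-- The pairs of positions at which two lifts of the loop, one starting with turn `e`, cross. -/
noncomputable def crossings (W : Loop) (e : Bool) : Finset (ZMod W.n × ZMod W.n) :=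
  Finset.univ.filter fun p => ∃ d t, Cross e ((p.1, true) : W.Pos) (p.2, d) t

lemma Cross.unique {e : Bool} {q q' : W.Pos} {t t' : ℕ} (h : Cross e q q' t) (h' : Cross e q q' t') :
    t = t' := by
  have key : ∀ {t t'}, Cross e q q' t → Cross e q q' t' → ¬ t < t' := by
    intro t t' h h' hlt
    have := h'.agree (t + 1) (by omega) (by omega)
    rw [h.end₁, h.end₂] at this
    simp at this
  rcases lt_trichotomy t t' with h1 | h1 | h1
  · exact absurd h1 (key h h')
  · exact h1
  · exact absurd h1 (key h' h)

lemma card_forward_le {e : Bool} {S : Finset (W.Pos × W.Pos × ℕ)}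
    (hS : ∀ x ∈ S, Cross e x.1 x.2.1 x.2.2 ∧ x.1.2 = true) : S.card ≤ (W.crossings e).card := by
  apply Finset.card_le_card_of_injOn fun x => (x.1.1, x.2.1.1)
  · rintro ⟨⟨i, d⟩, ⟨j, d'⟩, t⟩ hx
    obtain ⟨h, hd⟩ := hS _ hx
    simp only at h hd
    subst hd
    simp only [crossings, Finset.coe_filter, Finset.mem_univ, true_and, Set.mem_ofPred_eq]
    exact ⟨d', t, h⟩
  · rintro ⟨⟨i, d⟩, ⟨j, d'⟩, t⟩ hx ⟨⟨i₁, d₁⟩, ⟨j₁, d₁'⟩, t₁⟩ hx₁ heq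
    obtain ⟨h, hd⟩ := hS _ hx
    obtain ⟨h₁, hd₁⟩ := hS _ hx₁
    simp only [Prod.mk.injEq] at h hd h₁ hd₁ heq
    obtain ⟨rfl, rfl⟩ := heq
    subst hd hd₁
    have : d' = d₁' := by
      by_contra hne
      have h2 := Bool.eq_not_of_ne hne
      subst h2
      exact lt_ne ((j, d₁') : W.Pos) (h.lt_eq.symm.trans h₁.lt_eq)
    subst this
    rw [h.unique h₁]

lemma card_le_of_cross {e : Bool} {S : Finset (W.Pos × W.Pos × ℕ)}
    (hS : ∀ x ∈ S, Cross e x.1 x.2.1 x.2.2) : S.card ≤ 2 * (W.crossings e).card := by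
  rw [← Finset.card_filter_add_card_filter_not (s := S) (fun x => x.1.2 = true), two_mul]
  apply add_le_add
  · apply card_forward_le
    intro x hx
    rw [Finset.mem_filter] at hx
    exact ⟨hS x hx.1, hx.2⟩
  · rw [← Finset.card_image_of_injOn
      (f := fun x : W.Pos × W.Pos × ℕ => (rv (nx^[x.2.2 + 1] x.1), rv (nx^[x.2.2 + 1] x.2.1), x.2.2))]
    · apply card_forward_le
      intro x hx
      obtain ⟨y, hy, rfl⟩ := Finset.mem_image.1 hx
      rw [Finset.mem_filter] at hy
      refine ⟨(hS y hy.1).reverse, ?_⟩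
      simpa using hy.2
    · rintro ⟨q, q', t⟩ _ ⟨q₁, q₁', t₁⟩ _ heq
      simp only [Prod.mk.injEq] at heq
      obtain ⟨h1, h2, rfl⟩ := heq
      have inj := nx_injective.iterate (t + 1) (α := W.Pos)
      rw [inj (rv_injective h1), inj (rv_injective h2)]

/-- The triples `(r, s, t)` for which the last `t` steps of the run `r` overlap the first `t` steps
of the run `s`. -/
noncomputable def overlaps (W : Loop) (e : Bool) : Finset (W.Pos × W.Pos × ℕ) :=
  ((W.Bd e) ×ˢ (W.Bd e) ×ˢ Finset.range W.n).filter fun x =>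
    lt (rv x.1) = lt (rv x.2.1) ∧ x.2.2 < min (gap x.1) (gap x.2.1) ∧
      lt (nx^[gap x.1 - x.2.2] x.1) = lt x.2.1

lemma mem_overlaps {e : Bool} {r s : W.Pos} {t : ℕ} : (r, s, t) ∈ W.overlaps e ↔
    r ∈ W.Bd e ∧ s ∈ W.Bd e ∧ lt (rv r) = lt (rv s) ∧ t < gap r ∧ t < gap s ∧
      lt (nx^[gap r - t] r) = lt s := by
  have := gap_lt r
  simp only [overlaps, Finset.mem_filter, Finset.mem_product, Finset.mem_range, lt_min_iff]
  constructor
  · rintro ⟨⟨h1, h2, h3⟩, h4, ⟨h5, h6⟩, h7⟩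
    exact ⟨h1, h2, h4, h5, h6, h7⟩
  · rintro ⟨h1, h2, h3, h4, h5, h6⟩
    exact ⟨⟨h1, h2, by omega⟩, h3, ⟨h4, h5⟩, h6⟩

lemma tq_run {e : Bool} {r : W.Pos} (h : r ∈ W.Bd e) {j : ℕ} (h1 : 1 ≤ j) (h2 : j ≤ gap r) :
    tq (nx^[j] r) = e := by
  rw [tq_of_le_gap h1 h2, (mem_Bd.1 h).2]

lemma tq_run_end {e : Bool} {r : W.Pos} (h : r ∈ W.Bd e) : tq (nx^[gap r + 1] r) = !e := by
  rw [tq_gap, (mem_Bd.1 h).2]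

lemma cross_of_overlap {e : Bool} {r s : W.Pos} {t : ℕ} (h : (r, s, t) ∈ W.overlaps e) :
    Cross e (nx^[gap r - t] r) s t := by
  obtain ⟨hr, hs, hty, h1, h2, hl⟩ := mem_overlaps.1 h
  have key : ∀ k, nx^[k] (nx^[gap r - t] r) = nx^[k + (gap r - t)] r := fun k =>
    (Function.iterate_add_apply _ _ _ _).symm
  have hq : tq (nx^[gap r - t] r) = e := tq_run hr (by omega) (by omega)
  refine ⟨hl, ?_, hq, (mem_Bd.1 hs).1, ?_, ?_, ?_⟩
  · obtain ⟨m, hm⟩ := Nat.exists_eq_add_of_le' (show 1 ≤ gap r - t by omega)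
    have h3 : lt (rv (nx^[gap r - t] r)) ≠ lt (rv s) := by
      rw [hm, Function.iterate_succ_apply', lt_rv_nx, ← hty]
      exact lt_ne_of_le_gap hr (by omega)
    have h4 := lt_ne (nx^[gap r - t] r)
    have h5 : cyc (lt (rv s)) (lt s) = !cyc (lt (rv (nx^[gap r - t] r))) (lt s) := by
      have h6 : lt (rv (nx^[gap r - t] r)) ≠ lt s := by rw [← hl]; exact h4
      rw [cyc_rotate (lt_ne s) h3.symm h6.symm, cyc_swap h6]
    have h7 := (mem_Bd.1 hs).1
    rw [tq] at hq h7
    rw [h5] at h7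
    rw [← hl] at h7
    revert hq h7
    generalize cyc (lt (rv (nx^[gap r - t] r))) (lt (nx^[gap r - t] r)) = a
    generalize pr (nx^[gap r - t] r) = b
    generalize pr s = c
    cases a <;> cases b <;> cases c <;> cases e <;> simp
  · intro k h3 h4
    rw [key, tq_run hr (by omega) (by omega), tq_run hs (by omega) (by omega)]
  · rw [key, show t + 1 + (gap r - t) = gap r + 1 by omega, tq_run_end hr]
  · rw [tq_run hs (by omega) (by omega)]

lemma Cross.not_mem_overlap {e : Bool} {r s : W.Pos} {t j : ℕ} (h : (r, s, t) ∈ W.overlaps e)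
    (h1 : 1 ≤ j) (h2 : j ≤ t) : tq (nx^[j] (nx^[gap r - t] r)) = e ∧
      tq (nx^[j] (rv (nx^[gap r + 1] r))) = !e := by
  obtain ⟨hr, hs, hty, h3, h4, hl⟩ := mem_overlaps.1 h
  constructor
  · rw [← Function.iterate_add_apply, tq_run hr (by omega) (by omega)]
  · rw [show gap r + 1 = j + (gap r + 1 - j) by omega, nx_iterate_rv_add, tq_rv,
      tq_run hr (by omega) (by omega)]

/-- The crossings found by overlapping a run with another. -/
noncomputable def short (W : Loop) (e : Bool) : Finset (W.Pos × W.Pos × ℕ) :=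
  (W.overlaps e).image (fun x => (nx^[gap x.1 - x.2.2] x.1, x.2.1, x.2.2)) ∪
  ((W.overlaps e).filter (fun x => x.2.2 ≠ 0)).image
    (fun x => (rv (nx^[gap x.1 + 1] x.1), rv (nx^[x.2.2 + 1] x.2.1), x.2.2))

lemma cross_of_short {e : Bool} {x : W.Pos × W.Pos × ℕ} (hx : x ∈ W.short e) :
    Cross e x.1 x.2.1 x.2.2 := by
  rw [short, Finset.mem_union, Finset.mem_image, Finset.mem_image] at hx
  rcases hx with ⟨⟨r, s, t⟩, hy, rfl⟩ | ⟨⟨r, s, t⟩, hy, rfl⟩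
  · exact cross_of_overlap hy
  · have hy' := (Finset.mem_filter.1 hy).1
    have h := (cross_of_overlap hy').reverse
    have h1 := (mem_overlaps.1 hy').2.2.2.1
    rw [← Function.iterate_add_apply, show t + 1 + (gap r - t) = gap r + 1 by omega] at h
    exact h

lemma turn_of_short {e : Bool} {q q' : W.Pos} {t : ℕ} (hx : (q, q', t) ∈ W.short e) {i j : ℕ}
    (hi : 1 ≤ i) (hi' : i ≤ t) (hj : 1 ≤ j) (hj' : j ≤ t) : tq (nx^[i] q) = tq (nx^[j] q) := by
  rw [short, Finset.mem_union, Finset.mem_image, Finset.mem_image] at hx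
  rcases hx with ⟨⟨r, s, t'⟩, hy, h⟩ | ⟨⟨r, s, t'⟩, hy, h⟩
  · simp only [Prod.mk.injEq] at h
    obtain ⟨rfl, rfl, rfl⟩ := h
    rw [(Cross.not_mem_overlap hy hi hi').1, (Cross.not_mem_overlap hy hj hj').1]
  · simp only [Prod.mk.injEq] at h
    obtain ⟨rfl, rfl, rfl⟩ := h
    have hy := (Finset.mem_filter.1 hy).1
    rw [(Cross.not_mem_overlap hy hi hi').2, (Cross.not_mem_overlap hy hj hj').2]

lemma card_short (e : Bool) : (W.short e).card + ((W.overlaps e).filter (fun x => x.2.2 = 0)).card =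
    2 * (W.overlaps e).card := by
  rw [short, Finset.card_union_of_disjoint, Finset.card_image_of_injOn, Finset.card_image_of_injOn,
    add_assoc, add_comm (Finset.card (Finset.filter _ _)),
    Finset.card_filter_add_card_filter_not, two_mul]
  · rintro ⟨r, s, t⟩ hx ⟨r', s', t'⟩ hx' heq
    have hx := mem_overlaps.1 (Finset.mem_filter.1 hx).1
    have hx' := mem_overlaps.1 (Finset.mem_filter.1 hx').1
    simp only [Prod.mk.injEq] at heq
    obtain ⟨h1, h2, rfl⟩ := heq
    rw [nx_injective.iterate (t + 1) (rv_injective h2)]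
    have h3 := rv_injective h1
    rw [← nx_nb, ← nx_nb] at h3
    rw [nb_inj hx.1 hx'.1 (nx_injective h3)]
  · rintro ⟨r, s, t⟩ hx ⟨r', s', t'⟩ hx' heq
    have hx := mem_overlaps.1 hx
    have hx' := mem_overlaps.1 hx'
    simp only [Prod.mk.injEq] at heq
    obtain ⟨h1, rfl, rfl⟩ := heq
    have h2 := congrArg nx^[t] h1
    rw [← Function.iterate_add_apply, ← Function.iterate_add_apply,
      show t + (gap r - t) = gap r by omega, show t + (gap r' - t) = gap r' by omega] at h2
    rw [nb_inj hx.1 hx'.1 h2]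
  · rw [Finset.disjoint_left]
    rintro ⟨q, q', t⟩ hx hx'
    obtain ⟨⟨r, s, t⟩, hy, h⟩ := Finset.mem_image.1 hx
    obtain ⟨⟨r', s', t'⟩, hy', h'⟩ := Finset.mem_image.1 hx'
    rw [Finset.mem_filter] at hy'
    simp only [Prod.mk.injEq] at h h'
    obtain ⟨rfl, rfl, rfl⟩ := h
    obtain ⟨h1, h2, rfl⟩ := h'
    have h3 : 1 ≤ t' := Nat.one_le_iff_ne_zero.2 hy'.2
    have h4 := (Cross.not_mem_overlap hy le_rfl h3).1
    rw [← h1, (Cross.not_mem_overlap hy'.1 le_rfl h3).2] at h4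
    simp at h4

lemma two_mul_overlaps_le (e : Bool) : 2 * (W.overlaps e).card ≤
    2 * (W.crossings e).card + ((W.overlaps e).filter (fun x => x.2.2 = 0)).card := by
  rw [← card_short]
  exact Nat.add_le_add_right (card_le_of_cross fun x => cross_of_short) _

lemma two_mul_overlaps_lt {e : Bool} {q q' : W.Pos} {t i j : ℕ} (h : Cross e q q' t) (hi : 1 ≤ i)
    (hi' : i ≤ t) (hj : 1 ≤ j) (hj' : j ≤ t) (hij : tq (nx^[i] q) ≠ tq (nx^[j] q)) :
    2 * (W.overlaps e).card <
    2 * (W.crossings e).card + ((W.overlaps e).filter (fun x => x.2.2 = 0)).card := by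
  rw [← card_short]
  apply Nat.add_lt_add_right
  have h1 : (q, q', t) ∉ W.short e := fun hx => hij (turn_of_short hx hi hi' hj hj')
  have h2 := card_le_of_cross (e := e) (S := insert (q, q', t) (W.short e)) (by
    intro x hx
    rcases Finset.mem_insert.1 hx with rfl | hx
    · exact h
    · exact cross_of_short hx)
  rw [Finset.card_insert_of_notMem h1] at h2
  omega

end Loop

instance : Fintype Letter := ⟨{.x, .y, .z}, by rintro (_ | _ | _) <;> simp⟩

lemma Letter.sum_univ {M : Type*} [AddCommMonoid M] (f : Letter → M) :
    ∑ a, f a = f .x + f .y + f .z := by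
  change Finset.sum {Letter.x, Letter.y, Letter.z} f = _
  rw [Finset.sum_insert (by simp), Finset.sum_insert (by simp), Finset.sum_singleton, add_assoc]

namespace Loop

variable {W : Loop}

/-- The runs with turn `e` avoiding the letter `c`. -/
noncomputable def runs (W : Loop) (e : Bool) (c : Letter) : Finset W.Pos :=
  (W.Bd e).filter fun r => lt (rv r) = c

lemma mem_runs {e : Bool} {c : Letter} {r : W.Pos} :
    r ∈ W.runs e c ↔ r ∈ W.Bd e ∧ lt (rv r) = c := Finset.mem_filter

lemma sum_Bd {M : Type*} [AddCommMonoid M] (e : Bool) (f : W.Pos → M) :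
    ∑ r ∈ W.Bd e, f r = ∑ c, ∑ r ∈ W.runs e c, f r :=
  (Finset.sum_fiberwise _ _ _).symm

lemma lt_ne_of_mem_runs {e : Bool} {c : Letter} {r : W.Pos} (h : r ∈ W.runs e c) : lt r ≠ c := by
  rw [← (mem_runs.1 h).2]; exact (lt_ne r).symm

lemma lt_nb_ne_of_mem_runs {e : Bool} {c : Letter} {r : W.Pos} (h : r ∈ W.runs e c) :
    lt (nb r) ≠ c := by
  rw [← (mem_runs.1 h).2]; exact lt_nb_ne (mem_runs.1 h).1

lemma card_start_le {e : Bool} {a b c : Letter} (hab : a ≠ b) (hac : a ≠ c) (hbc : b ≠ c) :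
    ((W.runs e c).filter fun r => lt r = a).card ≤ ((W.runs e b).filter fun r => lt r = a).card := by
  apply Finset.card_le_card_of_injOn io
  · intro r hr
    simp only [Finset.coe_filter, Set.mem_ofPred_eq, mem_runs] at hr ⊢
    obtain ⟨⟨h1, h2⟩, h3⟩ := hr
    refine ⟨⟨io_mem h1, ?_⟩, by rw [lt_io, h3]⟩
    rw [lt_rv_io]
    exact eq_third hac (h3 ▸ lt_nx_ne r) (h2 ▸ lt_nx_ne_rv h1) hab.symm hbc
  · exact io_injective.injOn

lemma card_end_le {e : Bool} {a b c : Letter} (hab : a ≠ b) (hac : a ≠ c) (hbc : b ≠ c) :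
    ((W.runs e c).filter fun r => lt (nb r) = a).card ≤
      ((W.runs e b).filter fun r => lt (nb r) = a).card := by
  apply Finset.card_le_card_of_injOn fun r => io (nb (nb r))
  · intro r hr
    simp only [Finset.coe_filter, Set.mem_ofPred_eq, mem_runs] at hr ⊢
    obtain ⟨⟨h1, h2⟩, h3⟩ := hr
    have h4 : io (nb (nb r)) ∈ W.Bd e := by simpa using io_mem (nb_mem (nb_mem h1))
    have h5 : nb (io (nb (nb r))) = io (nb r) := nb_io_nb (nb_mem h1)
    refine ⟨⟨h4, ?_⟩, by rw [h5, lt_io, h3]⟩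
    rw [← lt_nx_nb h4, h5, lt_nx_io]
    refine eq_third hac (h3 ▸ lt_ne (nb r)) ?_ hab.symm hbc
    rw [← h2, ← lt_nx_nb h1]
    exact (lt_nx_ne_rv (nb_mem h1)).symm
  · intro r hr r' hr' h
    simp only [Finset.coe_filter, Set.mem_ofPred_eq, mem_runs] at hr hr'
    exact nb_inj hr.1.1 hr'.1.1 (nb_inj (nb_mem hr.1.1) (nb_mem hr'.1.1) (io_injective h))

lemma card_runs_eq {e : Bool} {a b c : Letter} (hab : a ≠ b) (hac : a ≠ c) (hbc : b ≠ c)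
    {f : W.Pos → Letter} (hf : ∀ r ∈ W.runs e c, f r ≠ c) :
    (W.runs e c).card = ((W.runs e c).filter fun r => f r = a).card +
      ((W.runs e c).filter fun r => f r = b).card := by
  rw [← Finset.card_filter_add_card_filter_not (s := W.runs e c) (fun r => f r = a)]
  congr 2
  apply Finset.filter_congr
  intro r hr
  constructor
  · intro h; exact eq_third hac h (hf r hr) hab.symm hbc
  · intro h; rw [h]; exact hab.symm

/-- The number of runs of either type containing `a` that start with `a`. -/
noncomputable def starts (W : Loop) (e : Bool) (a : Letter) : ℕ :=
  ((W.runs e (if a = .x then .y else .x)).filter fun r => lt r = a).card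

lemma card_start {e : Bool} {a c : Letter} (h : a ≠ c) :
    ((W.runs e c).filter fun r => lt r = a).card = W.starts e a := by
  have key : ∀ b c, a ≠ b → a ≠ c → ((W.runs e c).filter fun r => lt r = a).card =
      ((W.runs e b).filter fun r => lt r = a).card := by
    intro b c h1 h2
    by_cases h3 : b = c
    · rw [h3]
    · exact le_antisymm (card_start_le h1 h2 h3) (card_start_le h2 h1 (Ne.symm h3))
  apply key _ _ _ h
  split_ifs with h
  · rw [h]; simp
  · exact h

lemma card_runs {e : Bool} {a b c : Letter} (hab : a ≠ b) (hac : a ≠ c) (hbc : b ≠ c) :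
    (W.runs e c).card = W.starts e a + W.starts e b := by
  rw [card_runs_eq hab hac hbc (f := lt) (fun r => lt_ne_of_mem_runs), card_start hac,
    card_start hbc]

lemma card_end {e : Bool} {a c : Letter} (h : a ≠ c) :
    ((W.runs e c).filter fun r => lt (nb r) = a).card = W.starts e a := by
  obtain ⟨b, hba, hbc⟩ := exists_third a c
  have key : ∀ {a b c : Letter}, a ≠ b → a ≠ c → b ≠ c →
      ((W.runs e c).filter fun r => lt (nb r) = a).card =
      ((W.runs e b).filter fun r => lt (nb r) = a).card := fun h1 h2 h3 =>
    le_antisymm (card_end_le h1 h2 h3) (card_end_le h2 h1 h3.symm)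
  have key2 : ∀ {a b c : Letter}, a ≠ b → a ≠ c → b ≠ c →
      ((W.runs e c).filter fun r => lt (nb r) = a).card +
      ((W.runs e c).filter fun r => lt (nb r) = b).card = W.starts e a + W.starts e b := by
    intro a b c h1 h2 h3
    rw [← card_runs h1 h2 h3, ← card_runs_eq h1 h2 h3 fun r => lt_nb_ne_of_mem_runs]
  have k1 := key hba.symm h hbc
  have k2 := key hba hbc h
  have k3 := key h.symm hbc.symm hba.symm
  have e1 := key2 hba.symm h hbc
  have e2 := key2 h hba.symm hbc.symm
  have e3 := key2 hbc hba h.symm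
  omega

lemma card_even_filter (m : ℕ) : ((Finset.range m).filter fun t => Even t).card = (m + 1) / 2 ∧
    ((Finset.range m).filter fun t => ¬ Even t).card = m / 2 := by
  induction m with
  | zero => simp
  | succ m ih =>
    rw [Finset.range_add_one, Finset.filter_insert, Finset.filter_insert]
    by_cases h : Even m
    · rw [if_pos h, if_neg (not_not.2 h), Finset.card_insert_of_notMem (by simp), ih.1, ih.2]
      rw [Nat.even_iff] at h
      omega
    · rw [if_neg h, if_pos h, Finset.card_insert_of_notMem (by simp), ih.1, ih.2]
      rw [Nat.even_iff] at h
      omega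

/-- The number of overlaps of the end of `r` with the start of `s`. -/
noncomputable def cnt (r s : W.Pos) : ℕ :=
  ((Finset.range (min (gap r) (gap s))).filter fun t => lt (nx^[gap r - t] r) = lt s).card

lemma lt_sub_eq_iff {r : W.Pos} {t : ℕ} (h : t ≤ gap r) :
    lt (nx^[gap r - t] r) = lt (nb r) ↔ Even t := by
  rw [nb, lt_iterate le_rfl, lt_iterate (Nat.sub_le _ _)]
  have := lt_nx_ne r
  by_cases h1 : Even (gap r) <;> by_cases h2 : Even t <;>
    simp [Nat.even_sub h, h1, h2, this, this.symm]

lemma cnt_eq {e : Bool} {c : Letter} {r s : W.Pos} (hr : r ∈ W.runs e c) (hs : s ∈ W.runs e c) :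
    cnt r s = if lt (nb r) = lt s then (min (gap r) (gap s) + 1) / 2
      else min (gap r) (gap s) / 2 := by
  have key : ∀ t ∈ Finset.range (min (gap r) (gap s)), (lt (nx^[gap r - t] r) = lt s ↔
      (Even t ↔ lt (nb r) = lt s)) := by
    intro t ht
    rw [Finset.mem_range, lt_min_iff] at ht
    rw [← lt_sub_eq_iff ht.1.le]
    have h1 : lt (nx^[gap r - t] r) ≠ c := by
      rw [← (mem_runs.1 hr).2]; exact lt_ne_of_le_gap (mem_runs.1 hr).1 (Nat.sub_le _ _)
    have h2 := lt_nb_ne_of_mem_runs hr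
    have h3 := lt_ne_of_mem_runs hs
    revert h1 h2 h3
    generalize lt (nx^[gap r - t] r) = p
    generalize lt (nb r) = q
    generalize lt s = l
    intro h1 h2 h3
    constructor
    · rintro rfl; exact eq_comm
    · intro h
      by_cases h4 : q = l
      · exact (h.2 h4).trans h4
      · have h5 : p ≠ q := fun h6 => h4 (h.1 h6)
        exact eq_third h2 h5 h1 (Ne.symm h4) h3
  rw [cnt, Finset.filter_congr key]
  split_ifs with h
  · simp only [h, iff_true]; exact (card_even_filter _).1
  · simp only [h, iff_false]; exact (card_even_filter _).2

lemma two_mul_sum_cnt (e : Bool) (c : Letter) :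
    2 * ∑ r ∈ W.runs e c, ∑ s ∈ W.runs e c, (cnt r s : ℤ) =
      ∑ r ∈ W.runs e c, ∑ s ∈ W.runs e c, ((min (gap r) (gap s) : ℕ) : ℤ) := by
  obtain ⟨a, hac, -⟩ := exists_third c c
  set u : W.Pos → ℤ := fun r => (if lt r = a then 1 else 0) - (if lt (nb r) = a then 1 else 0)
    with hu
  have hsum : ∑ r ∈ W.runs e c, u r = 0 := by
    rw [hu, Finset.sum_sub_distrib, Finset.sum_boole, Finset.sum_boole, card_start hac,
      card_end hac, sub_self]
  have pair : ∀ r ∈ W.runs e c, ∀ s ∈ W.runs e c,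
      (cnt r s : ℤ) + cnt s r = (min (gap r) (gap s) : ℕ) - u r * u s := by
    intro r hr s hs
    have iff_of : ∀ {p q : Letter}, p ≠ c → q ≠ c → (p = q ↔ (p = a ↔ q = a)) := by
      intro p q hp hq
      constructor
      · rintro rfl; rfl
      · intro h
        by_cases h1 : p = a
        · rw [h1, h.1 h1]
        · exact eq_third hac h1 hp (fun h2 => h1 (h.2 h2)) hq
    rw [cnt_eq hr hs, cnt_eq hs hr, min_comm (gap s)]
    have hr' := lt_nb_eq_iff r
    have hs' := lt_nb_eq_iff s
    simp only [iff_of (lt_nb_ne_of_mem_runs hr) (lt_ne_of_mem_runs hs),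
      iff_of (lt_nb_ne_of_mem_runs hs) (lt_ne_of_mem_runs hr)]
    rw [iff_of (lt_nb_ne_of_mem_runs hr) (lt_ne_of_mem_runs hr), Nat.even_iff] at hr'
    rw [iff_of (lt_nb_ne_of_mem_runs hs) (lt_ne_of_mem_runs hs), Nat.even_iff] at hs'
    have hm : min (gap r) (gap s) = gap r ∨ min (gap r) (gap s) = gap s := min_choice _ _
    revert hr' hs' hm
    generalize min (gap r) (gap s) = m
    simp only [hu]
    by_cases h1 : lt r = a <;> by_cases h2 : lt (nb r) = a <;> by_cases h3 : lt s = a <;>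
      by_cases h4 : lt (nb s) = a <;> simp [h1, h2, h3, h4] <;> omega
  have h1 : ∑ r ∈ W.runs e c, ∑ s ∈ W.runs e c, ((cnt r s : ℤ) + cnt s r) =
      ∑ r ∈ W.runs e c, ∑ s ∈ W.runs e c, (((min (gap r) (gap s) : ℕ) : ℤ) - u r * u s) :=
    Finset.sum_congr rfl fun r hr => Finset.sum_congr rfl fun s hs => pair r hr s hs
  simp only [Finset.sum_add_distrib, Finset.sum_sub_distrib] at h1
  rw [Finset.sum_comm (f := fun r s : W.Pos => (cnt s r : ℤ)), ← Finset.sum_mul_sum, hsum,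
    mul_zero, sub_zero] at h1
  rw [← h1, two_mul]

lemma card_overlaps (e : Bool) : (W.overlaps e).card =
    ∑ c, ∑ r ∈ W.runs e c, ∑ s ∈ W.runs e c, cnt r s := by
  have h : W.overlaps e = (Finset.univ.biUnion fun c => (W.runs e c).biUnion fun r =>
      (W.runs e c).biUnion fun s => ((Finset.range (min (gap r) (gap s))).filter
        fun t => lt (nx^[gap r - t] r) = lt s).image fun t => (r, s, t)) := by
    ext ⟨r, s, t⟩
    rw [mem_overlaps]
    simp only [Finset.mem_biUnion, Finset.mem_univ, true_and, Finset.mem_image, Finset.mem_filter,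
      Finset.mem_range, mem_runs, Prod.mk.injEq, lt_min_iff]
    constructor
    · rintro ⟨h1, h2, h3, h4, h5, h6⟩
      exact ⟨_, r, ⟨h1, rfl⟩, s, ⟨h2, h3.symm⟩, t, ⟨⟨h4, h5⟩, h6⟩, rfl, rfl, rfl⟩
    · rintro ⟨c, r, ⟨h1, h1'⟩, s, ⟨h2, h2'⟩, t, ⟨⟨h4, h5⟩, h6⟩, rfl, rfl, rfl⟩
      exact ⟨h1, h2, h1'.trans h2'.symm, h4, h5, h6⟩
  rw [h, Finset.card_biUnion]
  · refine Finset.sum_congr rfl fun c _ => ?_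
    rw [Finset.card_biUnion]
    · refine Finset.sum_congr rfl fun r _ => ?_
      rw [Finset.card_biUnion]
      · refine Finset.sum_congr rfl fun s _ => ?_
        rw [Finset.card_image_of_injective _ (fun t t' h => by simpa using h), cnt]
      · intro s _ s' _ hne
        rw [Function.onFun, Finset.disjoint_left]
        simp only [Finset.mem_image]
        rintro _ ⟨t, _, rfl⟩ ⟨t', _, h⟩
        simp only [Prod.mk.injEq] at h
        exact hne h.2.1.symm
    · intro r _ r' _ hne
      rw [Function.onFun, Finset.disjoint_left]
      simp only [Finset.mem_image, Finset.mem_biUnion]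
      rintro _ ⟨s, _, t, _, rfl⟩ ⟨s', _, t', _, h⟩
      simp only [Prod.mk.injEq] at h
      exact hne h.1.symm
  · intro c _ c' _ hne
    rw [Function.onFun, Finset.disjoint_left]
    simp only [Finset.mem_image, Finset.mem_biUnion]
    rintro _ ⟨r, hr, s, _, t, _, rfl⟩ ⟨r', hr', s', _, t', _, h⟩
    simp only [Prod.mk.injEq] at h
    rw [h.1] at hr'
    exact hne ((mem_runs.1 hr).2.symm.trans (mem_runs.1 hr').2)

lemma card_overlaps_zero_le (e : Bool) : ((W.overlaps e).filter (fun x => x.2.2 = 0)).card ≤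
    2 * ∑ a, W.starts e a ^ 2 := by
  have h : (W.overlaps e).filter (fun x => x.2.2 = 0) ⊆
      Finset.univ.biUnion fun c => (Finset.univ.filter (· ≠ c)).biUnion fun a =>
        (((W.runs e c).filter fun r => lt (nb r) = a) ×ˢ
          ((W.runs e c).filter fun r => lt r = a) ×ˢ {0}) := by
    rintro ⟨r, s, t⟩ hx
    rw [Finset.mem_filter, mem_overlaps] at hx
    obtain ⟨⟨h1, h2, h3, h4, h5, h6⟩, rfl⟩ := hx
    simp only [Finset.mem_biUnion, Finset.mem_univ, true_and, Finset.mem_product, Finset.mem_filter,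
      Finset.mem_singleton, mem_runs]
    exact ⟨_, lt s, h3 ▸ (lt_ne s).symm, ⟨⟨h1, rfl⟩, h6⟩, ⟨⟨h2, h3.symm⟩, rfl⟩, trivial⟩
  refine (Finset.card_le_card h).trans (Finset.card_biUnion_le.trans ?_)
  have h2 : ∀ c, ((Finset.univ.filter (· ≠ c)).biUnion fun a =>
        (((W.runs e c).filter fun r => lt (nb r) = a) ×ˢ
          ((W.runs e c).filter fun r => lt r = a) ×ˢ {0})).card ≤
      ∑ a ∈ Finset.univ.filter (· ≠ c), W.starts e a ^ 2 := by
    intro c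
    refine Finset.card_biUnion_le.trans (Finset.sum_le_sum fun a ha => ?_)
    have ha := (Finset.mem_filter.1 ha).2
    rw [Finset.card_product, Finset.card_product, Finset.card_singleton, mul_one, card_end ha,
      card_start ha, sq]
  refine (Finset.sum_le_sum fun c _ => h2 c).trans (le_of_eq ?_)
  simp only [Finset.sum_filter, Letter.sum_univ]
  simp
  ring

/-- The sum of the lengths of the overlaps of all pairs of runs of the same type. -/
noncomputable def minSum (W : Loop) (e : Bool) : ℤ :=
  ∑ c, ∑ r ∈ W.runs e c, ∑ s ∈ W.runs e c, ((min (gap r) (gap s) : ℕ) : ℤ)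

lemma two_mul_card_overlaps (e : Bool) : 2 * ((W.overlaps e).card : ℤ) = W.minSum e := by
  rw [card_overlaps, minSum]
  simp only [Nat.cast_sum]
  rw [Finset.mul_sum]
  exact Finset.sum_congr rfl fun c _ => two_mul_sum_cnt e c

lemma minSum_le (e : Bool) :
    W.minSum e ≤ 2 * (W.crossings e).card + 2 * ∑ a, (W.starts e a : ℤ) ^ 2 := by
  rw [← two_mul_card_overlaps]
  have h1 := two_mul_overlaps_le (W := W) e
  have h2 := card_overlaps_zero_le (W := W) e
  have h3 := h1.trans (Nat.add_le_add_left h2 _)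
  exact_mod_cast h3

lemma minSum_lt {e : Bool} {q q' : W.Pos} {t i j : ℕ} (h : Cross e q q' t) (hi : 1 ≤ i)
    (hi' : i ≤ t) (hj : 1 ≤ j) (hj' : j ≤ t) (hij : tq (nx^[i] q) ≠ tq (nx^[j] q)) :
    W.minSum e < 2 * (W.crossings e).card + 2 * ∑ a, (W.starts e a : ℤ) ^ 2 := by
  rw [← two_mul_card_overlaps]
  have h1 := two_mul_overlaps_lt h hi hi' hj hj' hij
  have h2 := card_overlaps_zero_le (W := W) e
  have h3 := h1.trans_le (Nat.add_le_add_left h2 _)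
  exact_mod_cast h3

end Loop

section Deficit

variable {α : Type*}

/-- The elements of `R` at which `d` is strictly larger than elsewhere on `R`. -/
noncomputable def strictMax (R : Finset α) (d : α → ℕ) : Finset α :=
  R.filter fun r => ∀ s ∈ R, s ≠ r → d s < d r

/-- The deficit of the heights `d` on `R`. -/
noncomputable def deficit (R : Finset α) (d : α → ℕ) : ℤ :=
  ∑ r ∈ R, ∑ s ∈ R, ((min (d r) (d s) : ℕ) : ℤ) - 2 * ∑ r ∈ R, (d r : ℤ) + 2 * (strictMax R d).card

lemma sum_min_insert {R : Finset α} {d : α → ℕ} {a : α} (ha : a ∉ R) (hmax : ∀ r ∈ R, d r ≤ d a) :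
    ∑ r ∈ insert a R, ∑ s ∈ insert a R, ((min (d r) (d s) : ℕ) : ℤ) =
      d a + 2 * ∑ r ∈ R, (d r : ℤ) + ∑ r ∈ R, ∑ s ∈ R, ((min (d r) (d s) : ℕ) : ℤ) := by
  have h1 : ∑ r ∈ R, ((min (d a) (d r) : ℕ) : ℤ) = ∑ r ∈ R, (d r : ℤ) :=
    Finset.sum_congr rfl fun r hr => by rw [min_eq_right (hmax r hr)]
  have h2 : ∑ r ∈ R, ((min (d r) (d a) : ℕ) : ℤ) = ∑ r ∈ R, (d r : ℤ) :=
    Finset.sum_congr rfl fun r hr => by rw [min_eq_left (hmax r hr)]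
  simp only [Finset.sum_insert ha, Finset.sum_add_distrib, h1, h2, min_self]
  ring

lemma le_sum_min {R : Finset α} {d : α → ℕ} {a : α} (ha : a ∈ R) (h : 1 ≤ d a) :
    (d a : ℤ) - 1 + ((R.filter fun r => 1 ≤ d r).card : ℤ) ^ 2 ≤
      ∑ r ∈ R, ∑ s ∈ R, ((min (d r) (d s) : ℕ) : ℤ) := by
  have key : ∀ r ∈ R, ∀ s ∈ R, (if r = a then (if s = a then (d a : ℤ) - 1 else 0) else 0) +
      (if 1 ≤ d r then 1 else 0) * (if 1 ≤ d s then 1 else 0) ≤ ((min (d r) (d s) : ℕ) : ℤ) := by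
    intro r _ s _
    by_cases h1 : r = a <;> by_cases h2 : s = a <;> by_cases h3 : 1 ≤ d r <;>
      by_cases h4 : 1 ≤ d s <;> subst_vars <;> simp_all
  refine le_trans (le_of_eq ?_) (Finset.sum_le_sum fun r hr => Finset.sum_le_sum fun s hs =>
    key r hr s hs)
  simp only [Finset.sum_add_distrib]
  rw [← Finset.sum_mul_sum, Finset.sum_boole, sq]
  congr 1
  rw [Finset.sum_eq_single a, Finset.sum_eq_single a]
  · simp
  · intro s _ hs; simp [hs]
  · intro h; exact absurd ha h
  · intro r _ hr; simp [hr]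
  · intro h; exact absurd ha h

lemma deficit_insert {R : Finset α} {d : α → ℕ} {a : α} (ha : a ∉ R) (hmax : ∀ r ∈ R, d r ≤ d a) :
    deficit (insert a R) d = ∑ r ∈ R, ∑ s ∈ R, ((min (d r) (d s) : ℕ) : ℤ) - d a +
      2 * (strictMax (insert a R) d).card := by
  rw [deficit, sum_min_insert ha hmax, Finset.sum_insert ha]
  ring

lemma one_le_card_strictMax {R : Finset α} {d : α → ℕ} {a : α} (h : ∀ r ∈ R, d r < d a) :
    1 ≤ (strictMax (insert a R) d).card := by
  refine Finset.card_pos.2 ⟨a, Finset.mem_filter.2 ⟨Finset.mem_insert_self _ _, fun s hs hne => ?_⟩⟩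
  exact h s (Finset.mem_of_mem_insert_of_ne hs hne)

lemma deficit_bounds {R : Finset α} {d : α → ℕ}
    (h : ∀ r ∈ R, 2 ≤ d r → ∃ s ∈ R, s ≠ r ∧ d r ≤ d s + 2) :
    0 ≤ deficit R d ∧ (R.card = 1 → 1 ≤ deficit R d) ∧
      ∀ m : ℕ, m ≤ (R.filter fun r => 1 ≤ d r).card → (m : ℤ) * (m - 2) ≤ deficit R d := by
  rcases R.eq_empty_or_nonempty with rfl | hR
  · simp [deficit, strictMax]
  obtain ⟨a, ha, hmax⟩ := Finset.exists_max_image R d hR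
  obtain ⟨R', ha', rfl⟩ : ∃ R', a ∉ R' ∧ insert a R' = R :=
    ⟨R.erase a, Finset.notMem_erase _ _, Finset.insert_erase ha⟩
  have hmax' : ∀ r ∈ R', d r ≤ d a := fun r hr => hmax r (Finset.mem_insert_of_mem hr)
  have hda := h a ha
  have hN : ((insert a R').filter fun r => 1 ≤ d r).card ≤ (R'.filter fun r => 1 ≤ d r).card + 1 := by
    rw [Finset.filter_insert]
    split_ifs
    · exact Finset.card_insert_le _ _
    · omega
  have hmul : ∀ {m k : ℕ}, m ≤ k + 1 → 1 ≤ k → (m : ℤ) * (m - 2) ≤ (k : ℤ) ^ 2 - 1 := by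
    intro m k h1 h2
    rcases Nat.eq_zero_or_pos m with rfl | h3
    · simp; nlinarith
    · zify at h1 h2 h3
      nlinarith
  have hsmall : ∀ {m : ℕ}, m ≤ 1 → (m : ℤ) * (m - 2) ≤ 0 := by
    intro m hm
    interval_cases m <;> simp
  rw [deficit_insert ha' hmax']
  rcases R'.eq_empty_or_nonempty with rfl | hR'
  · have h1 : d a ≤ 1 := by
      by_contra h2
      obtain ⟨s, hs, hne, -⟩ := hda (by omega)
      simp at hs
      exact hne hs
    have h2 := one_le_card_strictMax (R := ∅) (d := d) (a := a) (by simp)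
    simp only [Finset.sum_empty]
    refine ⟨by omega, fun _ => by omega, fun m hm => ?_⟩
    have := hsmall (hm.trans hN)
    omega
  obtain ⟨b, hb, hbmax⟩ := Finset.exists_max_image R' d hR'
  have hab : (d a : ℤ) ≤ d b + 2 * (strictMax (insert a R') d).card := by
    rcases (hmax' b hb).eq_or_lt with h1 | h1
    · omega
    · have h2 := one_le_card_strictMax (R := R') (d := d) (a := a)
        fun r hr => (hbmax r hr).trans_lt h1
      have h3 : d a ≤ d b + 2 := by
        by_cases h4 : 2 ≤ d a
        · obtain ⟨s, hs, hne, h5⟩ := hda h4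
          have := hbmax s (Finset.mem_of_mem_insert_of_ne hs hne)
          omega
        · omega
      omega
  have hcard : (insert a R').card ≠ 1 := by
    rw [Finset.card_insert_of_notMem ha']
    have := hR'.card_pos
    omega
  refine ⟨?_, fun h => absurd h hcard, ?_⟩ <;> by_cases hb1 : 1 ≤ d b
  · have h1 := le_sum_min hb hb1
    have h2 : 1 ≤ (R'.filter fun r => 1 ≤ d r).card :=
      Finset.card_pos.2 ⟨b, Finset.mem_filter.2 ⟨hb, hb1⟩⟩
    have h3 := hmul (Nat.zero_le _) h2
    simp only [Nat.cast_zero, zero_mul] at h3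
    linarith
  · have : (0 : ℤ) ≤ ∑ r ∈ R', ∑ s ∈ R', ((min (d r) (d s) : ℕ) : ℤ) := by positivity
    omega
  · intro m hm
    have h1 := le_sum_min hb hb1
    have h2 : 1 ≤ (R'.filter fun r => 1 ≤ d r).card :=
      Finset.card_pos.2 ⟨b, Finset.mem_filter.2 ⟨hb, hb1⟩⟩
    have h3 := hmul (hm.trans hN) h2
    linarith
  · intro m hm
    have h1 : (R'.filter fun r => 1 ≤ d r).card = 0 := by
      rw [Finset.card_eq_zero, Finset.filter_eq_empty_iff]
      intro r hr
      have := hbmax r hr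
      omega
    have h2 : (0 : ℤ) ≤ ∑ r ∈ R', ∑ s ∈ R', ((min (d r) (d s) : ℕ) : ℤ) := by positivity
    have h3 := hsmall (hm.trans (hN.trans (by omega)))
    omega

lemma two_starts_bound {X Y : ℕ} {F G H : ℤ} (hF : 0 ≤ F) (hG : 0 ≤ G) (hH : 0 ≤ H)
    (hX : (X : ℤ) * (X - 2) ≤ F) (hX1 : X = 1 → 1 ≤ F)
    (hY : (Y : ℤ) * (Y - 2) ≤ G) (hY1 : Y = 1 → 1 ≤ G)
    (hXY : Y ≤ X → ((X : ℤ) - Y) * (X - Y - 2) ≤ H)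
    (hYX : X ≤ Y → ((Y : ℤ) - X) * (Y - X - 2) ≤ H) :
    -1 ≤ F + G + H + 2 * (((X : ℤ) - 2) * (Y - 2) - 1) ∨
      (F + G + H ≤ 0 ∧ ((X = 2 ∧ (Y = 0 ∨ Y = 2)) ∨ (Y = 2 ∧ (X = 0 ∨ X = 2)))) := by
  have key : ∀ {X Y : ℕ} {F G H : ℤ}, 0 ≤ F → 0 ≤ G → 0 ≤ H → (X : ℤ) * (X - 2) ≤ F →
      (X = 1 → 1 ≤ F) → (Y : ℤ) * (Y - 2) ≤ G → (Y = 1 → 1 ≤ G) →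
      (X ≤ Y → ((Y : ℤ) - X) * (Y - X - 2) ≤ H) → X ≤ Y →
      -1 ≤ F + G + H + 2 * (((X : ℤ) - 2) * (Y - 2) - 1) ∨
      (F + G + H ≤ 0 ∧ ((X = 2 ∧ (Y = 0 ∨ Y = 2)) ∨ (Y = 2 ∧ (X = 0 ∨ X = 2)))) := by
    intro X Y F G H hF hG hH hX hX1 hY hY1 hYX h
    have hYX := hYX h
    rcases Nat.lt_or_ge X 3 with h1 | h1
    · rcases Nat.lt_or_ge Y 4 with h2 | h2
      · interval_cases X <;> interval_cases Y <;> simp at * <;> omega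
      · left
        zify at h2
        interval_cases X <;> simp at * <;> nlinarith
    · left
      zify at h h1
      nlinarith
  rcases le_total X Y with h | h
  · exact key hF hG hH hX hX1 hY hY1 hYX h
  · have := key hG hF hH hY hY1 hX hX1 hXY h
    rw [add_comm G F, mul_comm ((Y : ℤ) - 2)] at this
    tauto

lemma starts_bound {S : Letter → ℕ} {F : Letter → ℤ} (h0 : ∀ c, 0 ≤ F c)
    (h1 : ∀ a b c, a ≠ b → a ≠ c → b ≠ c → S a + S b = 1 → 1 ≤ F c)
    (h2 : ∀ a b c, a ≠ b → a ≠ c → b ≠ c → S b ≤ S a →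
      ((S a : ℤ) - S b) * (S a - S b - 2) ≤ F c) :
    -1 ≤ ∑ c, F c + (∑ c, (S c : ℤ)) ^ 2 - ∑ c, (S c : ℤ) ^ 2 - 4 * ∑ c, (S c : ℤ) + 6 ∨
      ∃ a b c, a ≠ b ∧ a ≠ c ∧ b ≠ c ∧ S c = 0 ∧ S a = 2 ∧ (S b = 0 ∨ S b = 2) ∧
        ∑ c, F c ≤ 0 := by
  by_cases hz : ∃ c, S c = 0
  · obtain ⟨c, hc⟩ := hz
    obtain ⟨a, hac, -⟩ := exists_third c c
    obtain ⟨b, hba, hbc⟩ := exists_third a c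
    have hsum : ∀ f : Letter → ℤ, ∑ t, f t = f a + f b + f c := by
      intro f
      rw [Letter.sum_univ]
      cases a <;> cases b <;> cases c <;> simp at * <;> ring
    have e1 := h2 a c b hac hba.symm hbc.symm (by omega)
    have e2 := h2 b c a hbc hba hac.symm (by omega)
    have e3 := h2 a b c hba.symm hac hbc
    have e4 := h2 b a c hba hbc hac
    have f1 := h1 a c b hac hba.symm hbc.symm
    have f2 := h1 b c a hbc hba hac.symm
    simp only [hc, Nat.cast_zero, sub_zero, add_zero] at e1 e2 f1 f2
    rw [hsum, hsum, hsum, hc]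
    rcases two_starts_bound (h0 b) (h0 a) (h0 c) e1 f1 e2 f2 e3 e4 with h | ⟨h, h' | h'⟩
    · left
      push_cast
      nlinarith
    · exact Or.inr ⟨a, b, c, hba.symm, hac, hbc, hc, h'.1, h'.2, by linarith⟩
    · exact Or.inr ⟨b, a, c, hba, hbc, hac, hc, h'.1, h'.2, by linarith⟩
  · left
    push Not at hz
    have h3 : ∀ c, (1 : ℤ) ≤ S c := fun c => by exact_mod_cast Nat.one_le_iff_ne_zero.2 (hz c)
    simp only [Letter.sum_univ]
    have hx := h3 .x
    have hy := h3 .y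
    have hz := h3 .z
    have := h0 .x
    have := h0 .y
    have := h0 .z
    nlinarith [mul_nonneg (sub_nonneg.2 hx) (sub_nonneg.2 hy),
      mul_nonneg (sub_nonneg.2 hx) (sub_nonneg.2 hz), mul_nonneg (sub_nonneg.2 hy) (sub_nonneg.2 hz)]

end Deficit

namespace Loop

variable {W : Loop}

lemma starts_le (e : Bool) {a b c : Letter} (hab : a ≠ b) (hac : a ≠ c) (hbc : b ≠ c) :
    W.starts e a ≤ W.starts e b + ((W.runs e c).filter fun r => Even (gap r)).card := by
  rw [← card_start hac, ← card_end hbc, ← Finset.card_filter_add_card_filter_not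
    (s := (W.runs e c).filter fun r => lt r = a) (fun r => Even (gap r)), add_comm]
  refine add_le_add (Finset.card_le_card fun r => ?_) (Finset.card_le_card fun r => ?_)
  · simp only [Finset.mem_filter, and_assoc, ← lt_nb_eq_iff]
    rintro ⟨h1, h2, h3⟩
    exact ⟨h1, eq_third hac (h2 ▸ h3) (lt_nb_ne_of_mem_runs h1) hab.symm hbc⟩
  · simp only [Finset.mem_filter, and_assoc]
    rintro ⟨h1, -, h3⟩
    exact ⟨h1, h3⟩

/-- The deficit of the runs with turn `e` avoiding `c`. -/
noncomputable def runDeficit (W : Loop) (e : Bool) (c : Letter) : ℤ :=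
  deficit (W.runs e c) fun r => gap r - 1

/-- Every long run has another run of the same type that is almost as long. -/
def IsMotif (W : Loop) : Prop := ∀ e c, ∀ r ∈ W.runs e c, 3 ≤ gap r →
  ∃ s ∈ W.runs e c, s ≠ r ∧ gap r ≤ gap s + 2

lemma IsMotif.bounds (h : W.IsMotif) (e : Bool) (c : Letter) :
    0 ≤ W.runDeficit e c ∧ ((W.runs e c).card = 1 → 1 ≤ W.runDeficit e c) ∧
      ∀ m : ℕ, m ≤ ((W.runs e c).filter fun r => 2 ≤ gap r).card →
        (m : ℤ) * (m - 2) ≤ W.runDeficit e c := by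
  have h1 := deficit_bounds (R := W.runs e c) (d := fun r => gap r - 1) fun r hr h2 => by
    obtain ⟨s, hs, hne, h3⟩ := h e c r hr (by omega)
    exact ⟨s, hs, hne, by omega⟩
  refine ⟨h1.1, h1.2.1, fun m hm => h1.2.2 m ?_⟩
  rwa [Finset.filter_congr fun r _ => show 1 ≤ gap r - 1 ↔ 2 ≤ gap r by omega]

/-- The number of runs with turn `e` strictly longer than all others of their type. -/
noncomputable def rankOf (W : Loop) (e : Bool) : ℕ :=
  ∑ c, (strictMax (W.runs e c) gap).card

lemma sum_runDeficit_eq (e : Bool) : ∑ c, W.runDeficit e c + (∑ a, (W.starts e a : ℤ)) ^ 2 -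
    ∑ a, (W.starts e a : ℤ) ^ 2 - 4 * ∑ a, (W.starts e a : ℤ) =
    W.minSum e - 2 * ∑ r ∈ W.Bd e, (gap r : ℤ) + 2 * W.rankOf e -
      2 * ∑ a, (W.starts e a : ℤ) ^ 2 := by
  have h1 : ∀ c, W.runDeficit e c = (∑ r ∈ W.runs e c, ∑ s ∈ W.runs e c,
      ((min (gap r) (gap s) : ℕ) : ℤ)) - 2 * (∑ r ∈ W.runs e c, (gap r : ℤ)) +
      2 * (strictMax (W.runs e c) gap).card - ((W.runs e c).card : ℤ) ^ 2 +
      2 * (W.runs e c).card := by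
    intro c
    have h2 : ∀ r : W.Pos, ((gap r - 1 : ℕ) : ℤ) = gap r - 1 := fun r => by
      have := one_le_gap r
      omega
    have h3 : ∀ r s : W.Pos, ((min (gap r - 1) (gap s - 1) : ℕ) : ℤ) =
        ((min (gap r) (gap s) : ℕ) : ℤ) - 1 := fun r s => by
      have := one_le_gap r
      have := one_le_gap s
      omega
    have h4 : strictMax (W.runs e c) (fun r => gap r - 1) = strictMax (W.runs e c) gap := by
      ext r
      simp only [strictMax, Finset.mem_filter]
      refine and_congr_right fun _ => forall₂_congr fun s _ => imp_congr_right fun _ => ?_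
      have := one_le_gap r
      have := one_le_gap s
      omega
    rw [runDeficit, deficit, h4]
    simp only [h2, h3, Finset.sum_sub_distrib, Finset.sum_const, nsmul_eq_mul, mul_one]
    ring
  have hx := card_runs (W := W) (e := e) (a := .y) (b := .z) (c := .x) (by simp) (by simp) (by simp)
  have hy := card_runs (W := W) (e := e) (a := .x) (b := .z) (c := .y) (by simp) (by simp) (by simp)
  have hz := card_runs (W := W) (e := e) (a := .x) (b := .y) (c := .z) (by simp) (by simp) (by simp)
  simp only [h1, sum_Bd, minSum, rankOf, Letter.sum_univ, hx, hy, hz]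
  push_cast
  ring

/-- The turns ahead of `q` and `q'` first differ at a place where `q` has turn `e`. -/
def Ahead (e : Bool) (q q' : W.Pos) : Prop :=
  ∃ k, (∀ j < k, tq (nx^[j + 1] q) = tq (nx^[j + 1] q')) ∧ tq (nx^[k + 1] q) = e ∧
    tq (nx^[k + 1] q') = !e

lemma Ahead.swap {e : Bool} {q q' : W.Pos} (h : Ahead e q q') : Ahead (!e) q' q := by
  obtain ⟨k, h1, h2, h3⟩ := h
  exact ⟨k, fun j hj => (h1 j hj).symm, h3, by simpa using h2⟩

lemma Ahead.asymm {e : Bool} {q q' : W.Pos} (h : Ahead e q q') : ¬ Ahead e q' q := by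
  rintro ⟨m, h1', h2', h3'⟩
  obtain ⟨k, h1, h2, h3⟩ := h
  rcases lt_trichotomy k m with h | rfl | h
  · have := h1' k h
    rw [h2, h3] at this
    simp at this
  · rw [h2] at h3'
    simp at h3'
  · have := h1 m h
    rw [h2', h3'] at this
    simp at this

lemma exists_tq_iterate_ne {q q' : W.Pos} (hl : lt q = lt q') (hp : pr q = pr q') (hne : q ≠ q') :
    ∃ k, tq (nx^[k + 1] q) ≠ tq (nx^[k + 1] q') := by
  by_contra! hall
  have hlt : ∀ j, lt (nx^[j] q) = lt (nx^[j] q') := fun j =>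
    lt_nx_iterate_eq hl hp (t := j) (fun k h1 _ => by
      obtain ⟨k, rfl⟩ := Nat.exists_eq_add_of_le' h1
      exact hall k)
  by_cases hd : q.2 = q'.2
  · obtain ⟨m, -, rfl⟩ := exists_nx_iterate hd
    have hper : ∀ p : W.Pos, p.2 = q.2 → lt (nx^[m] p) = lt p := by
      intro p hp2
      obtain ⟨j, -, rfl⟩ := exists_nx_iterate hp2.symm
      rw [hlt j, ← Function.iterate_add_apply, ← Function.iterate_add_apply, add_comm]
    have hm : (m : ZMod W.n) = 0 := by
      apply W.aper
      intro i
      obtain ⟨s, d⟩ := q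
      cases d
      · have := hper (i + m + 1, false) rfl
        rw [nx_iterate_false] at this
        simp only [lt, cond_false] at this
        rw [show i + m + 1 - 1 = i + (m : ZMod W.n) by ring,
          show i + m + 1 - m - 1 = i by ring] at this
        exact this.symm
      · have := hper (i, true) rfl
        rw [nx_iterate_true] at this
        exact this
    apply hne
    obtain ⟨s, d⟩ := q
    cases d
    · rw [nx_iterate_false, hm, sub_zero]
    · rw [nx_iterate_true, hm, add_zero]
  · obtain ⟨k, -, hk⟩ := exists_nx_iterate (q := q) (q' := rv q') (by
      revert hd
      rw [rv_snd]
      cases q.2 <;> cases q'.2 <;> simp)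
    have hb : k.bodd = false := by
      have := congrArg pr hk
      rw [pr_nx_iterate, pr_rv, hp] at this
      revert this
      cases pr q' <;> simp
    obtain ⟨m, rfl⟩ : ∃ m, k = m + m := by
      have := Nat.bodd_add_div2 k
      rw [hb] at this
      exact ⟨k.div2, by simp at this; omega⟩
    have h1 : nx^[m] q' = rv (nx^[m] q) := by
      rw [← rv_rv q', ← hk, nx_iterate_rv_add]
    have h2 := hlt m
    rw [h1] at h2
    exact lt_ne _ h2.symm

lemma ahead_total (e : Bool) {q q' : W.Pos} (hl : lt q = lt q') (hp : pr q = pr q') (hne : q ≠ q') :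
    Ahead e q q' ∨ Ahead e q' q := by
  have h := exists_tq_iterate_ne hl hp hne
  have h1 := Nat.find_spec h
  have h2 : ∀ j < Nat.find h, tq (nx^[j + 1] q) = tq (nx^[j + 1] q') := fun j hj =>
    not_not.1 (Nat.find_min h hj)
  by_cases h3 : tq (nx^[Nat.find h + 1] q) = e
  · refine Or.inl ⟨_, h2, h3, ?_⟩
    rw [h3] at h1
    exact (Bool.eq_not.2 h1.symm)
  · refine Or.inr ⟨_, fun j hj => (h2 j hj).symm, ?_, Bool.eq_not.2 h3⟩
    revert h1 h3
    cases tq (nx^[Nat.find h + 1] q) <;> cases tq (nx^[Nat.find h + 1] q') <;> cases e <;> simp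

/-- Two run boundaries that look alike. -/
structure Alike (e : Bool) (q q' : W.Pos) : Prop where
  left : q ∈ W.Bd e
  right : q' ∈ W.Bd e
  lt_eq : lt q = lt q'
  lt_rv_eq : lt (rv q) = lt (rv q')

namespace Alike

variable {e e' : Bool} {q q' : W.Pos}

lemma swap (h : Alike e q q') : Alike e q' q := ⟨h.right, h.left, h.lt_eq.symm, h.lt_rv_eq.symm⟩

lemma pr_eq (h : Alike e q q') : pr q = pr q' := by
  have h1 := (mem_Bd.1 h.left).1.trans (mem_Bd.1 h.right).1.symm
  rw [tq, tq, h.lt_eq, h.lt_rv_eq] at h1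
  simpa using h1

lemma nb (h : Alike e q q') (hg : Even (gap q) ↔ Even (gap q')) :
    Alike (!e) (Loop.nb q) (Loop.nb q') := by
  have h1 : lt (Loop.nb q) = lt (Loop.nb q') := by
    rw [Loop.nb, Loop.nb, lt_iterate le_rfl, lt_iterate le_rfl, h.lt_eq]
    have h2 : lt (nx q) = lt (nx q') := lt_nx_eq h.lt_eq h.pr_eq
      ((mem_Bd.1 h.left).2.trans (mem_Bd.1 h.right).2.symm)
    simp only [hg, h2]
  have h3 : lt (nx (Loop.nb q)) = lt (nx (Loop.nb q')) := by
    rw [lt_nx_nb h.left, lt_nx_nb h.right, h.lt_rv_eq]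
  refine ⟨nb_mem h.left, nb_mem h.right, h1, ?_⟩
  refine eq_third (b := lt (nx (Loop.nb q))) (lt_nx_ne _).symm (lt_ne _)
    (lt_nx_ne_rv (nb_mem h.left)).symm (h1 ▸ lt_ne _) (h3 ▸ (lt_nx_ne_rv (nb_mem h.right)).symm)

lemma ahead_of_gap_lt (h : Alike e q q') (hg : gap q < gap q') :
    Ahead (!e) q q' ∧ Ahead e (rv (Loop.nb q)) (rv (Loop.nb q')) := by
  have h1 : ∀ {p : W.Pos}, p ∈ W.Bd e → ∀ j < gap p, tq (nx^[j + 1] p) = e := fun hp j hj => by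
    rw [tq_of_le_gap (by omega) (by omega), (mem_Bd.1 hp).2]
  constructor
  · refine ⟨gap q, fun j hj => ?_, ?_, ?_⟩
    · rw [h1 h.left j hj, h1 h.right j (by omega)]
    · rw [tq_gap, (mem_Bd.1 h.left).2]
    · rw [h1 h.right _ hg, Bool.not_not]
  · have h2 : ∀ {p : W.Pos}, p ∈ W.Bd e → ∀ j, j + 1 < gap p →
        tq (nx^[j + 1] (rv (Loop.nb p))) = !e := by
      intro p hp j hj
      obtain ⟨m, hm⟩ := Nat.exists_eq_add_of_lt hj
      rw [Loop.nb, hm, show j + 1 + m + 1 = (j + 1) + (m + 1) by ring, nx_iterate_rv_add, tq_rv,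
        h1 hp m (by omega)]
    obtain ⟨g, hg'⟩ := Nat.exists_eq_add_of_le' (one_le_gap q)
    refine ⟨g, fun j hj => ?_, ?_, ?_⟩
    · rw [h2 h.left j (by omega), h2 h.right j (by omega)]
    · rw [← hg', Loop.nb, nx_iterate_rv, tq_rv, (mem_Bd.1 h.left).1, Bool.not_not]
    · exact h2 h.right g (by omega)

lemma cross (h : Alike e' q q') (h1 : Ahead (!e) (rv q) (rv q')) (h2 : Ahead e q' q) :
    ∃ p p' t i j, Cross e p p' t ∧ 1 ≤ i ∧ i ≤ t ∧ 1 ≤ j ∧ j ≤ t ∧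
      tq (nx^[i] p) ≠ tq (nx^[j] (p : W.Pos)) := by
  obtain ⟨k, hk, hk1, hk2⟩ := h1
  obtain ⟨m, hm, hm1, hm2⟩ := h2
  have hB := mem_Bd.1 h.left
  have hB' := mem_Bd.1 h.right
  obtain ⟨m, rfl⟩ : ∃ m', m = m' + 1 := by
    refine Nat.exists_eq_add_of_le' (Nat.one_le_iff_ne_zero.2 ?_)
    rintro rfl
    simp only [zero_add, Function.iterate_one] at hm1 hm2
    rw [hB'.2] at hm1
    rw [hB.2] at hm2
    rw [hm1] at hm2
    simp at hm2
  have back : ∀ p : W.Pos, nx^[k + 1] (rv (nx^[k + 1] (rv p))) = p := fun p => by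
    rw [nx_iterate_rv, rv_rv]
  have fwd : ∀ (p : W.Pos) j, nx^[k + 1 + j] (rv (nx^[k + 1] (rv p))) = nx^[j] p := fun p j => by
    rw [add_comm, Function.iterate_add_apply, back]
  have mid : ∀ (p : W.Pos) j, j ≤ k + 1 →
      nx^[j] (rv (nx^[k + 1] (rv p))) = rv (nx^[k + 1 - j] (rv p)) := fun p j hj => by
    rw [show k + 1 = j + (k + 1 - j) by omega, nx_iterate_rv_add]
    congr 3
    omega
  have hlt : lt (nx^[k] (rv q)) = lt (nx^[k] (rv q')) :=
    lt_nx_iterate_eq h.lt_rv_eq h.pr_eq (t := k) (fun j h1 h2 => by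
      obtain ⟨j, rfl⟩ := Nat.exists_eq_add_of_le' h1
      exact hk j (by omega))
  refine ⟨rv (nx^[k + 1] (rv q)), rv (nx^[k + 1] (rv q')), k + 1 + (m + 1), k + 1, k + 1 + 1,
    ⟨?_, ?_, ?_, ?_, ?_, ?_, ?_⟩, by omega, by omega, by omega, by omega, ?_⟩
  · rw [Function.iterate_succ_apply', Function.iterate_succ_apply', lt_rv_nx, lt_rv_nx, hlt]
  · simp [h.pr_eq]
  · rw [tq_rv, hk1, Bool.not_not]
  · rw [tq_rv, hk2, Bool.not_not]
  · intro j hj1 hj2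
    rcases le_or_gt j (k + 1) with hj | hj
    · rw [mid _ _ hj, mid _ _ hj, tq_rv, tq_rv]
      congr 1
      rcases Nat.eq_zero_or_pos (k + 1 - j) with h0 | h0
      · simp [h0, hB.1, hB'.1]
      · obtain ⟨i, hi⟩ := Nat.exists_eq_add_of_le' h0
        rw [hi]
        exact hk i (by omega)
    · obtain ⟨i, rfl⟩ := Nat.exists_eq_add_of_lt hj
      rw [add_assoc, fwd, fwd]
      exact (hm i (by omega)).symm
  · rw [add_assoc, fwd, hm2]
  · rw [add_assoc, fwd, hm1]
  · rw [fwd, back, Function.iterate_one, hB.1, hB.2]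
    simp

lemma ahead_nb_of_gap_eq (h : Alike e' q q') (hg : gap q = gap q') (h1 : Ahead e (rv q) (rv q')) :
    Ahead e (rv (Loop.nb q)) (rv (Loop.nb q')) := by
  obtain ⟨k, hk, hk1, hk2⟩ := h1
  have hB := mem_Bd.1 h.left
  have hB' := mem_Bd.1 h.right
  have far : ∀ {p : W.Pos} j, nx^[gap p + j] (rv (Loop.nb p)) = nx^[j] (rv p) := fun {p} j => by
    rw [add_comm, Function.iterate_add_apply, Loop.nb, nx_iterate_rv]
  have near : ∀ {p : W.Pos}, p ∈ W.Bd e' → ∀ j, 1 ≤ j → j < gap p →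
      tq (nx^[j] (rv (Loop.nb p))) = !e' := by
    intro p hp j h1 h2
    obtain ⟨m, hm⟩ := Nat.exists_eq_add_of_lt h2
    rw [Loop.nb, hm, add_assoc, nx_iterate_rv_add, tq_rv, tq_of_le_gap (by omega) (by omega),
      (mem_Bd.1 hp).2]
  refine ⟨gap q + k, fun j hj => ?_, ?_, ?_⟩
  · rcases lt_trichotomy (j + 1) (gap q) with h1 | h1 | h1
    · rw [near h.left _ (by omega) h1, near h.right _ (by omega) (by omega)]
    · have f1 := far (p := q) 0
      have f2 := far (p := q') 0
      rw [add_zero] at f1 f2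
      rw [h1, f1, hg, f2]
      simp [hB.1, hB'.1]
    · obtain ⟨i, hi⟩ := Nat.exists_eq_add_of_lt h1
      rw [hi, add_assoc, far, hg, far]
      exact hk i (by omega)
  · rw [add_assoc, far, hk1]
  · rw [add_assoc, hg, far, hk2]

end Alike

/-- A crossing whose overlap contains both kinds of turns. -/
def HasLong (W : Loop) (e : Bool) : Prop :=
  ∃ (q q' : W.Pos) (t i j : ℕ), Cross e q q' t ∧ 1 ≤ i ∧ i ≤ t ∧ 1 ≤ j ∧ j ≤ t ∧
      tq (nx^[i] q) ≠ tq (nx^[j] q)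

lemma Alike.ahead {e e' : Bool} {q q' : W.Pos} (hL : ¬ W.HasLong e) (h : Alike e' q q')
    (h1 : Ahead (!e) (rv q) (rv q')) : Ahead e q q' := by
  rcases ahead_total e h.lt_eq h.pr_eq (by
    rintro rfl
    exact h1.asymm h1) with h2 | h2
  · exact h2
  · exact absurd (h.cross h1 h2) hL

lemma Alike.ahead_nb {e e' : Bool} {q q' : W.Pos} (hL : ¬ W.HasLong e) (h : Alike e' q q')
    (h1 : Ahead (!e) (rv q) (rv q')) : Ahead (!e) (rv (Loop.nb q)) (rv (Loop.nb q')) := by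
  have h2 := h.ahead hL h1
  rcases lt_trichotomy (gap q) (gap q') with hg | hg | hg
  · obtain ⟨h3, h4⟩ := h.ahead_of_gap_lt hg
    by_cases he : e' = e
    · subst he
      exact absurd h3.swap (by simpa using h2.asymm)
    · rwa [← Bool.eq_not.2 he]
  · exact h.ahead_nb_of_gap_eq hg h1
  · obtain ⟨h3, h4⟩ := h.swap.ahead_of_gap_lt hg
    by_cases he : e' = e
    · subst he
      exact h4.swap
    · rw [Bool.eq_not.2 he, Bool.not_not] at h3
      exact absurd h3 h2.asymm

lemma exists_nb_iterate (k : ℕ) : ∀ r : W.Pos, tq (nx (nx^[k] r)) ≠ tq (nx^[k] r) →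
    tq (nx r) ≠ tq r → ∃ j, nb^[j] r = nx^[k] r := by
  induction k using Nat.strong_induction_on with
  | _ k ih =>
    intro r hp hr
    rcases Nat.eq_zero_or_pos k with rfl | hk
    · exact ⟨0, rfl⟩
    rcases lt_or_ge k (gap r) with h1 | h1
    · rw [← Function.iterate_succ_apply' (f := nx), tq_of_le_gap (by omega) (by omega),
        tq_of_le_gap (by omega) (by omega)] at hp
      exact absurd rfl hp
    · obtain ⟨m, rfl⟩ := Nat.exists_eq_add_of_le' h1
      have h2 : nx^[m + gap r] r = nx^[m] (nb r) := Function.iterate_add_apply _ _ _ _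
      rw [h2] at hp ⊢
      have := one_le_gap r
      obtain ⟨j, hj⟩ := ih m (by omega) (nb r) hp (by
        rw [nx_nb, tq_gap, nb, tq_of_le_gap this le_rfl]
        simp)
      exact ⟨j + 1, hj⟩

lemma not_mem_Bd_not {e : Bool} {r : W.Pos} (h : r ∈ W.Bd e) : r ∉ W.Bd (!e) := by
  intro h'
  have h1 := (mem_Bd.1 h).1
  rw [(mem_Bd.1 h').1] at h1
  simp at h1

lemma nb_mem' {e : Bool} {q : W.Pos} (h : q ∈ W.Bd (!e)) : nb q ∈ W.Bd e := by
  simpa using nb_mem h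

lemma lt_ne_of_starts_zero {e : Bool} {b c : Letter} (hc : W.starts e c = 0) (hbc : c ≠ b)
    {r : W.Pos} (hr : r ∈ W.runs e b) : lt r ≠ c ∧ lt (nb r) ≠ c := by
  have h1 := card_start (W := W) (e := e) hbc
  have h2 := card_end (W := W) (e := e) hbc
  rw [hc, Finset.card_eq_zero, Finset.filter_eq_empty_iff] at h1 h2
  exact ⟨h1 hr, h2 hr⟩

lemma nb_mem_runs {e : Bool} {a b c : Letter} (hac : a ≠ c) (hbc : b ≠ c) {r : W.Pos}
    (hr : r ∈ W.runs e b) (ha : lt (nb r) = a) : nb r ∈ W.runs (!e) c := by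
  have h1 := mem_runs.1 hr
  refine mem_runs.2 ⟨nb_mem h1.1, ?_⟩
  refine eq_third (a := a) (b := b) ?_ (ha ▸ lt_ne _) ?_ hac.symm hbc.symm
  · rintro rfl; exact lt_nb_ne_of_mem_runs hr ha
  · rw [← h1.2, ← lt_nx_nb h1.1]
    exact (lt_nx_ne_rv (nb_mem h1.1)).symm

lemma exists_nb_iterate_lt {e : Bool} {r s : W.Pos} (hr : r ∈ W.Bd e) (hs : s ∈ W.Bd e) {m : ℕ}
    (hm : 0 < m) (hper : nb^[m] r = r) : ∃ j < m, nb^[j] r = s ∨ nb^[j] r = io s := by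
  have key : ∀ p ∈ W.Bd e, r.2 = p.2 → ∃ j < m, nb^[j] r = p := by
    intro p hp hd
    obtain ⟨k, -, rfl⟩ := exists_nx_iterate hd
    have hne : ∀ {q : W.Pos}, q ∈ W.Bd e → tq (nx q) ≠ tq q := fun hq => by
      rw [(mem_Bd.1 hq).1, (mem_Bd.1 hq).2]; simp
    obtain ⟨j, hj⟩ := exists_nb_iterate k r (hne hp) (hne hr)
    have hper : Function.IsPeriodicPt nb m r := hper
    exact ⟨j % m, Nat.mod_lt _ hm, by rw [hper.iterate_mod_apply, hj]⟩
  by_cases hd : r.2 = s.2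
  · obtain ⟨j, hj, h⟩ := key s hs hd
    exact ⟨j, hj, Or.inl h⟩
  · obtain ⟨j, hj, h⟩ := key (io s) (io_mem hs) (by rw [io_snd]; exact Bool.eq_not.2 hd)
    exact ⟨j, hj, Or.inr h⟩

lemma card_not_runs_gap_le (e : Bool) (c : Letter) :
    ((W.runs (!e) c).filter fun x => 2 ≤ gap x).card ≤
      ((W.runs e c).filter fun x => 2 ≤ gap x).card := by
  apply Finset.card_le_card_of_injOn fun x => io (nb x)
  · intro x hx
    simp only [Finset.coe_filter, Set.mem_ofPred_eq, mem_runs] at hx ⊢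
    obtain ⟨⟨h1, h2⟩, h3⟩ := hx
    refine ⟨⟨io_mem (nb_mem' h1), ?_⟩, by rwa [gap_io_nb h1]⟩
    rw [lt_rv_io, lt_nx_nb h1, h2]
  · intro x hx y hy hxy
    simp only [Finset.coe_filter, Set.mem_ofPred_eq, mem_runs] at hx hy
    exact nb_inj hx.1.1 hy.1.1 (io_injective hxy)

lemma starts_not_le (e : Bool) (a : Letter) : W.starts (!e) a ≤ W.starts e a := by
  obtain ⟨c, hca, -⟩ := exists_third a a
  rw [← card_end (e := !e) hca.symm, ← card_start (e := e) hca.symm]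
  apply Finset.card_le_card_of_injOn fun x => io (nb x)
  · intro x hx
    simp only [Finset.coe_filter, Set.mem_ofPred_eq, mem_runs] at hx ⊢
    obtain ⟨⟨h1, h2⟩, h3⟩ := hx
    refine ⟨⟨io_mem (nb_mem' h1), ?_⟩, by rwa [lt_io]⟩
    rw [lt_rv_io, lt_nx_nb h1, h2]
  · intro x hx y hy hxy
    simp only [Finset.coe_filter, Set.mem_ofPred_eq, mem_runs] at hx hy
    exact nb_inj hx.1.1 hy.1.1 (io_injective hxy)

lemma starts_not (e : Bool) (a : Letter) : W.starts (!e) a = W.starts e a :=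
  le_antisymm (starts_not_le e a) (by simpa using starts_not_le (W := W) (!e) a)

/-- The runs with turn `e` avoiding `b` are `r` and `r'`, and no run starts with `c`. -/
structure TwoRuns (W : Loop) (e : Bool) (a b c : Letter) (r r' : W.Pos) : Prop where
  hab : a ≠ b
  hac : a ≠ c
  hbc : b ≠ c
  starts_zero : W.starts e c = 0
  starts_two : W.starts e b = 0 ∨ W.starts e b = 2
  runs_eq : W.runs e b = {r, r'}
  ne : r ≠ r'

namespace TwoRuns

variable {e : Bool} {a b c : Letter} {r r' : W.Pos}

lemma swap (h : W.TwoRuns e a b c r r') : W.TwoRuns e a b c r' r :=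
  ⟨h.hab, h.hac, h.hbc, h.starts_zero, h.starts_two, by rw [h.runs_eq, Finset.pair_comm], h.ne.symm⟩

lemma mem (h : W.TwoRuns e a b c r r') : r ∈ W.runs e b := by rw [h.runs_eq]; simp

lemma mem_Bd (h : W.TwoRuns e a b c r r') : r ∈ W.Bd e := (mem_runs.1 h.mem).1

lemma lt_of_mem (h : W.TwoRuns e a b c r r') {s : W.Pos} (hs : s ∈ W.runs e b) :
    lt s = a ∧ lt (nb s) = a := by
  have h1 := lt_ne_of_starts_zero h.starts_zero h.hbc.symm hs
  exact ⟨eq_third h.hbc (lt_ne_of_mem_runs hs) h1.1 h.hab h.hac,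
    eq_third h.hbc (lt_nb_ne_of_mem_runs hs) h1.2 h.hab h.hac⟩

lemma lt_of_mem' (h : W.TwoRuns e a b c r r') {s : W.Pos} (hs : s ∈ W.runs e a) :
    lt s = b ∧ lt (nb s) = b := by
  have h1 := lt_ne_of_starts_zero h.starts_zero h.hac.symm hs
  exact ⟨eq_third h.hac (lt_ne_of_mem_runs hs) h1.1 h.hab.symm h.hbc,
    eq_third h.hac (lt_nb_ne_of_mem_runs hs) h1.2 h.hab.symm h.hbc⟩

lemma nb_mem (h : W.TwoRuns e a b c r r') :
    nb r ∈ W.runs (!e) c := nb_mem_runs h.hac h.hbc h.mem (h.lt_of_mem h.mem).2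

lemma eq_or_eq (h : W.TwoRuns e a b c r r') {x : W.Pos} (hx : x ∈ W.runs (!e) c)
    (hl : lt (nb x) = a) : nb x = r ∨ nb x = r' := by
  have h1 := nb_mem_runs h.hab h.hbc.symm hx hl
  rw [Bool.not_not, h.runs_eq] at h1
  simpa using h1

lemma alike (h : W.TwoRuns e a b c r r') : Alike e r r' :=
  ⟨h.mem_Bd, h.swap.mem_Bd, (h.lt_of_mem h.mem).1.trans (h.lt_of_mem h.swap.mem).1.symm,
    (mem_runs.1 h.mem).2.trans (mem_runs.1 h.swap.mem).2.symm⟩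

lemma even_gap (h : W.TwoRuns e a b c r r') : Even (gap r) :=
  (lt_nb_eq_iff r).1 ((h.lt_of_mem h.mem).2.trans (h.lt_of_mem h.mem).1.symm)

lemma alike_nb (h : W.TwoRuns e a b c r r') : Alike (!e) (nb r) (nb r') :=
  h.alike.nb (iff_of_true h.even_gap h.swap.even_gap)

lemma lt_rv_io_ne (h : W.TwoRuns e a b c r r') : lt (rv (io r')) ≠ b := by
  rw [lt_rv_io, ← (mem_runs.1 h.swap.mem).2]
  exact lt_nx_ne_rv h.swap.mem_Bd

lemma nb_nb_of_even (h : W.TwoRuns e a b c r r') (hg : Even (gap (nb r))) : nb (nb r) = r' := by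
  have h1 : lt (nb (nb r)) = a := ((lt_nb_eq_iff _).2 hg).trans (h.lt_of_mem h.mem).2
  refine (h.eq_or_eq h.nb_mem h1).resolve_left fun h2 => ?_
  obtain ⟨j, hj, h3⟩ := exists_nb_iterate_lt h.mem_Bd h.swap.mem_Bd (m := 2) (by norm_num) h2
  interval_cases j
  · rcases h3 with h3 | h3
    · exact h.ne h3
    · apply h.lt_rv_io_ne
      rw [← h3]
      exact (mem_runs.1 h.mem).2
  · apply not_mem_Bd_not (e := e) (r := nb r) _ (mem_runs.1 h.nb_mem).1
    rcases h3 with h3 | h3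
    · exact (show nb r = r' from h3) ▸ h.swap.mem_Bd
    · exact (show nb r = io r' from h3) ▸ io_mem h.swap.mem_Bd

lemma nb_nb_mem_of_odd (h : W.TwoRuns e a b c r r') (hg : ¬ Even (gap (nb r))) :
    nb (nb r) ∈ W.runs e a := by
  have h1 : lt (nb (nb r)) = b := by
    refine eq_third h.hac ?_ (lt_nb_ne_of_mem_runs h.nb_mem) h.hab.symm h.hbc
    rw [← (h.lt_of_mem h.mem).2]
    exact fun h2 => hg ((lt_nb_eq_iff _).1 h2)
  have h2 := nb_mem_runs h.hab.symm h.hac.symm h.nb_mem h1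
  rwa [Bool.not_not] at h2

lemma nb_ne (h : W.TwoRuns e a b c r r') :
    nb r ≠ nb r' := fun h1 => h.ne (nb_inj h.mem_Bd h.swap.mem_Bd h1)

lemma card_runs_le (h : W.TwoRuns e a b c r r') : (W.runs e a).card ≤ 2 := by
  rw [card_runs (a := b) (b := c) h.hbc h.hab.symm h.hac.symm, h.starts_zero]
  rcases h.starts_two with h1 | h1 <;> omega

lemma nb_four_of_odd (h : W.TwoRuns e a b c r r') (hg : ¬ Even (gap (nb r)))
    (hg' : ¬ Even (gap (nb r'))) :
    nb (nb (nb (nb r))) = r' := by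
  have hf := h.nb_nb_mem_of_odd hg
  have hf' := h.swap.nb_nb_mem_of_odd hg'
  have hlt := h.lt_of_mem' hf
  have hx := nb_mem_runs h.hbc h.hac hf hlt.2
  have hxB := (mem_runs.1 hx).1
  have h1 : lt (nb (nb (nb (nb r)))) = a := by
    by_contra h2
    have h3 : lt (nb (nb (nb (nb r)))) = b :=
      eq_third h.hac h2 (lt_nb_ne_of_mem_runs hx) h.hab.symm h.hbc
    have h4 := nb_mem_runs h.hab.symm h.hac.symm hx h3
    rw [Bool.not_not] at h4
    have hne : nb (nb r) ≠ nb (nb r') := fun h5 =>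
      h.nb_ne (nb_inj (mem_runs.1 h.nb_mem).1 (mem_runs.1 h.swap.nb_mem).1 h5)
    have h5 : nb (nb (nb (nb r))) = nb (nb r) ∨ nb (nb (nb (nb r))) = nb (nb r') := by
      by_contra! h6
      have h7 : ({nb (nb (nb (nb r))), nb (nb r), nb (nb r')} : Finset W.Pos) ⊆ W.runs e a := by
        intro y
        simp only [Finset.mem_insert, Finset.mem_singleton]
        rintro (rfl | rfl | rfl) <;> assumption
      have h8 := (Finset.card_le_card h7).trans h.card_runs_le
      rw [Finset.card_eq_three.2 ⟨_, _, _, h6.1, h6.2, hne, rfl⟩] at h8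
      omega
    have h6 : lt (nb (nb (nb r))) = a := by
      rcases h5 with h5 | h5
      · rw [nb_inj hxB (mem_runs.1 h.nb_mem).1 h5]
        exact (h.lt_of_mem h.mem).2
      · rw [nb_inj hxB (mem_runs.1 h.swap.nb_mem).1 h5]
        exact (h.lt_of_mem h.swap.mem).2
    exact h.hab (h6.symm.trans hlt.2)
  refine (h.eq_or_eq hx h1).resolve_left fun h2 => ?_
  obtain ⟨j, hj, h3⟩ := exists_nb_iterate_lt h.mem_Bd h.swap.mem_Bd (m := 4) (by norm_num) h2
  have hodd : ∀ x ∈ W.runs (!e) c, x = r' ∨ x = io r' → False := by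
    intro x hx h3
    apply not_mem_Bd_not (e := e) (r := x) _ (mem_runs.1 hx).1
    rcases h3 with rfl | rfl
    · exact h.swap.mem_Bd
    · exact io_mem h.swap.mem_Bd
  interval_cases j
  · rcases h3 with h3 | h3
    · exact h.ne h3
    · apply h.lt_rv_io_ne
      rw [← h3]
      exact (mem_runs.1 h.mem).2
  · exact hodd _ h.nb_mem h3
  · apply h.hab
    have h4 := (h.lt_of_mem h.swap.mem).1
    rw [← h4, ← hlt.1]
    rcases h3 with h3 | h3
    · exact congrArg lt h3.symm
    · rw [← lt_io r']
      exact congrArg lt h3.symm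
  · exact hodd _ hx h3

lemma behind_total (h : W.TwoRuns e a b c r r') :
    Ahead (!e) (rv r) (rv r') ∨ Ahead (!e) (rv r') (rv r) :=
  ahead_total _ h.alike.lt_rv_eq (by simp [h.alike.pr_eq]) fun h1 => h.ne (rv_injective h1)

lemma false_of_swap (h : W.TwoRuns e a b c r r')
    (h1 : Ahead (!e) (rv r) (rv r') → Ahead (!e) (rv r') (rv r))
    (h2 : Ahead (!e) (rv r') (rv r) → Ahead (!e) (rv r) (rv r')) : False := by
  rcases h.behind_total with h3 | h3
  · exact h3.asymm (h1 h3)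
  · exact h3.asymm (h2 h3)

lemma behind_nb_nb (h : W.TwoRuns e a b c r r') (hL : ¬ W.HasLong e)
    (h1 : Ahead (!e) (rv r) (rv r')) :
    Ahead (!e) (rv (nb (nb r))) (rv (nb (nb r'))) :=
  h.alike_nb.ahead_nb hL (h.alike.ahead_nb hL h1)

lemma hasLong_of_even (h : W.TwoRuns e a b c r r') (hg : Even (gap (nb r)))
    (hg' : Even (gap (nb r'))) : W.HasLong e := by
  by_contra hL
  have h1 := h.behind_nb_nb hL
  have h2 := h.swap.behind_nb_nb hL
  rw [h.nb_nb_of_even hg, h.swap.nb_nb_of_even hg'] at h1 h2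
  exact h.false_of_swap h1 h2

lemma hasLong_of_odd (h : W.TwoRuns e a b c r r') (hg : ¬ Even (gap (nb r)))
    (hg' : ¬ Even (gap (nb r'))) : W.HasLong e := by
  by_contra hL
  have ev : ∀ {f : W.Pos}, f ∈ W.runs e a → Even (gap f) := fun hf =>
    (lt_nb_eq_iff _).1 ((h.lt_of_mem' hf).2.trans (h.lt_of_mem' hf).1.symm)
  have e1 := ev (h.nb_nb_mem_of_odd hg)
  have e2 := ev (h.swap.nb_nb_mem_of_odd hg')
  have step : ∀ {r r' : W.Pos}, W.TwoRuns e a b c r r' → ¬ Even (gap (nb r)) →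
      ¬ Even (gap (nb r')) → Even (gap (nb (nb r))) → Even (gap (nb (nb r'))) →
      Ahead (!e) (rv r) (rv r') → Ahead (!e) (rv r') (rv r) := by
    intro r r' h hg hg' e1 e2 h1
    have a3 := h.alike_nb.nb (iff_of_false hg hg')
    have h2 := (a3.nb (iff_of_true e1 e2)).ahead_nb hL (a3.ahead_nb hL (h.behind_nb_nb hL h1))
    rwa [h.nb_four_of_odd hg hg', h.swap.nb_four_of_odd hg' hg] at h2
  exact h.false_of_swap (step h hg hg' e1 e2) (step h.swap hg' hg e2 e1)

lemma hasLong_of_even_odd (h : W.TwoRuns e a b c r r')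
    (hN : ((W.runs e c).filter fun x => 2 ≤ gap x).card ≤ 2)
    (hg : Even (gap (nb r))) (hg' : ¬ Even (gap (nb r'))) : W.HasLong e := by
  by_contra hL
  have hN' := (card_not_runs_gap_le e c).trans hN
  have hr2 := h.nb_nb_of_even hg
  have hf := h.swap.nb_nb_mem_of_odd hg'
  have hSb : W.starts (!e) b = 2 := by
    rw [starts_not]
    refine h.starts_two.resolve_left fun h1 => ?_
    have h2 := card_runs (W := W) (e := e) (a := b) (b := c) h.hbc h.hab.symm h.hac.symm
    rw [h.starts_zero, h1, Finset.card_eq_zero] at h2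
    rw [h2] at hf
    simp at hf
  have hSa : W.starts (!e) a = 2 := by
    rw [starts_not]
    have h2 := card_runs (W := W) (e := e) (a := a) (b := c) h.hac h.hab h.hbc.symm
    rw [h.starts_zero, h.runs_eq, Finset.card_pair h.ne] at h2
    omega
  have three : ∀ {S : Finset W.Pos} {x y z : W.Pos}, S.card ≤ 2 → x ∈ S → y ∈ S → z ∈ S →
      x ≠ y → x ≠ z → y ≠ z → False := by
    intro S x y z hS hx hy hz h1 h2 h3
    have h4 : ({x, y, z} : Finset W.Pos) ⊆ S := by
      intro w
      simp only [Finset.mem_insert, Finset.mem_singleton]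
      rintro (rfl | rfl | rfl) <;> assumption
    have h5 := (Finset.card_le_card h4).trans hS
    rw [Finset.card_eq_three.2 ⟨x, y, z, h1, h2, h3, rfl⟩] at h5
    omega
  obtain ⟨x, hxB, hxr⟩ := exists_nb (e := !e) (x := r) (by simpa using h.mem_Bd)
  have hx : x ∈ W.runs (!e) c := by
    refine mem_runs.2 ⟨hxB, ?_⟩
    rw [← lt_nx_nb hxB, hxr]
    refine eq_third h.hab ?_ ?_ h.hac.symm h.hbc.symm
    · rw [← (h.lt_of_mem h.mem).1]; exact lt_nx_ne r
    · rw [← (mem_runs.1 h.mem).2]; exact lt_nx_ne_rv h.mem_Bd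
  have hlr := (h.lt_of_mem h.mem).2
  have hlr' := (h.lt_of_mem h.swap.mem).2
  have hxne : x ≠ nb r := by
    rintro rfl
    exact h.ne (hxr.symm.trans hr2)
  have hxne' : x ≠ nb r' := by
    rintro rfl
    rw [hxr] at hf
    exact h.hab ((mem_runs.1 hf).2.symm.trans (mem_runs.1 h.mem).2)
  have hlx : lt x = b := by
    refine eq_third h.hac (fun h1 => ?_) (lt_ne_of_mem_runs hx) h.hab.symm h.hbc
    exact three (S := (W.runs (!e) c).filter fun y => lt y = a)
      (by rw [card_start h.hac, hSa]) (Finset.mem_filter.2 ⟨hx, h1⟩)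
      (Finset.mem_filter.2 ⟨h.nb_mem, hlr⟩) (Finset.mem_filter.2 ⟨h.swap.nb_mem, hlr'⟩)
      hxne hxne' h.nb_ne
  obtain ⟨z, hz, hzx⟩ := Finset.exists_mem_ne (s := (W.runs (!e) c).filter fun y => lt y = b)
    (by rw [card_start h.hbc, hSb]; norm_num) x
  obtain ⟨hz, hlz⟩ := Finset.mem_filter.1 hz
  have hzB := (mem_runs.1 hz).1
  have hznb : z ≠ nb r := by
    rintro rfl
    exact h.hab (hlr.symm.trans hlz)
  have hznb' : z ≠ nb r' := by
    rintro rfl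
    exact h.hab (hlr'.symm.trans hlz)
  have hzg : 2 ≤ gap z := by
    have h1 : Even (gap z) := by
      rw [← lt_nb_eq_iff, hlz]
      refine eq_third h.hac (fun h1 => ?_) (lt_nb_ne_of_mem_runs hz) h.hab.symm h.hbc
      rcases h.eq_or_eq hz h1 with h2 | h2
      · exact hzx (nb_inj hzB hxB (h2.trans hxr.symm))
      · exact hznb (nb_inj hzB (mem_runs.1 h.nb_mem).1 (h2.trans hr2.symm))
    obtain ⟨k, hk⟩ := h1
    have := one_le_gap z
    omega
  have hg2 : 2 ≤ gap (nb r) := by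
    obtain ⟨k, hk⟩ := hg
    have := one_le_gap (nb r)
    omega
  have one : ∀ y ∈ W.runs (!e) c, y ≠ nb r → y ≠ z → gap y = 1 := by
    intro y hy h1 h2
    by_contra h3
    have := one_le_gap y
    exact three hN' (Finset.mem_filter.2 ⟨hy, by omega⟩) (Finset.mem_filter.2 ⟨h.nb_mem, hg2⟩)
      (Finset.mem_filter.2 ⟨hz, hzg⟩) h1 h2 hznb.symm
  have hx1 := one x hx hxne hzx.symm
  have hr1 := one _ h.swap.nb_mem h.nb_ne.symm hznb'.symm
  have hback : Ahead (!e) (rv r) (rv r') := by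
    refine ⟨0, by simp, ?_, ?_⟩
    · rw [← hxr, nb, hx1]
      simp [(Loop.mem_Bd.1 hxB).1]
    · obtain ⟨m, hm⟩ := Nat.exists_eq_add_of_le' hg2
      rw [← hr2, nb, hm, show m + 2 = 0 + 1 + (m + 1) by ring, nx_iterate_rv_add, tq_rv,
        tq_of_le_gap (by omega) (by omega), (Loop.mem_Bd.1 (mem_runs.1 h.nb_mem).1).2]
  have h1 := h.alike_nb.ahead hL (h.alike.ahead_nb hL hback)
  have h2 := (h.alike_nb.swap.ahead_of_gap_lt (by omega)).1
  rw [Bool.not_not] at h2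
  exact h1.asymm h2

end TwoRuns

lemma hasLong {e : Bool} {a b c : Letter} (hab : a ≠ b) (hac : a ≠ c) (hbc : b ≠ c)
    (hc : W.starts e c = 0) (ha : W.starts e a = 2) (hb : W.starts e b = 0 ∨ W.starts e b = 2)
    (hN : ((W.runs e c).filter fun x => 2 ≤ gap x).card ≤ 2) : W.HasLong e := by
  have h1 := card_runs (W := W) (e := e) (a := a) (b := c) hac hab hbc.symm
  rw [ha, hc] at h1
  obtain ⟨r, r', hne, hr⟩ := Finset.card_eq_two.1 h1
  have h : W.TwoRuns e a b c r r' := ⟨hab, hac, hbc, hc, hb, hr, hne⟩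
  by_cases h2 : Even (gap (nb r)) <;> by_cases h3 : Even (gap (nb r'))
  · exact h.hasLong_of_even h2 h3
  · exact h.hasLong_of_even_odd hN h2 h3
  · exact h.swap.hasLong_of_even_odd hN h3 h2
  · exact h.hasLong_of_odd h2 h3

lemma IsMotif.le_crossings (h : W.IsMotif) (e : Bool) :
    (W.n : ℤ) ≤ (W.crossings e).card + W.rankOf e + 3 := by
  have hn : (W.n : ℤ) ≤ ∑ r ∈ W.Bd e, (gap r : ℤ) := by exact_mod_cast le_sum_gap (W := W) e
  have hsum := sum_runDeficit_eq (W := W) e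
  have hle := minSum_le (W := W) e
  rcases starts_bound (S := W.starts e) (F := W.runDeficit e) (fun c => (h.bounds e c).1)
    (fun a b c hab hac hbc h1 => (h.bounds e c).2.1 (by rw [card_runs hab hac hbc, h1]))
    (fun a b c hab hac hbc h1 => by
      have h2 := starts_le (W := W) e hab hac hbc
      have h3 : ((W.runs e c).filter fun r => Even (gap r)).card ≤
          ((W.runs e c).filter fun r => 2 ≤ gap r).card := by
        refine Finset.card_le_card (Finset.monotone_filter_right _ fun r _ hr => ?_)
        obtain ⟨k, hk⟩ := hr
        have := one_le_gap r
        omega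
      have h4 := (h.bounds e c).2.2 (W.starts e a - W.starts e b) (by omega)
      rwa [Nat.cast_sub h1] at h4) with h1 | ⟨a, b, c, hab, hac, hbc, hc, ha, hb, hF⟩
  · linarith
  · have hF0 := Finset.sum_nonneg fun c (_ : c ∈ Finset.univ) => (h.bounds e c).1
    have hFc : W.runDeficit e c ≤ 0 :=
      (Finset.single_le_sum (fun c _ => (h.bounds e c).1) (Finset.mem_univ c)).trans hF
    obtain ⟨q, q', t, i, j, hx, hi, hi', hj, hj', hij⟩ := hasLong hab hac hbc hc ha hb (by
      by_contra! h3
      have := (h.bounds e c).2.2 3 h3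
      norm_num at this
      linarith)
    have hlt := minSum_lt hx hi hi' hj hj' hij
    have hS : ∀ f : Letter → ℤ, ∑ t, f t = f a + f b + f c := by
      intro f
      rw [Letter.sum_univ]
      cases a <;> cases b <;> cases c <;> simp at * <;> ring
    have hq : (∑ a, (W.starts e a : ℤ)) ^ 2 - ∑ a, (W.starts e a : ℤ) ^ 2 -
        4 * ∑ a, (W.starts e a : ℤ) = -8 := by
      rw [hS, hS, ha, hc]
      rcases hb with hb | hb <;> rw [hb] <;> norm_num
    omega

end Loop

section Words

variable {w : List Letter}

lemma cget_mod (w : List Letter) (i : ℕ) : cget w (i % w.length) = cget w i := by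
  rw [cget, cget, Nat.mod_mod]

lemma map_cget_range (w : List Letter) : (List.range w.length).map (cget w) = w := by
  refine List.ext_getElem (by simp) fun i h1 h2 => ?_
  simp [cget, Nat.mod_eq_of_lt h2, h2]

lemma map_range_mul {α : Type*} {f : ℕ → α} {g : ℕ} (hf : ∀ i, f (g + i) = f i) (k : ℕ) :
    (List.range (k * g)).map f = (List.replicate k ((List.range g).map f)).flatten := by
  induction k with
  | zero => simp
  | succ k ih =>
    rw [Nat.succ_mul, Nat.add_comm, List.range_add, List.map_append, List.map_map,
      List.replicate_succ, List.flatten_cons, ← ih]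
    congr 2
    exact funext hf

lemma Primitive.eq_zero_of_period (hw : Primitive w) {d : ℕ} (hd : d < w.length)
    (h : ∀ i, cget w (i + d) = cget w i) : d = 0 := by
  by_contra hd0
  have hg : Nat.gcd d w.length < w.length :=
    (Nat.le_of_dvd (Nat.pos_of_ne_zero hd0) (Nat.gcd_dvd_left _ _)).trans_lt hd
  obtain ⟨m, hm⟩ := Nat.exists_mul_mod_eq_gcd hg
  have h1 : ∀ m i, cget w (i + d * m) = cget w i := by
    intro m
    induction m with
    | zero => simp
    | succ m ih => intro i; rw [Nat.mul_succ, ← add_assoc, h, ih]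
  have h2 : ∀ i, cget w (Nat.gcd d w.length + i) = cget w i := by
    intro i
    rw [← h1 m i, ← hm.2, ← cget_mod w (i + d * m), ← cget_mod w (_ + i), Nat.mod_add_mod, add_comm]
  obtain ⟨k, hk⟩ := Nat.gcd_dvd_right d w.length
  refine hw ⟨(List.range (Nat.gcd d w.length)).map (cget w), k, ?_, by simpa using hg, 0, ?_⟩
  · rcases k with _ | _ | k
    · omega
    · omega
    · omega
  · rw [← map_range_mul h2, mul_comm, ← hk, map_cget_range, List.rotate_zero]

lemma bodd_mod {m n : ℕ} (h : 2 ∣ n) : (m % n).bodd = m.bodd := by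
  have h1 : n.bodd = false := by
    obtain ⟨k, rfl⟩ := h
    simp
  conv_rhs => rw [← Nat.mod_add_div m n]
  simp [h1]

lemma cget_val [NeZero w.length] (i : ZMod w.length) (k : ℕ) :
    cget w (i + k : ZMod w.length).val = cget w (i.val + k) := by
  rw [ZMod.val_add, ZMod.val_natCast, Nat.add_mod_mod, cget_mod]

lemma CyclRed.cget_ne (hw : CyclRed w) (i : ℕ) : cget w i ≠ cget w (i + 1) := by
  have h := hw.2 (i % w.length) (Nat.mod_lt _ (List.length_pos_iff.2 hw.1))
  rwa [cget_mod, ← cget_mod w (_ + 1), Nat.mod_add_mod, cget_mod] at h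

lemma InG.exists_cget_eq (hw : InG w) (s : Letter) : ∃ i, cget w i = s := by
  by_contra! h
  have h1 : 2 = 0 := hw.2.1.eq_zero_of_period (by have := hw.2.2.2; omega) fun i =>
    eq_third (h (i + 1)).symm (h _) (hw.1.cget_ne (i + 1)).symm (h _) (hw.1.cget_ne i)
  omega

/-- The loop of a word. -/
def InG.loop (hw : InG w) : Loop :=
  haveI : NeZero w.length := ⟨by have := hw.2.2.2; omega⟩
  { n := w.length
    lab := fun i => cget w i.val
    par := fun i => i.val.bodd
    adj := fun i => by
      have h := cget_val i 1
      rw [Nat.cast_one] at h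
      rw [h]
      exact hw.1.cget_ne _
    par_zero := by simp
    par_succ := fun i => by
      have h : (i + 1).val = (i.val + 1) % w.length := by
        have := ZMod.val_add i ((1 : ℕ) : ZMod w.length)
        rwa [ZMod.val_natCast, Nat.add_mod_mod, Nat.cast_one] at this
      rw [h, bodd_mod hw.2.2.1, Nat.bodd_succ]
    aper := fun d hd => by
      refine (ZMod.val_eq_zero d).1 (hw.2.1.eq_zero_of_period (ZMod.val_lt d) fun i => ?_)
      have h := hd (i : ZMod w.length)
      rwa [add_comm, cget_val, ZMod.val_natCast, cget_mod, add_comm] at h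
    surj := fun s => by
      obtain ⟨i, hi⟩ := hw.exists_cget_eq s
      exact ⟨i, by rw [ZMod.val_natCast, cget_mod, hi]⟩ }

lemma InG.loop_n (hw : InG w) : hw.loop.n = w.length := rfl

lemma InG.loop_lab_add (hw : InG w) (i : ZMod hw.loop.n) (k : ℕ) :
    hw.loop.lab (i + k) = cget w (i.val + k) :=
  haveI : NeZero w.length := hw.loop.ne
  cget_val i k

lemma InG.loop_lab_natCast (hw : InG w) (k : ℕ) : hw.loop.lab k = cget w k := by
  have h := hw.loop_lab_add 0 k
  rwa [zero_add, ZMod.val_zero, zero_add] at h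

lemma toGL_phiM : ∀ {l : List Letter}, 2 ∣ l.length → (phiM l : GL2Z) = (l.map Rm).prod
  | [], _ => by simp [phiM]
  | [_], h => by simp at h
  | a :: b :: t, h => by
    have ht : 2 ∣ t.length := by simpa [add_assoc] using h
    rw [phiM, map_mul, Loop.toGL_pairM, toGL_phiM ht]
    simp [mul_assoc]

lemma InG.toGL_phiM (hw : InG w) : (phiM w : GL2Z) = hw.loop.P hw.loop.n := by
  have h : ∀ k : ℕ, hw.loop.P k = (((List.range k).map (cget w)).map Rm).prod := by
    intro k
    induction k with
    | zero => simp [Loop.P_zero]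
    | succ k ih =>
      have h1 := hw.loop.P_succ k
      rw [Int.cast_natCast, loop_lab_natCast] at h1
      rw [Nat.cast_succ, h1, ih]
      simp [List.range_succ]
  rw [h, hw.loop_n, map_cget_range, _root_.toGL_phiM hw.2.2.1]

end Words

lemma not_mem_of_card_two {T : Finset Letter} (hT : T.card = 2) {a b c : Letter} (hab : a ≠ b)
    (hac : a ≠ c) (hbc : b ≠ c) (ha : a ∈ T) (hb : b ∈ T) : c ∉ T := by
  intro hc
  have h : ({a, b, c} : Finset Letter) ⊆ T := by
    simp [Finset.insert_subset_iff, ha, hb, hc]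
  have := Finset.card_le_card h
  rw [Finset.card_eq_three.2 ⟨a, b, c, hab, hac, hbc, rfl⟩] at this
  omega

lemma eq_of_card_two {T : Finset Letter} (hT : T.card = 2) {a b c : Letter} (hab : a ≠ b)
    (hbc : b ≠ c) (ha : a ∈ T) (hb : b ∈ T) (hc : c ∈ T) : c = a := by
  by_contra h
  exact not_mem_of_card_two hT hab (Ne.symm h) hbc ha hb hc

lemma card_univ_erase (c : Letter) : (Finset.univ.erase c).card = 2 := by
  rw [Finset.card_erase_of_mem (Finset.mem_univ _)]
  rfl

lemma mem_strictMax {α : Type*} {R : Finset α} {d : α → ℕ} {r : α} :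
    r ∈ strictMax R d ↔ r ∈ R ∧ ∀ s ∈ R, s ≠ r → d s < d r := by
  simp [strictMax]

namespace Loop

variable {W : Loop}

/-- The forward starting position of a run. -/
noncomputable def st (r : W.Pos) : W.Pos := if r.2 then r else io (nb r)

@[simp] lemma st_snd (r : W.Pos) : (st r).2 = true := by
  rcases r with ⟨i, _ | _⟩ <;> simp [st]

lemma st_mem {e : Bool} {r : W.Pos} (h : r ∈ W.Bd e) : ∃ e', st r ∈ W.Bd e' := by
  unfold st
  split_ifs
  exacts [⟨e, h⟩, ⟨!e, io_mem (nb_mem h)⟩]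

lemma gap_st {e : Bool} {r : W.Pos} (h : r ∈ W.Bd e) : gap (st r) = gap r := by
  unfold st
  split_ifs
  exacts [rfl, gap_io_nb h]

lemma lt_rv_st {e : Bool} {r : W.Pos} (h : r ∈ W.Bd e) : lt (rv (st r)) = lt (rv r) := by
  unfold st
  split_ifs
  · rfl
  · rw [lt_rv_io, lt_nx_nb h]

lemma st_inj {e : Bool} {r s : W.Pos} (hr : r ∈ W.Bd e) (hs : s ∈ W.Bd e) (h : st r = st s) :
    r = s := by
  unfold st at h
  split_ifs at h
  · exact h
  · exact absurd (io_mem (nb_mem hs)) (h ▸ not_mem_Bd_not hr)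
  · exact absurd (io_mem (nb_mem hr)) (h ▸ not_mem_Bd_not hs)
  · exact nb_inj hr hs (io_injective h)

lemma exists_st_eq (e : Bool) {e' : Bool} {q : W.Pos} (h : q ∈ W.Bd e') (hq : q.2 = true) :
    ∃ r ∈ W.Bd e, st r = q := by
  by_cases he : e = e'
  · exact ⟨q, he ▸ h, by simp [st, hq]⟩
  · have he : e = !e' := by cases e <;> cases e' <;> simp_all
    exact ⟨io (nb q), he ▸ io_mem (nb_mem h), by simp [st, hq, nb_io_nb h]⟩

end Loop

namespace InG

open Loop

variable {w : List Letter}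

lemma lt_iterate (hw : InG w) {q : hw.loop.Pos} (hq : q.2 = true) (k : ℕ) :
    lt (nx^[k] q) = cget w (q.1.val + k) := by
  obtain ⟨i, d⟩ := q
  obtain rfl : d = true := hq
  rw [nx_iterate_true]
  exact hw.loop_lab_add i k

lemma lt_rv (hw : InG w) {q : hw.loop.Pos} (hq : q.2 = true) :
    lt (rv q) = cget w (q.1.val + w.length - 1) := by
  obtain ⟨i, d⟩ := q
  obtain rfl : d = true := hq
  have h : i - 1 = i + ((w.length - 1 : ℕ) : ZMod hw.loop.n) := by
    have h1 := hw.2.2.2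
    have h2 : ((w.length : ℕ) : ZMod hw.loop.n) = 0 := ZMod.natCast_self _
    rw [Nat.cast_sub (by omega), h2]
    ring
  change hw.loop.lab (i - 1) = _
  rw [h, loop_lab_add, Nat.add_sub_assoc (by have := hw.2.2.2; omega)]

lemma runType_eq (hw : InG w) {e : Bool} {q : hw.loop.Pos} (hm : q ∈ hw.loop.Bd e)
    (hq : q.2 = true) : runType w q.1.val = Finset.univ.erase (lt (rv q)) := by
  have h0 := hw.lt_iterate hq 0
  have h1 := hw.lt_iterate hq 1
  simp only [Function.iterate_zero, Function.iterate_one, id, add_zero] at h0 h1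
  rw [runType, ← h0, ← h1]
  refine Finset.eq_of_subset_of_card_le ?_ ?_
  · simp [Finset.insert_subset_iff, (lt_ne q).symm, lt_nx_ne_rv hm]
  · rw [card_univ_erase, Finset.card_pair (lt_nx_ne q).symm]

lemma runAt (hw : InG w) {e : Bool} {q : hw.loop.Pos} (hm : q ∈ hw.loop.Bd e)
    (hq : q.2 = true) : RunAt w q.1.val (gap q + 1) := by
  have hg := one_le_gap q
  have hL := hw.2.2.2
  have hl := hw.lt_iterate hq
  have h0 := hl 0
  have h1 := hl 1
  simp only [Function.iterate_zero, Function.iterate_one, id, add_zero] at h0 h1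
  refine ⟨ZMod.val_lt q.1, by omega, gap_lt q, ⟨Finset.univ.erase (lt (rv q)), card_univ_erase _,
    fun j hj => ?_⟩, ?_, ?_⟩
  · rw [← hl, Finset.mem_erase]
    exact ⟨lt_ne_of_le_gap hm (by omega), Finset.mem_univ _⟩
  · rintro ⟨T, hT, h⟩
    have h3 := h (gap q + 1) (by omega)
    rw [← hl, ← nx_nb, lt_nx_nb hm] at h3
    refine not_mem_of_card_two hT (lt_nx_ne q).symm (lt_ne q).symm (lt_nx_ne_rv hm) ?_ ?_ h3
    · rw [h0]; exact h 0 (by omega)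
    · rw [h1]; exact h 1 (by omega)
  · rintro ⟨T, hT, h⟩
    refine not_mem_of_card_two hT (lt_nx_ne q).symm (lt_ne q).symm (lt_nx_ne_rv hm) ?_ ?_
      (hw.lt_rv hq ▸ h 0 (by omega))
    · have := h 1 (by omega)
      rwa [show q.1.val + w.length - 1 + 1 = q.1.val + w.length by omega, ← cget_mod,
        Nat.add_mod_right, cget_mod, ← h0] at this
    · have := h 2 (by omega)
      rwa [show q.1.val + w.length - 1 + 2 = q.1.val + 1 + w.length by omega, ← cget_mod,
        Nat.add_mod_right, cget_mod, ← h1] at this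

lemma exists_run (hw : InG w) {i len : ℕ} (h : RunAt w i len) :
    ∃ e, ∃ q ∈ hw.loop.Bd e, q.2 = true ∧ q.1.val = i ∧ gap q + 1 = len := by
  obtain ⟨hi, h2, -, ⟨T, hT, hmem⟩, hR, hL⟩ := h
  set q : hw.loop.Pos := ((i : ZMod hw.loop.n), true) with hqd
  have hq : q.2 = true := rfl
  have hv : q.1.val = i := by
    rw [hqd, ZMod.val_natCast]
    exact Nat.mod_eq_of_lt hi
  have hl := hw.lt_iterate hq
  rw [hv] at hl
  have hT' : ∀ j < len, lt (nx^[j] q) ∈ T := fun j hj => hl j ▸ hmem j hj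
  have hlast : lt (nx^[len] q) ∉ T := fun hc => hR ⟨T, hT, fun j hj => by
    rcases (Nat.lt_succ_iff.1 hj).lt_or_eq with h | rfl
    · exact hmem j h
    · exact hl j ▸ hc⟩
  have hfirst : lt (rv q) ∉ T := fun hc => hL ⟨T, hT, fun j hj => by
    rcases j with _ | j
    · have := hw.lt_rv hq
      rw [hv] at this
      exact this ▸ hc
    · have hw4 := hw.2.2.2
      rw [show i + w.length - 1 + (j + 1) = i + j + w.length by omega, ← cget_mod,
        Nat.add_mod_right, cget_mod]
      exact hmem j (by omega)⟩
  have hstep : ∀ j, tq (nx^[j + 2] q) = tq (nx^[j + 1] q) ↔ lt (nx^[j + 2] q) = lt (nx^[j] q) := by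
    intro j
    rw [Function.iterate_succ_apply' nx (j + 1), tq_nx_eq_iff, Function.iterate_succ_apply' nx j,
      lt_rv_nx]
  have hne : ∀ j, lt (nx^[j] q) ≠ lt (nx^[j + 1] q) := fun j => by
    rw [Function.iterate_succ_apply']
    exact (lt_nx_ne _).symm
  have hstart : tq (nx q) ≠ tq q := fun hc => by
    rw [tq_nx_eq_iff] at hc
    exact hfirst (hc ▸ hT' 1 (by omega))
  have heq : ∀ j, 1 ≤ j → j ≤ len - 1 → tq (nx^[j] q) = tq (nx q) := by
    intro j h1 h3
    induction j, h1 using Nat.le_induction with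
    | base => rfl
    | succ j h1 ih =>
      obtain ⟨m, rfl⟩ := Nat.exists_eq_add_of_le' h1
      rw [← ih (by omega), hstep]
      exact eq_of_card_two hT (hne m) (hne (m + 1)) (hT' _ (by omega)) (hT' _ (by omega))
        (hT' _ (by omega))
  have hend : tq (nx^[len - 1 + 1] q) ≠ tq (nx q) := by
    rw [← heq (len - 1) (by omega) le_rfl]
    obtain ⟨m, rfl⟩ := Nat.exists_eq_add_of_le' h2
    intro hc
    exact hlast ((hstep m).1 hc ▸ hT' m (by omega))
  refine ⟨tq (nx q), q, mem_Bd.2 ⟨Bool.eq_not_of_ne hstart.symm, rfl⟩, hq, hv, ?_⟩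
  rw [gap_eq (by omega) heq hend]
  omega

lemma exists_run_st (hw : InG w) (e : Bool) {i len : ℕ} (h : RunAt w i len) :
    ∃ r ∈ hw.loop.Bd e, (st r).1.val = i ∧ gap r + 1 = len ∧
      runType w i = Finset.univ.erase (lt (rv r)) := by
  obtain ⟨e', q, hm, hq, rfl, hg⟩ := hw.exists_run h
  obtain ⟨r, hr, rfl⟩ := exists_st_eq e hm hq
  exact ⟨r, hr, rfl, by rw [← hg, gap_st hr], by rw [hw.runType_eq hm hq, lt_rv_st hr]⟩

lemma runAt_st (hw : InG w) {e : Bool} {r : hw.loop.Pos} (hr : r ∈ hw.loop.Bd e) :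
    RunAt w (st r).1.val (gap r + 1) ∧
      runType w (st r).1.val = Finset.univ.erase (lt (rv r)) := by
  obtain ⟨e', hm⟩ := st_mem hr
  rw [← gap_st hr, ← lt_rv_st hr]
  exact ⟨hw.runAt hm (st_snd r), hw.runType_eq hm (st_snd r)⟩

lemma isMotif (hw : InG w) (h : MotifCond w) : hw.loop.IsMotif := by
  intro e c r hr hg
  obtain ⟨hr', rfl⟩ := mem_runs.1 hr
  obtain ⟨h1, h2⟩ := hw.runAt_st hr'
  obtain ⟨i', len', h3, h4, h5, h6⟩ := h _ _ h1 (by omega)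
  obtain ⟨s, hs, rfl, rfl, h7⟩ := hw.exists_run_st e h3
  rw [h2, h7] at h4
  refine ⟨s, mem_runs.2 ⟨hs, (Finset.erase_inj _ (Finset.mem_univ _)).1 h4⟩, ?_, by omega⟩
  rintro rfl
  exact h5 rfl

lemma rankOf_le (hw : InG w) (e : Bool) : hw.loop.rankOf e ≤ rank w := by
  have hfin : Finite {p : ℕ × ℕ // DistinguishedRun w p.1 p.2} :=
    Set.Finite.subset ((Finset.range w.length ×ˢ Finset.range w.length).finite_toSet)
      fun p hp => by simpa using ⟨hp.1.1, hp.1.2.2.1⟩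
  have hmem : ∀ {c r}, r ∈ strictMax (hw.loop.runs e c) gap → r ∈ hw.loop.Bd e ∧ lt (rv r) = c :=
    fun h => mem_runs.1 (mem_strictMax.1 h).1
  rw [rankOf, ← Finset.card_sigma, ← Nat.card_eq_finsetCard]
  refine Nat.card_le_card_of_injective
    (fun p => ⟨((st p.1.2).1.val, gap p.1.2 + 1), ?_⟩) ?_
  · obtain ⟨⟨c, r⟩, hp⟩ := p
    have hp : r ∈ strictMax (hw.loop.runs e c) gap := (Finset.mem_sigma.1 hp).2
    obtain ⟨hr, rfl⟩ := hmem hp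
    obtain ⟨h1, h2⟩ := hw.runAt_st hr
    refine ⟨h1, fun i' len' h3 h4 h5 => ?_⟩
    obtain ⟨s, hs, rfl, rfl, h7⟩ := hw.exists_run_st e h3
    rw [h2, h7] at h4
    have := (mem_strictMax.1 hp).2 s
      (mem_runs.2 ⟨hs, (Finset.erase_inj _ (Finset.mem_univ _)).1 h4⟩) (by rintro rfl; exact h5 rfl)
    exact Nat.succ_lt_succ this
  · rintro ⟨⟨c, r⟩, hr⟩ ⟨⟨c', s⟩, hs⟩ h
    obtain ⟨hr', rfl⟩ : r ∈ hw.loop.Bd e ∧ lt (rv r) = c := hmem (Finset.mem_sigma.1 hr).2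
    obtain ⟨hs', rfl⟩ : s ∈ hw.loop.Bd e ∧ lt (rv s) = c' := hmem (Finset.mem_sigma.1 hs).2
    simp only [Subtype.mk.injEq, Prod.mk.injEq] at h
    have h1 : st r = st s := Prod.ext (ZMod.val_injective _ h.1) (by simp)
    obtain rfl := st_inj hr' hs' h1
    rfl

lemma selfInt_bound (hw : InG w) (hm : MotifCond w) : (w.length : ℤ) ≤ Iw w + rank w + 3 := by
  obtain ⟨X, hX⟩ := hw.loop.exists_axis ⟨phiM w, phiM_mem w⟩ hw.toGL_phiM
  have hI : Iw w = ((sTwo X.v / 2 : ℕ) : ℤ) := by rw [Iw, ← hX, X.selfInt_eq]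
  have hd : Disjoint (hw.loop.crossings true) (hw.loop.crossings false) := by
    refine Finset.disjoint_left.2 fun p h1 h2 => ?_
    obtain ⟨d, t, h1⟩ := (Finset.mem_filter.1 h1).2
    obtain ⟨d', t', h2⟩ := (Finset.mem_filter.1 h2).2
    simpa [h1.start₁] using h2.start₁
  have hc := X.card_le_sTwo (hw.loop.crossings true ∪ hw.loop.crossings false) fun p hp => by
    rcases Finset.mem_union.1 hp with hp | hp <;>
    · obtain ⟨d, t, h⟩ := (Finset.mem_filter.1 hp).2
      exact X.meets_of_cross h rfl
  rw [Finset.card_union_of_disjoint hd] at hc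
  have h1 := (hw.isMotif hm).le_crossings true
  have h2 := (hw.isMotif hm).le_crossings false
  have h3 := hw.rankOf_le true
  have h4 := hw.rankOf_le false
  have h5 := hw.loop_n
  omega

end InG

theorem almost_simple_geodesics_stmt9 (w : List Letter) (hw : InG w) (hm : MotifCond w) :
    Lw w ≤ deltaW w + (rank w : ℤ) + 3 := by
  have h1 := hw.selfInt_bound hm
  have h2 := hw.2.2.1
  rw [deltaW, Lw]
  omega
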